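/- Fix A > 18. For X ≥ 2 set ρ = e^{−1/X} and define Φ(z) = Σ_{j≥1} (1/j) Σ_{p₁,p₂ prime} z^{p₁p₂j}. Let a ∈ ℤ, q ∈ ℕ with 2 ≤ q ≤ (log X)^A and (a,q) = 1, and let 𝔐(q,a) = (a/q − δ_q, a/q + δ_q) with δ_q = q^{−1}X^{−1}(log X)^A. Then for all sufficiently large X and all α ∈ 𝔐(q,a), |Re(Φ(ρ·e(α)))| ≤ (3/4)·Φ(ρ). -/

import Mathlib

open Filter Real Topology

noncomputable section

/-- `e(t) = exp(2πit)`. -/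
def eC (t : ℝ) : ℂ := Complex.exp (2 * Real.pi * Complex.I * t)

/-- `Φ(z) = Σ_{j ≥ 1} (1/j) Σ_{p₁, p₂ prime} z^{p₁p₂j}` (complex version). -/
def PhiP2C (z : ℂ) : ℂ :=
  ∑' (j : ℕ+) (p : Nat.Primes) (q : Nat.Primes),
    (1 / (j : ℂ)) * z ^ ((p : ℕ) * (q : ℕ) * (j : ℕ))

/-- `Φ(ρ) = Σ_{j ≥ 1} (1/j) Σ_{p₁, p₂ prime} ρ^{p₁p₂j}` (real version). -/
def PhiP2 (ρ : ℝ) : ℝ :=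
  ∑' (j : ℕ+) (p : Nat.Primes) (q : Nat.Primes),
    (1 / (j : ℝ)) * ρ ^ ((p : ℕ) * (q : ℕ) * (j : ℕ))

lemma three_div_one_add_sq_floor_le (v : ℝ) :
    (1 + v ^ 2)⁻¹ ≤ 3 * (1 + (⌊v⌋ : ℝ) ^ 2)⁻¹ := by
  have h1 := Int.floor_le v
  have h2 := Int.lt_floor_add_one v
  rw [← div_eq_mul_inv, inv_eq_one_div, div_le_div_iff₀ (by positivity) (by positivity)]
  nlinarith [sq_nonneg (v - (⌊v⌋ : ℝ)), sq_nonneg (2 * v - (⌊v⌋ : ℝ))]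

lemma summable_int_inv_one_add_sq : Summable fun k : ℤ => (1 + (k : ℝ) ^ 2)⁻¹ := by
  have h : Summable fun k : ℤ => 1 / (k : ℝ) ^ 2 :=
    Real.summable_one_div_int_pow.mpr one_lt_two
  refine Summable.of_norm_bounded_eventually h ?_
  rw [Filter.eventually_cofinite]
  refine (Set.finite_singleton (0 : ℤ)).subset fun k hk => ?_
  by_contra hk0
  apply hk
  have hk' : (k : ℝ) ≠ 0 := by simpa using hk0
  have : (0 : ℝ) < (k : ℝ) ^ 2 := by positivity
  rw [Real.norm_of_nonneg (by positivity), inv_eq_one_div]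
  gcongr
  linarith

/-- A sequence satisfying a Chebyshev-type bound has uniformly bounded mass, with respect to
`a n / n`, against translates of a quadratically decaying weight in `log n`. -/
lemma exists_tsum_weight_le {a : ℕ → ℝ} (ha : ∀ n, 0 ≤ a n) {C : ℝ}
    (hC : ∀ x : ℝ, 0 ≤ x → ∑ n ∈ Finset.Icc 0 ⌊x⌋₊, a n ≤ C * x) :
    ∃ B : ℝ, 0 < B ∧ ∀ u : ℝ, Summable (fun n : ℕ => a n / n * (1 + (log n - u) ^ 2)⁻¹) ∧
      ∑' n : ℕ, a n / n * (1 + (log n - u) ^ 2)⁻¹ ≤ B := by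
  have hC0 : 0 ≤ C := by
    have := (Finset.sum_nonneg fun n _ => ha n).trans (hC 1 zero_le_one)
    linarith
  set T : ℝ := ∑' k : ℤ, (1 + (k : ℝ) ^ 2)⁻¹
  have hT : 0 ≤ T := tsum_nonneg fun k => by positivity
  have key : ∀ u : ℝ, ∀ s : Finset ℕ,
      ∑ n ∈ s, a n / n * (1 + (log n - u) ^ 2)⁻¹ ≤ C * exp 1 * 3 * T := by
    intro u s
    set κ : ℕ → ℤ := fun n => ⌊log n - u⌋
    have hfib : ∀ k ∈ s.image κ, ∑ n ∈ s with κ n = k, a n / n * (1 + (log n - u) ^ 2)⁻¹ ≤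
        C * exp 1 * 3 * (1 + (k : ℝ) ^ 2)⁻¹ := by
      intro k _
      have h1 : ∀ n ∈ s.filter (κ · = k), a n / n * (1 + (log n - u) ^ 2)⁻¹ ≤
          (if n ∈ Finset.Icc 0 ⌊exp (u + k + 1)⌋₊ then a n else 0) *
            (exp (-(u + k)) * (3 * (1 + (k : ℝ) ^ 2)⁻¹)) := by
        intro n hn
        have hk : κ n = k := (Finset.mem_filter.mp hn).2
        rcases Nat.eq_zero_or_pos n with rfl | hn0
        · simp only [Nat.cast_zero, div_zero, zero_mul]
          refine mul_nonneg ?_ (by positivity)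
          split_ifs
          exacts [ha 0, le_rfl]
        have hn0' : (0 : ℝ) < n := by exact_mod_cast hn0
        have hlow : u + k ≤ log n := by
          have := Int.floor_le (log n - u)
          rw [show ⌊log n - u⌋ = k from hk] at this; linarith
        have hup : log n < u + k + 1 := by
          have := Int.lt_floor_add_one (log n - u)
          rw [show ⌊log n - u⌋ = k from hk] at this; linarith
        have hmem : n ∈ Finset.Icc 0 ⌊exp (u + k + 1)⌋₊ := by
          simp only [Finset.mem_Icc, zero_le, true_and]
          apply Nat.le_floor
          rw [← Real.exp_log hn0']
          exact exp_le_exp.mpr hup.le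
        rw [if_pos hmem, div_eq_mul_inv, mul_assoc]
        refine mul_le_mul_of_nonneg_left ?_ (ha n)
        refine mul_le_mul ?_ ?_ (by positivity) (by positivity)
        · rw [Real.exp_neg]
          refine inv_anti₀ (exp_pos _) ?_
          rw [← Real.exp_log hn0']
          exact exp_le_exp.mpr hlow
        · rw [← hk]; exact three_div_one_add_sq_floor_le _
      refine (Finset.sum_le_sum h1).trans ?_
      rw [← Finset.sum_mul]
      have h2 : ∑ n ∈ s.filter (κ · = k),
          (if n ∈ Finset.Icc 0 ⌊exp (u + k + 1)⌋₊ then a n else 0) ≤ C * exp (u + k + 1) := by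
        rw [← Finset.sum_filter]
        refine (Finset.sum_le_sum_of_subset_of_nonneg (fun n hn => (Finset.mem_filter.mp hn).2)
          fun n _ _ => ha n).trans (hC _ (exp_pos _).le)
      refine (mul_le_mul_of_nonneg_right h2 (by positivity)).trans_eq ?_
      have : exp (u + k + 1) * exp (-(u + k)) = exp 1 := by rw [← exp_add]; ring_nf
      calc _ = C * (exp (u + k + 1) * exp (-(u + k))) * 3 * (1 + (k : ℝ) ^ 2)⁻¹ := by ring
        _ = _ := by rw [this]
    rw [← Finset.sum_fiberwise_of_maps_to (fun n hn => Finset.mem_image_of_mem κ hn)]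
    refine (Finset.sum_le_sum hfib).trans ?_
    rw [← Finset.mul_sum]
    refine mul_le_mul_of_nonneg_left ?_ (by positivity)
    exact summable_int_inv_one_add_sq.sum_le_tsum _ fun k _ => by positivity
  have hnn : ∀ u : ℝ, 0 ≤ fun n : ℕ => a n / n * (1 + (log n - u) ^ 2)⁻¹ := fun u n => by
    have := ha n
    simp only [Pi.zero_apply]
    positivity
  refine ⟨C * exp 1 * 3 * T + 1, by positivity, fun u =>
    ⟨summable_of_sum_le (hnn u) (key u), ?_⟩⟩
  exact (tsum_le_of_sum_le (hnn u) (key u)).trans (by linarith)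

open FourierTransform MeasureTheory in
lemma fourier_sub_eq_fourier_mul_neg (g : ℝ → ℂ) (v u : ℝ) :
    𝓕 g (v - u) = 𝓕 (fun t : ℝ => g t * Complex.exp (-(2 * π * Complex.I * t * v : ℂ))) (-u) := by
  simp only [Real.fourier_real_eq_integral_exp_smul, smul_eq_mul]
  congr 1; ext t
  rw [mul_left_comm, ← Complex.exp_add, mul_comm]
  congr 2
  push_cast
  ring

open FourierTransform MeasureTheory in
lemma hasSum_fourier_mul_LSeries {a : ℕ → ℝ} {σ : ℝ}
    (hs : LSeriesSummable (fun n => (a n : ℂ)) σ) {g : ℝ → ℂ} (hg : Integrable g) (u : ℝ) :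
    HasSum (fun n : ℕ => LSeries.term (fun n => (a n : ℂ)) σ n * 𝓕 g (log n - u))
      (𝓕 (fun t : ℝ => g t * LSeries (fun n => (a n : ℂ)) (σ + 2 * π * t * Complex.I)) (-u)) := by
  set E : ℝ → ℂ := fun t => Complex.exp ((↑(-2 * π * t * (-u)) : ℂ) * Complex.I) with hE
  have hEn : ∀ t, ‖E t‖ = 1 := fun t => Complex.norm_exp_ofReal_mul_I _
  have hEc : Continuous E := by simp only [hE]; fun_prop
  have hterm : ∀ (n : ℕ) (t : ℝ), LSeries.term (fun n => (a n : ℂ)) (σ + 2 * π * t * Complex.I) n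
      = LSeries.term (fun n => (a n : ℂ)) σ n *
        Complex.exp (-(2 * π * Complex.I * t * (log n : ℝ) : ℂ)) := by
    intro n t
    rcases eq_or_ne n 0 with rfl | hn
    · simp
    · rw [LSeries.term_of_ne_zero hn, LSeries.term_of_ne_zero hn, Complex.cpow_add _ _ (by
        exact_mod_cast hn), div_mul_eq_div_div, div_eq_mul_inv (_ / _), ← Complex.cpow_neg,
        Complex.cpow_def_of_ne_zero (by exact_mod_cast hn : (n : ℂ) ≠ 0) (-_),
        ← Complex.natCast_log]
      congr 2
      ring
  have hnorm : ∀ (n : ℕ) (t : ℝ), ‖LSeries.term (fun n => (a n : ℂ)) (σ + 2 * π * t * Complex.I) n‖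
      = ‖LSeries.term (fun n => (a n : ℂ)) σ n‖ := by
    intro n t
    rw [hterm, norm_mul, show (-(2 * π * Complex.I * t * (log n : ℝ) : ℂ)) =
      (↑(-(2 * π * t * log n)) : ℂ) * Complex.I by push_cast; ring, Complex.norm_exp_ofReal_mul_I,
      mul_one]
  set F : ℕ → ℝ → ℂ := fun n t =>
    E t * (g t * LSeries.term (fun n => (a n : ℂ)) (σ + 2 * π * t * Complex.I) n) with hF
  have hFn : ∀ n t, ‖F n t‖ = ‖LSeries.term (fun n => (a n : ℂ)) σ n‖ * ‖g t‖ := by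
    intro n t
    simp only [hF, norm_mul, hEn, hnorm]; ring
  have hFi : ∀ n, Integrable (F n) := by
    intro n
    refine Integrable.mono' (hg.norm.const_mul ‖LSeries.term (fun n => (a n : ℂ)) σ n‖) ?_
      (Eventually.of_forall fun t => (hFn n t).le)
    refine hEc.aestronglyMeasurable.mul (hg.aestronglyMeasurable.mul ?_)
    simp only [hterm]
    exact Continuous.aestronglyMeasurable (by fun_prop)
  have hsum : Summable fun n => ∫ t, ‖F n t‖ := by
    simp only [hFn, integral_const_mul]
    exact hs.norm.mul_right _
  have h := hasSum_integral_of_summable_integral_norm hFi hsum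
  rw [show (fun n : ℕ => LSeries.term (fun n => (a n : ℂ)) σ n * 𝓕 g (log n - u)) =
    fun n => ∫ t, F n t from ?_, show 𝓕 (fun t : ℝ => g t *
      LSeries (fun n => (a n : ℂ)) (σ + 2 * π * t * Complex.I)) (-u) = ∫ t, ∑' n, F n t from ?_]
  · exact h
  · rw [Real.fourier_real_eq_integral_exp_smul]
    congr 1; ext t
    simp only [hF, hE, tsum_mul_left, smul_eq_mul]
    rfl
  · ext n
    rw [fourier_sub_eq_fourier_mul_neg, Real.fourier_real_eq_integral_exp_smul,
      ← integral_const_mul]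
    congr 1; ext t
    simp only [hF, hE, hterm, smul_eq_mul]
    ring

open FourierTransform MeasureTheory in
lemma integral_exp_mul_fourier_eq {ε : ℝ} (hε : 0 < ε) {g : ℝ → ℂ} (hg : Integrable g) (u : ℝ) :
    ∫ v in Set.Ioi (0 : ℝ), (exp (-ε * v) : ℂ) * 𝓕 g (v - u) =
      𝓕 (fun t : ℝ => g t * (ε + 2 * π * t * Complex.I)⁻¹) (-u) := by
  set E : ℝ → ℂ := fun t => Complex.exp ((↑(-2 * π * t * (-u)) : ℂ) * Complex.I) with hE
  have hEn : ∀ t, ‖E t‖ = 1 := fun t => Complex.norm_exp_ofReal_mul_I _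
  have hEc : Continuous E := by simp only [hE]; fun_prop
  have hswap : ∫ v in Set.Ioi (0 : ℝ), ∫ t : ℝ,
        E t * g t * Complex.exp (-(ε + 2 * π * t * Complex.I) * v) =
      ∫ t : ℝ, ∫ v in Set.Ioi (0 : ℝ),
        E t * g t * Complex.exp (-(ε + 2 * π * t * Complex.I) * v) := by
    apply integral_integral_swap
    have h1 : Integrable (fun z : ℝ × ℝ => exp (-ε * z.1) * ‖g z.2‖)
        ((volume.restrict (Set.Ioi (0 : ℝ))).prod volume) :=
      Integrable.mul_prod (integrableOn_exp_mul_Ioi (by linarith) 0) hg.norm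
    refine h1.mono' ?_ (Eventually.of_forall fun z => ?_)
    · refine AEStronglyMeasurable.mul (AEStronglyMeasurable.mul ?_ ?_) ?_
      · exact (hEc.comp continuous_snd).aestronglyMeasurable
      · exact hg.aestronglyMeasurable.comp_snd
      · exact Continuous.aestronglyMeasurable (by fun_prop)
    · simp only [Function.uncurry, norm_mul, hEn, one_mul, Complex.norm_exp]
      rw [mul_comm]
      simp
  have hL : ∀ v : ℝ, (exp (-ε * v) : ℂ) * 𝓕 g (v - u) =
      ∫ t : ℝ, E t * g t * Complex.exp (-(ε + 2 * π * t * Complex.I) * v) := by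
    intro v
    rw [fourier_sub_eq_fourier_mul_neg, Real.fourier_real_eq_integral_exp_smul,
      ← integral_const_mul]
    congr 1; ext t
    simp only [hE, smul_eq_mul]
    rw [show (-(ε + 2 * π * t * Complex.I) * v : ℂ) = (↑(-ε * v) : ℂ) +
      -(2 * π * Complex.I * t * v : ℂ) by push_cast; ring, Complex.exp_add, Complex.ofReal_exp]
    ring
  have hR : ∀ t : ℝ, ∫ v in Set.Ioi (0 : ℝ),
        E t * g t * Complex.exp (-(ε + 2 * π * t * Complex.I) * v) =
      E t * g t * (ε + 2 * π * t * Complex.I)⁻¹ := by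
    intro t
    rw [integral_const_mul, integral_exp_mul_complex_Ioi (by simpa using hε)]
    rw [Complex.ofReal_zero, mul_zero, Complex.exp_zero, neg_div_neg_eq, one_div]
  simp only [hL]
  rw [hswap, Real.fourier_real_eq_integral_exp_smul]
  congr 1; ext t
  rw [hR]
  simp only [hE, smul_eq_mul]
  ring

open SchwartzMap in
lemma SchwartzMap.exists_norm_le_inv_one_add_sq (f : 𝓢(ℝ, ℂ)) :
    ∃ D : ℝ, 0 < D ∧ ∀ v, ‖f v‖ ≤ D * (1 + v ^ 2)⁻¹ := by
  obtain ⟨C0, h0, hC0⟩ := f.decay 0 0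
  obtain ⟨C2, h2, hC2⟩ := f.decay 2 0
  refine ⟨C0 + C2, by positivity, fun v => ?_⟩
  have e0 := hC0 v
  have e2 := hC2 v
  simp only [pow_zero, one_mul, norm_iteratedFDeriv_zero, Real.norm_eq_abs, sq_abs] at e0 e2
  rw [← div_eq_mul_inv, le_div_iff₀ (by positivity)]
  linarith

open FourierTransform MeasureTheory SchwartzMap in
lemma tsum_mul_fourier_eq {a : ℕ → ℝ} (ha : ∀ n, 0 ≤ a n)
    (hw : ∀ u : ℝ, Summable (fun n : ℕ => a n / n * (1 + (log n - u) ^ 2)⁻¹))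
    (hs : ∀ σ : ℝ, 1 < σ → LSeriesSummable (fun n => (a n : ℂ)) σ)
    {G : ℂ → ℂ} (hGc : ContinuousOn G {s | 1 ≤ s.re}) {A : ℂ}
    (hG : ∀ s : ℂ, 1 < s.re → LSeries (fun n => (a n : ℂ)) s = G s + A / (s - 1))
    (g : 𝓢(ℝ, ℂ)) (hg : HasCompactSupport g) (u : ℝ) :
    ∑' n : ℕ, (a n / n : ℂ) * 𝓕 g (log n - u) =
      𝓕 (fun t : ℝ => g t * G (1 + 2 * π * t * Complex.I)) (-u) +
        A * ∫ v in Set.Ioi (0 : ℝ), 𝓕 g (v - u) := by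
  obtain ⟨D, hD, hDk⟩ := (𝓕 g).exists_norm_le_inv_one_add_sq
  set E : ℝ → ℂ := fun t => Complex.exp ((↑(-2 * π * t * (-u)) : ℂ) * Complex.I) with hE
  have hEn : ∀ t, ‖E t‖ = 1 := fun t => Complex.norm_exp_ofReal_mul_I _
  have hEc : Continuous E := by simp only [hE]; fun_prop
  have hkc := (𝓕 g).continuous
  have hGσ : ∀ σ : ℝ, 1 ≤ σ → Continuous fun t : ℝ => G (σ + 2 * π * t * Complex.I) := by
    intro σ hσ
    refine hGc.comp_continuous (by fun_prop) fun t => ?_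
    simpa using hσ
  have hev : ∀ᶠ σ : ℝ in 𝓝[>] 1, 1 < σ ∧ σ < 2 :=
    Ioo_mem_nhdsGT one_lt_two
  have hid : ∀ σ : ℝ, 1 < σ → ∑' n : ℕ, LSeries.term (fun n => (a n : ℂ)) σ n * 𝓕 g (log n - u) =
      (∫ t, E t * (g t * G (σ + 2 * π * t * Complex.I))) +
        A * ∫ v in Set.Ioi (0 : ℝ), (exp (-(σ - 1) * v) : ℂ) * 𝓕 g (v - u) := by
    intro σ hσ
    rw [fourier_coe, (hasSum_fourier_mul_LSeries (hs σ hσ) g.integrable u).tsum_eq,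
      integral_exp_mul_fourier_eq (sub_pos.mpr hσ) g.integrable u,
      Real.fourier_real_eq_integral_exp_smul, Real.fourier_real_eq_integral_exp_smul,
      ← integral_const_mul, ← integral_add]
    · congr 1; ext t
      rw [hG _ (by simpa using hσ)]
      simp only [hE, smul_eq_mul, Complex.ofReal_sub, Complex.ofReal_one]
      rw [div_eq_mul_inv, show (σ + 2 * π * t * Complex.I - 1 : ℂ) =
        σ - 1 + 2 * π * t * Complex.I by ring]
      ring
    · have h1 : Continuous fun t => E t * (g t * G (σ + 2 * π * t * Complex.I)) :=
        hEc.mul (g.continuous.mul (hGσ σ hσ.le))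
      exact h1.integrable_of_hasCompactSupport (hg.mul_right.mul_left)
    · refine Integrable.const_mul ?_ A
      have h1 : Continuous fun t : ℝ => (((σ - 1 : ℝ) : ℂ) + 2 * π * t * Complex.I)⁻¹ := by
        refine Continuous.inv₀ (by fun_prop) fun t h => ?_
        have := congrArg Complex.re h
        simp at this
        linarith
      exact (hEc.mul (g.continuous.mul h1)).integrable_of_hasCompactSupport
        (hg.mul_right.mul_left)
  have t1 : Tendsto (fun σ : ℝ => ∑' n : ℕ,
      LSeries.term (fun n => (a n : ℂ)) σ n * 𝓕 g (log n - u)) (𝓝[>] 1)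
      (𝓝 (∑' n : ℕ, (a n / n : ℂ) * 𝓕 g (log n - u))) := by
    refine tendsto_tsum_of_dominated_convergence ((hw u).mul_right D) (fun n => ?_) ?_
    · rcases eq_or_ne n 0 with rfl | hn
      · simp
      · refine Tendsto.mul_const _ ?_
        refine tendsto_nhdsWithin_of_tendsto_nhds ?_
        have : Continuous fun σ : ℝ => LSeries.term (fun n => (a n : ℂ)) σ n := by
          simp only [LSeries.term_of_ne_zero hn]
          refine continuous_const.div (Continuous.const_cpow (by fun_prop) (Or.inl (by
            exact_mod_cast hn))) fun σ => ?_
          rw [Ne, Complex.cpow_eq_zero_iff]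
          simp [hn]
        have h2 := this.tendsto 1
        simpa [LSeries.term_of_ne_zero hn] using h2
    · filter_upwards [hev] with σ hσ n
      rcases eq_or_ne n 0 with rfl | hn
      · simp
      · have hn1 : (1 : ℝ) ≤ n := by exact_mod_cast Nat.one_le_iff_ne_zero.mpr hn
        rw [norm_mul, mul_assoc]
        refine mul_le_mul ?_ ((hDk _).trans_eq (mul_comm _ _)) (norm_nonneg _)
          (div_nonneg (ha n) (by positivity))
        rw [LSeries.term_of_ne_zero hn, norm_div, Complex.norm_natCast_cpow_of_pos (by omega),
          Complex.norm_of_nonneg (ha n), Complex.ofReal_re]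
        refine div_le_div_of_nonneg_left (ha n) (by linarith) ?_
        calc (n : ℝ) = (n : ℝ) ^ (1 : ℝ) := (rpow_one _).symm
          _ ≤ _ := rpow_le_rpow_of_exponent_le hn1 hσ.1.le
  have t2 : Tendsto (fun σ : ℝ => ∫ t, E t * (g t * G (σ + 2 * π * t * Complex.I))) (𝓝[>] 1)
      (𝓝 (∫ t, E t * (g t * G (1 + 2 * π * t * Complex.I)))) := by
    set K : Set (ℝ × ℝ) := Set.Icc 1 2 ×ˢ tsupport g
    have hK : IsCompact K := isCompact_Icc.prod hg
    have hc : ContinuousOn (fun z : ℝ × ℝ => G (z.1 + 2 * π * z.2 * Complex.I)) K := by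
      refine hGc.comp (by fun_prop) fun z hz => ?_
      simpa using hz.1.1
    obtain ⟨M, hM⟩ := hK.exists_bound_of_continuousOn hc
    refine tendsto_integral_filter_of_dominated_convergence (fun t => ‖g t‖ * M) ?_ ?_ ?_ ?_
    · filter_upwards [hev] with σ hσ
      exact (hEc.mul (g.continuous.mul (hGσ σ hσ.1.le))).aestronglyMeasurable
    · filter_upwards [hev] with σ hσ
      refine Eventually.of_forall fun t => ?_
      rw [norm_mul, hEn, one_mul, norm_mul]
      by_cases ht : t ∈ tsupport g
      · exact mul_le_mul_of_nonneg_left (hM (σ, t) ⟨⟨hσ.1.le, hσ.2.le⟩, ht⟩) (norm_nonneg _)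
      · simp [image_eq_zero_of_notMem_tsupport ht]
    · exact g.integrable.norm.mul_const M
    · refine Eventually.of_forall fun t => ?_
      refine Tendsto.const_mul _ (Tendsto.const_mul _ ?_)
      have h1 : ContinuousWithinAt (fun σ : ℝ => G (σ + 2 * π * t * Complex.I)) (Set.Ici 1) 1 := by
        refine ContinuousWithinAt.comp (t := {s : ℂ | 1 ≤ s.re}) (hGc _ (by simp)) ?_ ?_
        · exact Continuous.continuousWithinAt (by fun_prop)
        · intro σ hσ
          simpa using hσ
      have := h1.tendsto.mono_left (nhdsWithin_mono _ Set.Ioi_subset_Ici_self)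
      simpa using this
  have t3 : Tendsto (fun σ : ℝ => ∫ v in Set.Ioi (0 : ℝ), (exp (-(σ - 1) * v) : ℂ) * 𝓕 g (v - u))
      (𝓝[>] 1) (𝓝 (∫ v in Set.Ioi (0 : ℝ), 𝓕 g (v - u))) := by
    refine tendsto_integral_filter_of_dominated_convergence (fun v => ‖𝓕 g (v - u)‖) ?_ ?_ ?_ ?_
    · refine Eventually.of_forall fun σ => ?_
      exact Continuous.aestronglyMeasurable
        (Continuous.mul (by fun_prop) (hkc.comp (by fun_prop)))
    · filter_upwards [hev] with σ hσ
      filter_upwards [ae_restrict_mem measurableSet_Ioi] with v hv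
      rw [norm_mul, Complex.norm_real, Real.norm_of_nonneg (exp_pos _).le]
      refine mul_le_of_le_one_left (norm_nonneg _) (exp_le_one_iff.mpr ?_)
      have : 0 ≤ (σ - 1) * v := mul_nonneg (by linarith [hσ.1]) (le_of_lt hv)
      linarith
    · exact ((𝓕 g).integrable.comp_sub_right u).norm.integrableOn
    · refine Eventually.of_forall fun v => ?_
      have h1 : Continuous fun σ : ℝ => (exp (-(σ - 1) * v) : ℂ) * 𝓕 g (v - u) := by fun_prop
      have := h1.tendsto 1
      refine (tendsto_nhdsWithin_of_tendsto_nhds this).congr' ?_ |>.trans ?_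
      · exact Eventually.of_forall fun _ => rfl
      · simp
  have t4 := t2.add (t3.const_mul A)
  have := tendsto_nhds_unique (t1.congr' ?_) t4
  · rw [this, Real.fourier_real_eq_integral_exp_smul]
    simp [hE]
  · filter_upwards [hev] with σ hσ using hid σ hσ.1

open FourierTransform MeasureTheory SchwartzMap in
lemma tendsto_tsum_mul_fourier {a : ℕ → ℝ} (ha : ∀ n, 0 ≤ a n)
    (hw : ∀ u : ℝ, Summable (fun n : ℕ => a n / n * (1 + (log n - u) ^ 2)⁻¹))
    (hs : ∀ σ : ℝ, 1 < σ → LSeriesSummable (fun n => (a n : ℂ)) σ)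
    {G : ℂ → ℂ} (hGc : ContinuousOn G {s | 1 ≤ s.re}) {A : ℂ}
    (hG : ∀ s : ℂ, 1 < s.re → LSeries (fun n => (a n : ℂ)) s = G s + A / (s - 1))
    (g : 𝓢(ℝ, ℂ)) (hg : HasCompactSupport g) :
    Tendsto (fun u : ℝ => ∑' n : ℕ, (a n / n : ℂ) * 𝓕 g (log n - u)) atTop (𝓝 (A * g 0)) := by
  simp only [tsum_mul_fourier_eq ha hw hs hGc hG g hg]
  have h1 : Tendsto (fun u : ℝ => 𝓕 (fun t : ℝ => g t * G (1 + 2 * π * t * Complex.I)) (-u)) atTop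
      (𝓝 0) :=
    (Real.zero_at_infty_fourier _).comp
      (tendsto_neg_atTop_atBot.mono_right atBot_le_cocompact)
  have h2 : Tendsto (fun u : ℝ => ∫ v in Set.Ioi (0 : ℝ), 𝓕 g (v - u)) atTop (𝓝 (g 0)) := by
    have e : ∀ u : ℝ, ∫ v in Set.Ioi (0 : ℝ), 𝓕 g (v - u) = ∫ v in Set.Ioi (-u), 𝓕 g v := by
      intro u
      rw [← integral_indicator measurableSet_Ioi, ← integral_indicator measurableSet_Ioi,
        ← integral_sub_right_eq_self (Set.indicator (Set.Ioi (-u)) _) u]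
      congr 1; ext v
      simp [Set.indicator_apply]
    simp only [e]
    have h3 : ∫ v, 𝓕 g v = g 0 := by
      have h4 : 𝓕⁻ (𝓕 g) = g := FourierTransform.fourierInv_fourier_eq g
      have h5 := congrArg (fun f : 𝓢(ℝ, ℂ) => f 0) h4
      simp only [fourierInv_coe, Real.fourierInv_eq'] at h5
      simpa using h5
    rw [← h3]
    have := (aecover_Ioi (μ := (volume : Measure ℝ)) (l := atTop) (a := fun u : ℝ => -u)
      tendsto_neg_atTop_atBot).integral_tendsto_of_countably_generated (𝓕 g).integrable
    exact this
  simpa using h1.add (h2.const_mul A)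

open FourierTransform MeasureTheory SchwartzMap in
lemma exists_schwartz_approximate_identity {η : ℝ} (hη : 0 < η) :
    ∃ g : 𝓢(ℝ, ℂ), HasCompactSupport g ∧ g 0 = 1 ∧
      Integrable (fun h : ℝ => |h| * (1 + h ^ 2) * ‖𝓕 g h‖) ∧
      ∫ h : ℝ, |h| * (1 + h ^ 2) * ‖𝓕 g h‖ ≤ η := by
  have hint : ∀ k : 𝓢(ℝ, ℂ), Integrable (fun h : ℝ => |h| * (1 + h ^ 2) * ‖k h‖) := by
    intro k
    refine ((k.integrable_pow_mul volume 1).add (k.integrable_pow_mul volume 3)).congr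
      (Eventually.of_forall fun h => ?_)
    simp only [Pi.add_apply, Real.norm_eq_abs]
    rw [← sq_abs h]; ring
  let b : ContDiffBump (0 : ℝ) := ⟨1, 2, one_pos, one_lt_two⟩
  have hbc : ContDiff ℝ (⊤ : ℕ∞) fun t : ℝ => ((b t : ℝ) : ℂ) :=
    Complex.ofRealCLM.contDiff.comp b.contDiff
  have hbs : HasCompactSupport fun t : ℝ => ((b t : ℝ) : ℂ) :=
    b.hasCompactSupport.comp_left Complex.ofReal_zero
  set k0 : 𝓢(ℝ, ℂ) := 𝓕 (hbs.toSchwartzMap hbc) with hk0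
  set I0 : ℝ := ∫ h : ℝ, |h| * (1 + h ^ 2) * ‖k0 h‖ with hI0
  have hI0n : 0 ≤ I0 := integral_nonneg fun h => by positivity
  set l : ℝ := 1 + I0 / η with hl
  have hl1 : 1 ≤ l := by rw [hl]; linarith [div_nonneg hI0n hη.le]
  have hl0 : 0 < l := by linarith
  have hgc : ContDiff ℝ (⊤ : ℕ∞) fun t : ℝ => ((b (t / l) : ℝ) : ℂ) :=
    hbc.comp (contDiff_id.div_const l)
  have hgs : HasCompactSupport fun t : ℝ => ((b (t / l) : ℝ) : ℂ) := by
    have := hbs.comp_homeomorph (Homeomorph.mulRight₀ l⁻¹ (by positivity))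
    simpa [Function.comp_def, div_eq_mul_inv] using this
  refine ⟨hgs.toSchwartzMap hgc, hgs, ?_, hint _, ?_⟩
  · have : b 0 = 1 := b.one_of_mem_closedBall (by simp [b.rIn_pos.le])
    simp [this]
  · have hk : ∀ h : ℝ, 𝓕 (hgs.toSchwartzMap hgc) h = l * k0 (l * h) := by
      intro h
      rw [hk0, fourier_coe, fourier_coe, Real.fourier_real_eq_integral_exp_smul,
        Real.fourier_real_eq_integral_exp_smul]
      have := MeasureTheory.Measure.integral_comp_div (fun s : ℝ =>
        Complex.exp ((↑(-2 * π * s * (l * h)) : ℂ) * Complex.I) • ((b s : ℝ) : ℂ)) l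
      rw [abs_of_pos hl0] at this
      change ∫ v : ℝ, _ • ((b (v / l) : ℝ) : ℂ) = l * ∫ v : ℝ, _ • ((b v : ℝ) : ℂ)
      rw [← Complex.real_smul, ← this]
      congr 1; ext t
      rw [show -2 * π * (t / l) * (l * h) = -2 * π * t * h by field_simp]
    calc ∫ h : ℝ, |h| * (1 + h ^ 2) * ‖𝓕 (hgs.toSchwartzMap hgc) h‖
        ≤ ∫ h : ℝ, |l * h| * (1 + (l * h) ^ 2) * ‖k0 (l * h)‖ := by
          refine integral_mono (hint _) ((hint k0).comp_mul_left' hl0.ne') fun h => ?_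
          simp only [hk, norm_mul, Complex.norm_real, Real.norm_of_nonneg hl0.le, abs_mul,
            abs_of_pos hl0, mul_pow]
          have h1 : h ^ 2 ≤ l ^ 2 * h ^ 2 :=
            le_mul_of_one_le_left (sq_nonneg h) (one_le_pow₀ hl1)
          have h2 : 0 ≤ l * |h| * ‖k0 (l * h)‖ := by positivity
          nlinarith [mul_le_mul_of_nonneg_left h1 h2]
      _ = l⁻¹ * I0 := by
          have := MeasureTheory.Measure.integral_comp_mul_left
            (fun h : ℝ => |h| * (1 + h ^ 2) * ‖k0 h‖) l
          rw [this, abs_of_pos (inv_pos.mpr hl0), smul_eq_mul]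
      _ ≤ η := by
          rw [inv_mul_le_iff₀ hl0, hl, add_mul, div_mul_cancel₀ _ hη.ne']
          linarith

lemma inv_one_add_sq_le_of_abs_sub_le {v w h : ℝ} (hw : |w - v| ≤ |h|) :
    (1 + w ^ 2)⁻¹ ≤ 2 * (1 + h ^ 2) * (1 + v ^ 2)⁻¹ := by
  rw [← div_eq_mul_inv, inv_eq_one_div, div_le_div_iff₀ (by positivity) (by positivity)]
  have h1 : (w - v) ^ 2 ≤ h ^ 2 := sq_le_sq.mpr hw
  nlinarith [sq_nonneg (2 * w - v), sq_nonneg (w * h), sq_nonneg w]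

lemma norm_sub_le_of_deriv_le_inv_one_add_sq {F F' : ℝ → ℂ} {C : ℝ}
    (hF : ∀ v, HasDerivAt F (F' v) v) (hC : ∀ v, ‖F' v‖ ≤ C * (1 + v ^ 2)⁻¹) (v h : ℝ) :
    ‖F v - F (v - h)‖ ≤ 2 * C * (1 + v ^ 2)⁻¹ * (|h| * (1 + h ^ 2)) := by
  have hC0 : 0 ≤ C := by
    have := (norm_nonneg _).trans (hC 0); simpa using this
  have := (convex_uIcc (v - h) v).norm_image_sub_le_of_norm_hasDerivWithin_le
    (f := F) (f' := F') (C := C * (2 * (1 + h ^ 2) * (1 + v ^ 2)⁻¹)) (x := v - h) (y := v)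
    (fun w _ => (hF w).hasDerivWithinAt) (fun w hw => ?_) Set.left_mem_uIcc Set.right_mem_uIcc
  · refine this.trans_eq ?_
    rw [sub_sub_cancel, Real.norm_eq_abs]; ring
  · refine (hC w).trans (mul_le_mul_of_nonneg_left (inv_one_add_sq_le_of_abs_sub_le ?_) hC0)
    have := Set.abs_sub_right_of_mem_uIcc hw
    rw [abs_sub_comm]
    simpa using this

open FourierTransform MeasureTheory SchwartzMap in
/-- A Wiener–Ikehara theorem, uniform over all test functions which together with their derivative
are bounded by a fixed multiple of `1 / (1 + v ^ 2)`. -/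
lemma wienerIkehara_uniform {a : ℕ → ℝ} (ha : ∀ n, 0 ≤ a n) {C₀ : ℝ}
    (hC₀ : ∀ x : ℝ, 0 ≤ x → ∑ n ∈ Finset.Icc 0 ⌊x⌋₊, a n ≤ C₀ * x)
    (hs : ∀ σ : ℝ, 1 < σ → LSeriesSummable (fun n => (a n : ℂ)) σ)
    {G : ℂ → ℂ} (hGc : ContinuousOn G {s | 1 ≤ s.re}) {A : ℂ}
    (hG : ∀ s : ℂ, 1 < s.re → LSeries (fun n => (a n : ℂ)) s = G s + A / (s - 1))
    {C ε : ℝ} (hC : 0 < C) (hε : 0 < ε) :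
    ∃ u₀ : ℝ, ∀ u : ℝ, u₀ ≤ u → ∀ F F' : ℝ → ℂ, (∀ v, HasDerivAt F (F' v) v) →
      (∀ v, ‖F v‖ ≤ C * (1 + v ^ 2)⁻¹) → (∀ v, ‖F' v‖ ≤ C * (1 + v ^ 2)⁻¹) →
      ‖∑' n : ℕ, (a n / n : ℂ) * F (log n - u) - A * ∫ v, F v‖ ≤ ε := by
  obtain ⟨B, hB0, hB⟩ := exists_tsum_weight_le ha hC₀
  set η : ℝ := ε / (4 * C * B) with hη
  have hη0 : 0 < η := by positivity
  obtain ⟨g, hgs, hg0, hgi, hgη⟩ := exists_schwartz_approximate_identity hη0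
  obtain ⟨D, hD, hDk⟩ := (𝓕 g).exists_norm_le_inv_one_add_sq
  set k : 𝓢(ℝ, ℂ) := 𝓕 g with hk
  have hkint : ∫ h, k h = 1 := by
    have h4 : 𝓕⁻ (𝓕 g) = g := FourierTransform.fourierInv_fourier_eq g
    have h5 := congrArg (fun f : 𝓢(ℝ, ℂ) => f 0) h4
    simp only [fourierInv_coe, Real.fourierInv_eq'] at h5
    rw [← hg0]
    simpa using h5
  set L : ℝ → ℂ := fun x => ∑' n : ℕ, (a n / n : ℂ) * k (log n - x) with hL
  have han : ∀ n : ℕ, ‖(a n / n : ℂ)‖ = a n / n := fun n => by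
    rw [norm_div, Complex.norm_of_nonneg (ha n), Complex.norm_natCast]
  have hterm : ∀ x : ℝ, ∀ n : ℕ, ‖(a n / n : ℂ) * k (log n - x)‖ ≤
      D * (a n / n * (1 + (log n - x) ^ 2)⁻¹) := by
    intro x n
    rw [norm_mul, han]
    have := mul_le_mul_of_nonneg_left (hDk (log n - x)) (div_nonneg (ha n) n.cast_nonneg)
    linarith
  have hLs : ∀ x, Summable fun n : ℕ => (a n / n : ℂ) * k (log n - x) := fun x =>
    Summable.of_norm_bounded ((hB x).1.mul_left D) (hterm x)
  have hLb : ∀ x, ‖L x‖ ≤ D * B := fun x =>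
    (tsum_of_norm_bounded ((hB x).1.mul_left D).hasSum (hterm x)).trans (by
      rw [tsum_mul_left]; exact mul_le_mul_of_nonneg_left (hB x).2 hD.le)
  have hLlim : Tendsto L atTop (𝓝 A) := by
    simpa [hg0] using tendsto_tsum_mul_fourier ha (fun u => (hB u).1) hs hGc hG g hgs
  have hLm : AEStronglyMeasurable L := by
    refine (stronglyMeasurable_of_tendsto (u := atTop) (f := fun N : ℕ => fun x =>
      ∑ n ∈ Finset.range N, (a n / n : ℂ) * k (log n - x)) (fun N => ?_)
      (tendsto_pi_nhds.mpr fun x => (hLs x).hasSum.tendsto_sum_nat)).aestronglyMeasurable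
    refine Continuous.stronglyMeasurable (continuous_finsetSum _ fun n _ => ?_)
    exact continuous_const.mul (k.continuous.comp (by fun_prop))
  have hw : Integrable fun w : ℝ => (1 + w ^ 2)⁻¹ := integrable_inv_one_add_sq
  have hLu : ∀ u, AEStronglyMeasurable fun w => L (u + w) := fun u =>
    hLm.comp_measurePreserving (measurePreserving_add_left volume u)
  have hJb : ∀ u w : ℝ, ‖(1 + w ^ 2)⁻¹ * ‖L (u + w) - A‖‖ ≤ (1 + w ^ 2)⁻¹ * (D * B + ‖A‖) := by
    intro u w
    rw [Real.norm_of_nonneg (by positivity)]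
    gcongr
    exact (norm_sub_le _ _).trans (add_le_add_left (hLb _) _)
  have hJm : ∀ u, AEStronglyMeasurable fun w : ℝ => (1 + w ^ 2)⁻¹ * ‖L (u + w) - A‖ := fun u =>
    hw.aestronglyMeasurable.mul ((hLu u).sub aestronglyMeasurable_const).norm
  have hJ : Tendsto (fun u : ℝ => ∫ w : ℝ, (1 + w ^ 2)⁻¹ * ‖L (u + w) - A‖) atTop (𝓝 0) := by
    rw [show (0 : ℝ) = ∫ w : ℝ, (0 : ℝ) by simp]
    refine tendsto_integral_filter_of_dominated_convergence
      (fun w : ℝ => (1 + w ^ 2)⁻¹ * (D * B + ‖A‖)) (Eventually.of_forall hJm)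
      (Eventually.of_forall fun u => Eventually.of_forall (hJb u)) (hw.mul_const _)
      (Eventually.of_forall fun w => ?_)
    have h1 : Tendsto (fun u : ℝ => L (u + w)) atTop (𝓝 A) :=
      hLlim.comp (tendsto_atTop_add_const_right _ w tendsto_id)
    simpa using (h1.sub_const A).norm.const_mul (1 + w ^ 2)⁻¹
  obtain ⟨u₀, hu₀⟩ := (hJ.eventually (gt_mem_nhds (show 0 < ε / (2 * C) by positivity))).exists_forall_of_atTop
  refine ⟨u₀, fun u hu F F' hF hFb hF'b => ?_⟩
  have hFc : Continuous F := continuous_iff_continuousAt.mpr fun v => (hF v).continuousAt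
  have hFi : Integrable F :=
    (hw.const_mul C).mono' hFc.aestronglyMeasurable (Eventually.of_forall hFb)
  have hprodi : ∀ v, Integrable fun w => F w * k (v - w) := by
    intro v
    refine (hw.const_mul (C * D)).mono'
      (hFc.mul (k.continuous.comp (by fun_prop))).aestronglyMeasurable
      (Eventually.of_forall fun w => ?_)
    rw [norm_mul]
    have h1 : ‖k (v - w)‖ ≤ D := (hDk _).trans (mul_le_of_le_one_right hD.le
      (inv_le_one_of_one_le₀ (by nlinarith [sq_nonneg (v - w)])))
    calc ‖F w‖ * ‖k (v - w)‖ ≤ (C * (1 + w ^ 2)⁻¹) * D :=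
          mul_le_mul (hFb w) h1 (norm_nonneg _) (by positivity)
      _ = _ := by ring
  set S : ℝ → ℂ := fun v => ∫ w, F w * k (v - w) with hS
  have hSF : ∀ v, ‖F v - S v‖ ≤ 2 * C * η * (1 + v ^ 2)⁻¹ := by
    intro v
    have e1 : S v = ∫ h, F (v - h) * k h := by
      rw [hS, ← integral_sub_left_eq_self _ volume v]
      simp
    have i1 : Integrable fun h => F (v - h) * k h := by
      have := (hprodi v).comp_sub_left v
      simpa using this
    rw [e1, show F v = ∫ h, F v * k h by rw [integral_const_mul, hkint, mul_one],
      ← integral_sub (k.integrable.const_mul _) i1]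
    refine (norm_integral_le_of_norm_le (hgi.const_mul (2 * C * (1 + v ^ 2)⁻¹))
      (Eventually.of_forall fun h => ?_)).trans ?_
    · rw [← sub_mul, norm_mul]
      have := mul_le_mul_of_nonneg_right
        (norm_sub_le_of_deriv_le_inv_one_add_sq hF hF'b v h) (norm_nonneg (k h))
      linarith
    · rw [integral_const_mul]
      have := mul_le_mul_of_nonneg_left hgη (show 0 ≤ 2 * C * (1 + v ^ 2)⁻¹ by positivity)
      linarith
  have hd : ∀ n : ℕ, ‖(a n / n : ℂ) * (F (log n - u) - S (log n - u))‖ ≤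
      2 * C * η * (a n / n * (1 + (log n - u) ^ 2)⁻¹) := by
    intro n
    rw [norm_mul, han]
    have := mul_le_mul_of_nonneg_left (hSF (log n - u)) (div_nonneg (ha n) n.cast_nonneg)
    linarith
  have hds := Summable.of_norm_bounded ((hB u).1.mul_left (2 * C * η)) hd
  have hdn : ‖∑' n : ℕ, (a n / n : ℂ) * (F (log n - u) - S (log n - u))‖ ≤ ε / 2 := by
    refine (tsum_of_norm_bounded ((hB u).1.mul_left (2 * C * η)).hasSum hd).trans ?_
    rw [tsum_mul_left]
    refine (mul_le_mul_of_nonneg_left (hB u).2 (by positivity)).trans_eq ?_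
    rw [hη]; field_simp; norm_num
  have hFw : Integrable fun w => F w * L (u + w) :=
    (hFi.norm.mul_const (D * B)).mono' (hFc.aestronglyMeasurable.mul (hLu u))
      (Eventually.of_forall fun w => by
        rw [norm_mul]; exact mul_le_mul_of_nonneg_left (hLb _) (norm_nonneg _))
  have hswap : HasSum (fun n : ℕ => (a n / n : ℂ) * S (log n - u)) (∫ w, F w * L (u + w)) := by
    have hi : ∀ n : ℕ, Integrable fun w => (a n / n : ℂ) * (F w * k (log n - u - w)) := fun n =>
      (hprodi _).const_mul _
    have h1 : ∀ n : ℕ, (a n / n : ℂ) * S (log n - u) =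
        ∫ w, (a n / n : ℂ) * (F w * k (log n - u - w)) := fun n => by
      rw [integral_const_mul]
    have h2 : ∀ w, F w * L (u + w) = ∑' n : ℕ, (a n / n : ℂ) * (F w * k (log n - u - w)) := by
      intro w
      rw [hL, ← tsum_mul_left]
      refine tsum_congr fun n => ?_
      rw [← sub_sub]; ring
    simp only [h1, h2]
    refine hasSum_integral_of_summable_integral_norm hi ?_
    refine summable_of_sum_le (c := ∫ w, ‖F w‖ * (D * B)) (fun n =>
      integral_nonneg fun w => norm_nonneg _) fun s => ?_
    rw [← integral_finsetSum _ fun n _ => (hi n).norm]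
    refine integral_mono (integrable_finsetSum _ fun n _ => (hi n).norm)
      (hFi.norm.mul_const _) fun w => ?_
    have h3 : ∀ n ∈ s, ‖(a n / n : ℂ) * (F w * k (log n - u - w))‖ ≤
        ‖F w‖ * (D * (a n / n * (1 + (log n - (u + w)) ^ 2)⁻¹)) := by
      intro n _
      rw [mul_left_comm, norm_mul, sub_sub]
      exact mul_le_mul_of_nonneg_left (hterm _ n) (norm_nonneg _)
    refine (Finset.sum_le_sum h3).trans ?_
    rw [← Finset.mul_sum, ← Finset.mul_sum]
    gcongr
    refine ((hB (u + w)).1.sum_le_tsum s fun n _ => ?_).trans (hB (u + w)).2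
    exact mul_nonneg (div_nonneg (ha n) n.cast_nonneg) (by positivity)
  have hmain : ‖(∫ w, F w * L (u + w)) - A * ∫ v, F v‖ ≤ ε / 2 := by
    rw [← integral_const_mul, ← integral_sub hFw (hFi.const_mul A)]
    have i2 : Integrable fun w : ℝ => C * ((1 + w ^ 2)⁻¹ * ‖L (u + w) - A‖) :=
      ((hw.mul_const (D * B + ‖A‖)).mono' (hJm u) (Eventually.of_forall (hJb u))).const_mul C
    refine (norm_integral_le_of_norm_le i2 (Eventually.of_forall fun w => ?_)).trans ?_
    · rw [mul_comm A, ← mul_sub, norm_mul, ← mul_assoc]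
      exact mul_le_mul_of_nonneg_right (hFb w) (norm_nonneg _)
    · rw [integral_const_mul]
      have := mul_le_mul_of_nonneg_left (hu₀ u hu).le hC.le
      refine this.trans_eq ?_
      field_simp
  have hsplit : ∑' n : ℕ, (a n / n : ℂ) * F (log n - u) =
      (∑' n : ℕ, (a n / n : ℂ) * (F (log n - u) - S (log n - u))) + ∫ w, F w * L (u + w) := by
    rw [← hswap.tsum_eq, ← hds.tsum_add hswap.summable]
    refine tsum_congr fun n => ?_
    ring
  rw [hsplit, add_sub_assoc]
  exact (norm_add_le _ _).trans (by linarith)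

lemma summable_and_tsum_succ_mul_exp_neg_le :
    Summable (fun k : ℕ => ((k : ℝ) + 1) * exp (-k)) ∧ ∑' k : ℕ, ((k : ℝ) + 1) * exp (-k) ≤ 3 := by
  have hr : ‖exp (-1)‖ < 1 := by
    rw [Real.norm_of_nonneg (exp_pos _).le, exp_lt_one_iff]; norm_num
  have h1 := hasSum_coe_mul_geometric_of_norm_lt_one hr
  have h2 := hasSum_geometric_of_norm_lt_one hr
  have h3 := h1.add h2
  have e : (fun k : ℕ => ((k : ℝ) + 1) * exp (-k)) =
      fun k : ℕ => (k : ℝ) * exp (-1) ^ k + exp (-1) ^ k := by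
    ext k
    rw [← Real.exp_nat_mul, mul_neg_one]; ring
  rw [e]
  refine ⟨h3.summable, h3.tsum_eq.trans_le ?_⟩
  have hx : exp (-1) ≤ 2 / 5 := by
    rw [Real.exp_neg, inv_le_comm₀ (exp_pos _) (by norm_num)]
    have := Real.exp_one_gt_d9
    norm_num at this ⊢; linarith
  have hx0 := exp_pos (-1)
  have hd : 3 / 5 ≤ 1 - exp (-1) := by linarith
  rw [show exp (-1) / (1 - exp (-1)) ^ 2 + (1 - exp (-1))⁻¹ = ((1 - exp (-1)) ^ 2)⁻¹ by
    field_simp; ring]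
  rw [inv_le_comm₀ (by positivity) (by norm_num)]
  nlinarith

/-- Linear growth of the partial sums bounds the exponentially smoothed sum. -/
lemma summable_and_tsum_mul_exp_le {b : ℕ → ℝ} (hb : ∀ n, 0 ≤ b n) {Y M : ℝ} (hY : 0 < Y)
    (hM : ∀ k : ℕ, ∑ n ∈ Finset.Icc 0 ⌊(k + 1) * Y⌋₊, b n ≤ M * (k + 1)) :
    Summable (fun n : ℕ => b n * exp (-(n / Y))) ∧ ∑' n : ℕ, b n * exp (-(n / Y)) ≤ 3 * M := by
  have hM0 : 0 ≤ M := by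
    have := (Finset.sum_nonneg fun n _ => hb n).trans (hM 0)
    simpa using this
  have key : ∀ s : Finset ℕ, ∑ n ∈ s, b n * exp (-(n / Y)) ≤ 3 * M := by
    intro s
    set κ : ℕ → ℕ := fun n => ⌊(n : ℝ) / Y⌋₊
    have hfib : ∀ k ∈ s.image κ, ∑ n ∈ s with κ n = k, b n * exp (-(n / Y)) ≤
        M * ((k + 1) * exp (-k)) := by
      intro k _
      have h1 : ∀ n ∈ s.filter (κ · = k), b n * exp (-(n / Y)) ≤ b n * exp (-k) := by
        intro n hn
        have hk : ⌊(n : ℝ) / Y⌋₊ = k := (Finset.mem_filter.mp hn).2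
        have := Nat.floor_le (show 0 ≤ (n : ℝ) / Y by positivity)
        rw [hk] at this
        gcongr
        exact hb n
      refine (Finset.sum_le_sum h1).trans ?_
      rw [← Finset.sum_mul, ← mul_assoc]
      refine mul_le_mul_of_nonneg_right ?_ (exp_pos _).le
      refine (Finset.sum_le_sum_of_subset_of_nonneg (fun n hn => ?_) fun n _ _ => hb n).trans (hM k)
      have hk : ⌊(n : ℝ) / Y⌋₊ = k := (Finset.mem_filter.mp hn).2
      have := Nat.lt_floor_add_one ((n : ℝ) / Y)
      rw [hk, div_lt_iff₀ hY] at this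
      simp only [Finset.mem_Icc, zero_le, true_and]
      exact Nat.le_floor this.le
    rw [← Finset.sum_fiberwise_of_maps_to (fun n hn => Finset.mem_image_of_mem κ hn)]
    refine (Finset.sum_le_sum hfib).trans ?_
    rw [← Finset.mul_sum, mul_comm 3]
    refine mul_le_mul_of_nonneg_left ?_ hM0
    exact (summable_and_tsum_succ_mul_exp_neg_le.1.sum_le_tsum _ fun k _ => by positivity).trans
      summable_and_tsum_succ_mul_exp_neg_le.2
  have hnn : 0 ≤ fun n : ℕ => b n * exp (-(n / Y)) := fun n => mul_nonneg (hb n) (exp_pos _).le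
  exact ⟨summable_of_sum_le hnn key, tsum_le_of_sum_le hnn key⟩

lemma primeCounting_floor_le {x : ℝ} (hx : 1 < x) : (Nat.primeCounting ⌊x⌋₊ : ℝ) ≤ 5 * x / log x := by
  have h0 := Chebyshev.pi_le_log4_mul_div hx
  have hl : 0 < log x := log_pos hx
  rw [Real.log_sqrt (by linarith)] at h0
  have h1 : log x ≤ 2 * √x := by
    have := Real.log_le_sub_one_of_pos (show 0 < √x by positivity)
    rw [Real.log_sqrt (by linarith)] at this; linarith
  have h2 : √x ≤ 2 * x / log x := by
    rw [le_div_iff₀ hl]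
    nlinarith [Real.mul_self_sqrt (show 0 ≤ x by linarith), Real.sqrt_nonneg x]
  have h3 : log 4 ≤ 3 / 2 := by
    rw [show (4 : ℝ) = 2 ^ 2 by norm_num, Real.log_pow]
    have := Real.log_two_lt_d9
    push_cast; linarith
  have h4 : log 4 * x / (log x / 2) ≤ 3 * x / log x := by
    rw [div_le_div_iff₀ (by positivity) hl]
    have : log 4 * x * log x ≤ 3 / 2 * x * log x := by gcongr
    linarith
  calc _ ≤ _ := h0
    _ ≤ 3 * x / log x + 2 * x / log x := add_le_add h4 h2
    _ = _ := by ring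

lemma sum_Icc_prime_eq_primeCounting (N : ℕ) :
    ∑ n ∈ Finset.Icc 0 N, (if n.Prime then (1 : ℝ) else 0) = Nat.primeCounting N := by
  rw [Finset.sum_boole, ← Nat.primesLE_card_eq_primeCounting, Nat.primesLE_eq_filter_Icc_zero]

/-- The exponentially damped sum `∑ p, exp (-p y)` over primes. -/
def primeExpSum (y : ℝ) : ℝ := ∑' n : ℕ, if n.Prime then exp (-(n * y)) else 0

lemma summable_primeExpSum {y : ℝ} (hy : 0 < y) :
    Summable fun n : ℕ => if n.Prime then exp (-(n * y)) else 0 := by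
  have h1 : Summable fun n : ℕ => exp (-y) ^ n :=
    summable_geometric_of_lt_one (exp_pos _).le (by rw [exp_lt_one_iff]; linarith)
  refine Summable.of_nonneg_of_le (fun n => by positivity) (fun n => ?_) h1
  rw [← Real.exp_nat_mul, mul_neg]
  split_ifs
  exacts [le_rfl, (exp_pos _).le]

lemma primeExpSum_nonneg (y : ℝ) : 0 ≤ primeExpSum y := tsum_nonneg fun n => by positivity

lemma primeExpSum_le {Y : ℝ} (hY : 1 < Y) : primeExpSum (1 / Y) ≤ 15 * (Y / log Y) := by
  have hl : 0 < log Y := log_pos hY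
  have := (summable_and_tsum_mul_exp_le (b := fun n : ℕ => if n.Prime then (1 : ℝ) else 0)
    (fun n => by positivity) (Y := Y) (M := 5 * (Y / log Y)) (by linarith) fun k => ?_).2
  · rw [show (15 : ℝ) * (Y / log Y) = 3 * (5 * (Y / log Y)) by ring]
    refine le_trans (le_of_eq (tsum_congr fun n => ?_)) this
    simp [div_eq_mul_inv]
  · rw [sum_Icc_prime_eq_primeCounting]
    have hk : Y ≤ (k + 1) * Y := by nlinarith [(Nat.cast_nonneg k : (0 : ℝ) ≤ k)]
    refine (primeCounting_floor_le (hY.trans_le hk)).trans ?_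
    rw [div_le_iff₀ (log_pos (hY.trans_le hk))]
    have : log Y ≤ log ((k + 1) * Y) := log_le_log (by linarith) hk
    calc 5 * ((k + 1) * Y) = 5 * (Y / log Y) * (k + 1) * log Y := by field_simp
      _ ≤ _ := by gcongr

lemma sq_mul_exp_neg_le {x : ℝ} (hx : 0 ≤ x) : x ^ 2 * exp (-x) ≤ 2 := by
  rw [Real.exp_neg, ← div_eq_mul_inv, div_le_iff₀ (exp_pos _)]
  have := Real.pow_div_factorial_le_exp x hx 2
  norm_num [Nat.factorial] at this; linarith

lemma cube_mul_exp_neg_le {x : ℝ} (hx : 0 ≤ x) : x ^ 3 * exp (-x) ≤ 6 := by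
  rw [Real.exp_neg, ← div_eq_mul_inv, div_le_iff₀ (exp_pos _)]
  have := Real.pow_div_factorial_le_exp x hx 3
  norm_num [Nat.factorial] at this; linarith

lemma one_add_sq_le_two_mul_exp_abs (v : ℝ) : 1 + v ^ 2 ≤ 2 * exp |v| := by
  have := Real.quadratic_le_exp_of_nonneg (abs_nonneg v)
  rw [sq_abs] at this
  linarith [abs_nonneg v, sq_nonneg v]

lemma exp_mul_exp_neg_exp_mul_le {W : ℝ} (hW : 0 ≤ W) (v : ℝ) :
    exp v * exp (-exp v) * (1 + W * exp v) ≤ 16 * (1 + W) * (1 + v ^ 2)⁻¹ := by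
  rw [← div_eq_mul_inv, le_div_iff₀ (by positivity)]
  have h0 := one_add_sq_le_two_mul_exp_abs v
  set x := exp v with hx
  have hx0 : 0 < x := exp_pos v
  have h2 := sq_mul_exp_neg_le hx0.le
  have h3 := cube_mul_exp_neg_le hx0.le
  rcases le_total 0 v with hv | hv
  · rw [abs_of_nonneg hv, ← hx] at h0
    calc x * exp (-x) * (1 + W * x) * (1 + v ^ 2) ≤ x * exp (-x) * (1 + W * x) * (2 * x) := by gcongr
      _ = 2 * (x ^ 2 * exp (-x)) + 2 * W * (x ^ 3 * exp (-x)) := by ring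
      _ ≤ 2 * 2 + 2 * W * 6 := by gcongr
      _ ≤ _ := by linarith
  · have hx1 : x ≤ 1 := by rw [hx]; exact exp_le_one_iff.mpr hv
    have he : exp (-x) ≤ 1 := exp_le_one_iff.mpr (by linarith)
    rw [abs_of_nonpos hv, Real.exp_neg, ← hx] at h0
    calc x * exp (-x) * (1 + W * x) * (1 + v ^ 2)
        ≤ x * 1 * (1 + W * 1) * (2 * x⁻¹) := by gcongr
      _ = 2 * (1 + W) := by field_simp
      _ ≤ _ := by nlinarith

open MeasureTheory in
/-- The prime number theorem in a residue class, in exponentially smoothed form. -/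
lemma residueClass_smoothed_pnt {q : ℕ} [NeZero q] {s : ZMod q} (hs : IsUnit s) {W ε : ℝ}
    (hW : 0 < W) (hε : 0 < ε) :
    ∃ Y₀ : ℝ, ∀ Y : ℝ, Y₀ ≤ Y → ∀ w : ℂ, w.re = 1 → ‖w‖ ≤ W →
      ‖∑' n : ℕ, (ArithmeticFunction.vonMangoldt.residueClass s n : ℂ) *
          Complex.exp (-(n * (w / Y))) - (q.totient : ℂ)⁻¹ * (Y / w)‖ ≤ ε * Y := by
  obtain ⟨u₀, hu₀⟩ := wienerIkehara_uniform
    (a := ArithmeticFunction.vonMangoldt.residueClass s)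
    (ArithmeticFunction.vonMangoldt.residueClass_nonneg s) (C₀ := log 4 + 4)
    (fun x hx => by
      refine le_trans ?_ (Chebyshev.psi_le_const_mul_self hx)
      rw [Chebyshev.psi_eq_sum_Icc]
      exact Finset.sum_le_sum fun n _ => ArithmeticFunction.vonMangoldt.residueClass_le s n)
    (fun σ hσ => LSeriesSummable_of_abscissaOfAbsConv_lt_re
      ((ArithmeticFunction.vonMangoldt.abscissaOfAbsConv_residueClass_le_one _).trans_lt
        (by exact_mod_cast hσ)))
    (ArithmeticFunction.vonMangoldt.continuousOn_LFunctionResidueClassAux s)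
    (A := (q.totient : ℂ)⁻¹)
    (fun z hz => by
      have := ArithmeticFunction.vonMangoldt.eqOn_LFunctionResidueClassAux hs hz
      rw [this]
      simp only [sub_add_cancel]) (C := 16 * (1 + W)) (by positivity) hε
  refine ⟨exp u₀, fun Y hY w hw hwW => ?_⟩
  have hY0 : 0 < Y := (exp_pos _).trans_le hY
  have hYC : (Y : ℂ) ≠ 0 := by exact_mod_cast hY0.ne'
  have hw0 : w ≠ 0 := fun h => by simp [h] at hw
  set F : ℝ → ℂ := fun v => Complex.exp v * Complex.exp (-(w * Complex.exp v)) with hF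
  set F' : ℝ → ℂ := fun v => F v * (1 - w * Complex.exp v) with hF'
  have hE : ∀ v : ℝ, HasDerivAt (fun v : ℝ => Complex.exp v) (Complex.exp v) v := fun v =>
    (Complex.hasDerivAt_exp (v : ℂ)).comp_ofReal
  have hE2 : ∀ v : ℝ, HasDerivAt (fun v : ℝ => Complex.exp (-(w * Complex.exp v)))
      (Complex.exp (-(w * Complex.exp v)) * (-(w * Complex.exp v))) v := fun v =>
    (((hE v).const_mul w).neg).cexp
  have hd : ∀ v, HasDerivAt F (F' v) v := by
    intro v
    refine ((hE v).mul (hE2 v)).congr_deriv ?_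
    simp only [hF', hF]; ring
  have hFn : ∀ v, ‖F v‖ = exp v * exp (-exp v) := by
    intro v
    simp only [hF, norm_mul, Complex.norm_exp]
    rw [← Complex.ofReal_exp, Complex.neg_re, Complex.re_mul_ofReal, hw]
    simp
  have hFb : ∀ v, ‖F v‖ ≤ 16 * (1 + W) * (1 + v ^ 2)⁻¹ := fun v => by
    rw [hFn]
    refine le_trans ?_ (exp_mul_exp_neg_exp_mul_le hW.le v)
    exact le_mul_of_one_le_right (by positivity) (by nlinarith [mul_pos hW (exp_pos v)])
  have hFb' : ∀ v, ‖F' v‖ ≤ 16 * (1 + W) * (1 + v ^ 2)⁻¹ := fun v => by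
    simp only [hF', norm_mul, hFn]
    refine le_trans ?_ (exp_mul_exp_neg_exp_mul_le hW.le v)
    refine mul_le_mul_of_nonneg_left ((norm_sub_le _ _).trans ?_) (by positivity)
    rw [norm_one, norm_mul, ← Complex.ofReal_exp, Complex.norm_real,
      Real.norm_of_nonneg (exp_pos _).le]
    gcongr
  have hFi : Integrable F := (integrable_inv_one_add_sq.const_mul _).mono'
    (continuous_iff_continuousAt.mpr fun v => (hd v).continuousAt).aestronglyMeasurable
    (Eventually.of_forall hFb)
  have hFint : ∫ v, F v = 1 / w := by
    have h1 : ∀ v : ℝ, HasDerivAt (fun v : ℝ => -(Complex.exp (-(w * Complex.exp v)) / w)) (F v) v := by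
      intro v
      refine ((hE2 v).div_const w).neg.congr_deriv ?_
      simp only [hF]; field_simp
    have h2 : Tendsto (fun v : ℝ => -(Complex.exp (-(w * Complex.exp v)) / w)) atBot (𝓝 (-(1 / w))) := by
      have : Tendsto (fun v : ℝ => Complex.exp v) atBot (𝓝 0) := by
        have := (Complex.continuous_ofReal.tendsto 0).comp Real.tendsto_exp_atBot
        simpa [Function.comp_def] using this
      have h3 : Continuous fun z : ℂ => -(Complex.exp (-(w * z)) / w) := by fun_prop
      have := (h3.tendsto 0).comp this
      simpa [Function.comp_def] using this
    have h3 : Tendsto (fun v : ℝ => -(Complex.exp (-(w * Complex.exp v)) / w)) atTop (𝓝 0) := by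
      have : Tendsto (fun v : ℝ => Complex.exp (-(w * Complex.exp v))) atTop (𝓝 0) := by
        rw [tendsto_zero_iff_norm_tendsto_zero]
        simp only [Complex.norm_exp]
        have : ∀ v : ℝ, (-(w * Complex.exp v)).re = -exp v := fun v => by
          rw [← Complex.ofReal_exp, Complex.neg_re, Complex.re_mul_ofReal, hw, one_mul]
        simp only [this]
        exact Real.tendsto_exp_neg_atTop_nhds_zero.comp Real.tendsto_exp_atTop
      simpa using (this.div_const w).neg
    rw [integral_of_hasDerivAt_of_tendsto h1 hFi h2 h3]
    ring
  have hmain := hu₀ (log Y) ((le_log_iff_exp_le hY0).mpr hY) F F' hd hFb hFb'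
  have hsum : ∑' n : ℕ, (ArithmeticFunction.vonMangoldt.residueClass s n / n : ℂ) *
      F (log n - log Y) = (Y : ℂ)⁻¹ * ∑' n : ℕ,
        (ArithmeticFunction.vonMangoldt.residueClass s n : ℂ) * Complex.exp (-(n * (w / Y))) := by
    rw [← tsum_mul_left]
    refine tsum_congr fun n => ?_
    rcases eq_or_ne n 0 with rfl | hn
    · simp [ArithmeticFunction.vonMangoldt.residueClass_apply_zero]
    · have hn0 : (0 : ℝ) < n := by exact_mod_cast Nat.pos_of_ne_zero hn
      have hnC : (n : ℂ) ≠ 0 := by exact_mod_cast hn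
      simp only [hF]
      rw [← Complex.ofReal_exp, Real.exp_sub, Real.exp_log hn0, Real.exp_log hY0]
      push_cast
      rw [show w * ((n : ℂ) / Y) = n * (w / Y) by ring]
      field_simp
  rw [hsum, hFint] at hmain
  have hYn : Y = ‖(Y : ℂ)‖ := by rw [Complex.norm_real, Real.norm_of_nonneg hY0.le]
  refine le_trans (le_of_eq ?_) (mul_le_mul_of_nonneg_right hmain hY0.le)
  generalize hT : ∑' n : ℕ, (ArithmeticFunction.vonMangoldt.residueClass s n : ℂ) *
    Complex.exp (-(n * (w / Y))) = T
  calc _ = ‖((Y : ℂ)⁻¹ * T - (q.totient : ℂ)⁻¹ * (1 / w)) * Y‖ := by congr 1; field_simp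
    _ = _ := by rw [norm_mul, ← hYn]

/-- `residueClass_smoothed_pnt` for parameters `w` in the half plane `1 ≤ re w`. -/
lemma residueClass_smoothed_pnt_of_one_le_re {q : ℕ} [NeZero q] {s : ZMod q} (hs : IsUnit s)
    {W ε : ℝ} (hW : 0 < W) (hε : 0 < ε) :
    ∃ Y₀ : ℝ, ∀ Y : ℝ, Y₀ ≤ Y → ∀ w : ℂ, 1 ≤ w.re → ‖w‖ ≤ W →
      ‖∑' n : ℕ, (ArithmeticFunction.vonMangoldt.residueClass s n : ℂ) *
          Complex.exp (-(n * (w / Y))) - (q.totient : ℂ)⁻¹ * (Y / w)‖ ≤ ε * Y := by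
  obtain ⟨Y₀, h⟩ := residueClass_smoothed_pnt hs hW hε
  refine ⟨max 1 (W * max Y₀ 0), fun Y hY w hw hwW => ?_⟩
  have hY0 : 0 < Y := one_pos.trans_le ((le_max_left _ _).trans hY)
  have hr0 : 0 < w.re := by linarith
  have hrC : (w.re : ℂ) ≠ 0 := by exact_mod_cast hr0.ne'
  have hrW : w.re ≤ W := (Complex.re_le_norm w).trans hwW
  have hYr : Y₀ ≤ Y / w.re := by
    rw [le_div_iff₀ hr0]
    calc Y₀ * w.re ≤ max Y₀ 0 * W := by gcongr; exact le_max_left _ _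
      _ ≤ Y := by rw [mul_comm]; exact (le_max_right _ _).trans hY
  have h1 := h (Y / w.re) hYr (w / w.re) (by simp [hr0.ne'])
    (by
      rw [norm_div, Complex.norm_real, Real.norm_of_nonneg hr0.le]
      exact (div_le_self (norm_nonneg _) hw).trans hwW)
  have e1 : (w / w.re) / ((Y / w.re : ℝ) : ℂ) = w / Y := by
    push_cast; field_simp
  have e2 : ((Y / w.re : ℝ) : ℂ) / (w / w.re) = Y / w := by
    push_cast; field_simp
  rw [e1, e2] at h1
  exact h1.trans (by gcongr; exact div_le_self hY0.le hw)

lemma primeExpSum_two_mul_le {Y : ℝ} (hY : 1 < Y) : primeExpSum (1 / (2 * Y)) ≤ 30 * (Y / log Y) := by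
  refine (primeExpSum_le (by linarith)).trans ?_
  have : 0 < log Y := log_pos hY
  have : log Y ≤ log (2 * Y) := log_le_log (by linarith) (by linarith)
  rw [show 15 * (2 * Y / log (2 * Y)) = 30 * (Y / log (2 * Y)) by ring]
  gcongr

/-- Replacing the weight `log p` by `log Y` in an exponentially smoothed sum over primes. -/
lemma exists_tsum_abs_log_sub_log_le {ε : ℝ} (hε : 0 < ε) :
    ∃ Y₀ : ℝ, ∀ Y : ℝ, Y₀ ≤ Y →
      Summable (fun n : ℕ => if n.Prime then |log n - log Y| * exp (-(n / Y)) else 0) ∧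
      ∑' n : ℕ, (if n.Prime then |log n - log Y| * exp (-(n / Y)) else 0) ≤ ε * Y := by
  obtain ⟨δ, hδ0, hδ1, hδε⟩ : ∃ δ : ℝ, 0 < δ ∧ δ < 1 ∧ 10 * δ ≤ ε / 2 :=
    ⟨min (1 / 2) (ε / 20), by positivity, by
      exact (min_le_left _ _).trans_lt (by norm_num), by
      have := min_le_right (1 / 2) (ε / 20); linarith⟩
  have hlim : Tendsto (fun Y : ℝ => (15 * log (1 / δ) + 60) / log Y) atTop (𝓝 0) :=
    tendsto_log_atTop.const_div_atTop _
  obtain ⟨Y₁, hY₁⟩ := eventually_atTop.mp (hlim.eventually (gt_mem_nhds (half_pos hε)))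
  refine ⟨max Y₁ (2 / δ ^ 2), fun Y hY => ?_⟩
  have hY2 : 2 / δ ^ 2 ≤ Y := (le_max_right _ _).trans hY
  have hYd : 2 ≤ Y * δ ^ 2 := by rwa [div_le_iff₀ (by positivity)] at hY2
  have hY1 : 1 < Y := by nlinarith
  have hY0 : 0 < Y := by linarith
  have hL : 0 < log Y := log_pos hY1
  have hδY : 1 < δ * Y := by nlinarith
  have hlδ : 0 < log (1 / δ) := log_pos (by rw [lt_div_iff₀ hδ0]; linarith)
  have hlog : log Y ≤ 2 * log (δ * Y) := by
    rw [← Real.log_rpow (by positivity)]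
    refine log_le_log hY0 ?_
    norm_num [Real.rpow_two]; nlinarith
  set N := ⌊δ * Y⌋₊
  set g₁ : ℕ → ℝ := fun n => if n ∈ Finset.Icc 0 N then (if n.Prime then log Y else 0) else 0
  set g₂ : ℕ → ℝ := fun n => if n.Prime then exp (-(n * (1 / Y))) else 0
  set g₃ : ℕ → ℝ := fun n => if n.Prime then exp (-(n * (1 / (2 * Y)))) else 0
  have hg₁ : HasSum g₁ (log Y * Nat.primeCounting N) := by
    have : HasSum g₁ (∑ b ∈ Finset.Icc 0 N, g₁ b) := hasSum_sum_of_ne_finset_zero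
      (fun b hb => by simp only [g₁, if_neg hb])
    convert this using 1
    rw [← sum_Icc_prime_eq_primeCounting, Finset.mul_sum]
    refine Finset.sum_congr rfl fun n hn => ?_
    simp only [g₁, if_pos hn]; split_ifs <;> simp
  have hg₂ : Summable g₂ := summable_primeExpSum (by positivity)
  have hg₃ : Summable g₃ := summable_primeExpSum (by positivity)
  have hle : ∀ n : ℕ, (if n.Prime then |log n - log Y| * exp (-(n / Y)) else 0) ≤
      g₁ n + (log (1 / δ) * g₂ n + 2 * g₃ n) := by
    intro n
    by_cases hp : n.Prime
    swap
    · simp [g₁, g₂, g₃, hp]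
    have hn1 : (1 : ℝ) ≤ n := by exact_mod_cast hp.one_lt.le
    have hn0 : (0 : ℝ) < n := by linarith
    have hg2 : g₂ n = exp (-(n / Y)) := by simp [g₂, hp, div_eq_mul_inv]
    have hg3 : g₃ n = exp (-(n / Y) / 2) := by
      simp only [g₃, if_pos hp]; congr 1; field_simp
    have hg1 : 0 ≤ g₁ n := by simp only [g₁]; split_ifs <;> positivity
    rw [if_pos hp, hg2, hg3]
    have hE1 : exp (-(n / Y)) ≤ 1 := exp_le_one_iff.mpr (by
      have : 0 ≤ (n : ℝ) / Y := by positivity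
      linarith)
    rcases le_total (n : ℝ) (δ * Y) with h | h
    · have hmem : n ∈ Finset.Icc 0 N := by simp [N, Nat.le_floor h]
      have hg1' : g₁ n = log Y := by simp only [g₁, if_pos hmem, if_pos hp]
      have h1 : |log n - log Y| ≤ log Y := by
        have h0 := log_nonneg hn1
        have : log n ≤ log Y := log_le_log hn0 (by nlinarith)
        rw [abs_of_nonpos (by linarith)]; linarith
      rw [hg1']
      have : |log n - log Y| * exp (-(n / Y)) ≤ log Y * 1 := by gcongr
      have : 0 ≤ log (1 / δ) * exp (-(n / Y)) + 2 * exp (-(n / Y) / 2) := by positivity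
      linarith
    · have h1 : |log n - log Y| ≤ log (1 / δ) + n / Y := by
        rw [← Real.log_div hn0.ne' hY0.ne', abs_le]
        constructor
        · have : log δ ≤ log (n / Y) := log_le_log hδ0 (by rw [le_div_iff₀ hY0]; exact h)
          rw [one_div, Real.log_inv] at *
          have : 0 ≤ (n : ℝ) / Y := by positivity
          linarith
        · have := Real.log_le_sub_one_of_pos (show 0 < (n : ℝ) / Y by positivity)
          linarith
      have h2 : n / Y * exp (-(n / Y)) ≤ 2 * exp (-(n / Y) / 2) := by
        have h3 : -(n / Y : ℝ) = -(n / Y) / 2 + -(n / Y) / 2 := by ring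
        conv_lhs => rw [h3, Real.exp_add, ← mul_assoc]
        gcongr
        have := Real.add_one_le_exp (n / Y / 2 : ℝ)
        rw [neg_div, Real.exp_neg, ← div_eq_mul_inv, div_le_iff₀ (exp_pos _)]
        linarith
      calc _ ≤ (log (1 / δ) + n / Y) * exp (-(n / Y)) := by gcongr
        _ ≤ _ := by linarith
  have hs : Summable fun n => g₁ n + (log (1 / δ) * g₂ n + 2 * g₃ n) :=
    hg₁.summable.add ((hg₂.mul_left _).add (hg₃.mul_left _))
  have hsum := Summable.of_nonneg_of_le (fun n => by positivity) hle hs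
  refine ⟨hsum, (hsum.tsum_le_tsum hle hs).trans ?_⟩
  rw [hg₁.summable.tsum_add ((hg₂.mul_left _).add (hg₃.mul_left _)),
    (hg₂.mul_left _).tsum_add (hg₃.mul_left _), tsum_mul_left, tsum_mul_left, hg₁.tsum_eq]
  have e1 : log Y * (Nat.primeCounting N : ℝ) ≤ 10 * δ * Y := by
    have h1 := primeCounting_floor_le hδY
    have hl2 : 0 < log (δ * Y) := log_pos hδY
    calc log Y * (Nat.primeCounting N : ℝ) ≤ (2 * log (δ * Y)) * (5 * (δ * Y) / log (δ * Y)) := by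
          gcongr
      _ = _ := by field_simp; ring
  have e2 : ∑' n, g₂ n ≤ 15 * (Y / log Y) := primeExpSum_le hY1
  have e3 : ∑' n, g₃ n ≤ 30 * (Y / log Y) := primeExpSum_two_mul_le hY1
  have e4 := (hY₁ Y ((le_max_left _ _).trans hY)).le
  calc _ ≤ 10 * δ * Y + (log (1 / δ) * (15 * (Y / log Y)) + 2 * (30 * (Y / log Y))) := by gcongr
    _ = 10 * δ * Y + (15 * log (1 / δ) + 60) / log Y * Y := by ring
    _ ≤ ε / 2 * Y + ε / 2 * Y := by gcongr
    _ = ε * Y := by ring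

/-- Proper prime powers contribute little to smoothed sums of the von Mangoldt function. -/
lemma exists_tsum_vonMangoldt_not_prime_le :
    ∃ C : ℝ, ∀ Y : ℝ, 1 ≤ Y →
      Summable (fun n : ℕ => (if n.Prime then 0 else ArithmeticFunction.vonMangoldt n) *
        exp (-(n / Y))) ∧
      ∑' n : ℕ, (if n.Prime then 0 else ArithmeticFunction.vonMangoldt n) * exp (-(n / Y)) ≤
        C * √Y := by
  obtain ⟨C, hC⟩ := Chebyshev.psi_sub_theta_le_mul_sqrt
  refine ⟨3 * |C|, fun Y hY => ?_⟩
  rw [mul_assoc]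
  refine summable_and_tsum_mul_exp_le (fun n => ?_) (by linarith) fun k => ?_
  · split_ifs
    exacts [le_rfl, ArithmeticFunction.vonMangoldt_nonneg]
  · have h1 := hC ((k + 1) * Y)
    rw [Chebyshev.psi_sub_theta_eq_sum_not_prime] at h1
    rw [← Finset.add_sum_Ioc_eq_sum_Icc (Nat.zero_le _)]
    simp only [Nat.not_prime_zero, if_false, ArithmeticFunction.map_zero, zero_add]
    rw [Finset.sum_filter] at h1
    simp only [ite_not] at h1
    refine h1.trans ?_
    rw [Real.sqrt_mul (by positivity), mul_assoc, mul_comm (√((k : ℝ) + 1))]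
    gcongr
    · exact le_abs_self C
    · rw [Real.sqrt_le_iff]; constructor <;> nlinarith [(Nat.cast_nonneg k : (0 : ℝ) ≤ k)]

lemma summable_vonMangoldt_mul_exp {Y : ℝ} (hY : 0 < Y) :
    Summable (fun n : ℕ => ArithmeticFunction.vonMangoldt n * exp (-(n / Y))) := by
  refine (summable_and_tsum_mul_exp_le (M := (log 4 + 4) * Y)
    (fun n => ArithmeticFunction.vonMangoldt_nonneg) hY fun k => ?_).1
  have h1 := Chebyshev.psi_le_const_mul_self (x := (k + 1) * Y) (by positivity)
  rw [Chebyshev.psi_eq_sum_Icc] at h1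
  linarith

open Polynomial in
lemma sum_nthRootsFinset_one {n : ℕ} (hn : 0 < n) :
    ∑ z ∈ nthRootsFinset n (1 : ℂ), z = if n = 1 then 1 else 0 := by
  split_ifs with h
  · subst h; simp [IsPrimitiveRoot.nthRoots_one_eq_biUnion_primitiveRoots]
  have hζ := Complex.isPrimitiveRoot_exp n hn.ne'
  set ζ := Complex.exp (2 * π * Complex.I / n)
  have h1 : ζ * ∑ z ∈ nthRootsFinset n (1 : ℂ), z = ∑ z ∈ nthRootsFinset n (1 : ℂ), z := by
    rw [Finset.mul_sum]
    refine Finset.sum_nbij' (fun z => ζ * z) (fun z => ζ⁻¹ * z) ?_ ?_ ?_ ?_ ?_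
    · intro z hz
      rw [mem_nthRootsFinset hn] at hz ⊢
      rw [mul_pow, hζ.pow_eq_one, hz, one_mul]
    · intro z hz
      rw [mem_nthRootsFinset hn] at hz ⊢
      rw [mul_pow, inv_pow, hζ.pow_eq_one, hz, inv_one, one_mul]
    · intro z _; field_simp [hζ.ne_zero hn.ne']
    · intro z _; field_simp [hζ.ne_zero hn.ne']
    · intro z _; rfl
  have h2 : ζ - 1 ≠ 0 := sub_ne_zero.mpr (hζ.ne_one (by omega))
  have h3 : (ζ - 1) * ∑ z ∈ nthRootsFinset n (1 : ℂ), z = 0 := by rw [sub_mul, h1]; ring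
  exact (mul_eq_zero.mp h3).resolve_left h2

lemma sum_primitiveRoots_eq_moebius {n : ℕ} (hn : 0 < n) :
    ∑ z ∈ primitiveRoots n ℂ, z = ArithmeticFunction.moebius n := by
  have h := (ArithmeticFunction.sum_eq_iff_sum_mul_moebius_eq
    (f := fun n : ℕ => ∑ z ∈ primitiveRoots n ℂ, z)
    (g := fun n : ℕ => if n = 1 then (1 : ℂ) else 0)).mp (fun m hm => by
      rw [← sum_nthRootsFinset_one hm, IsPrimitiveRoot.nthRoots_one_eq_biUnion_primitiveRoots,
        Finset.sum_biUnion]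
      intro a _ b _ hab
      exact IsPrimitiveRoot.disjoint hab) n hn
  rw [← h, Finset.sum_eq_single (n, 1)]
  · simp
  · rintro ⟨x, y⟩ hxy hne
    rw [Nat.mem_divisorsAntidiagonal] at hxy
    have : y ≠ 1 := by
      rintro rfl
      exact hne (by simp only [← hxy.1, mul_one])
    simp [this]
  · intro h; simp [hn.ne'] at h

/-- Ramanujan's sum over the units modulo `q`. -/
lemma sum_isUnit_stdAddChar_mul {q : ℕ} [NeZero q] {b : ZMod q} (hb : IsUnit b) :
    ∑ s : ZMod q with IsUnit s, ZMod.stdAddChar (b * s) = (ArithmeticFunction.moebius q : ℂ) := by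
  classical
  have hq : q ≠ 0 := NeZero.ne q
  rw [← sum_primitiveRoots_eq_moebius (Nat.pos_of_ne_zero hq)]
  have hinj : Set.InjOn (fun s : ZMod q => ZMod.stdAddChar (b * s))
      (Finset.univ.filter fun s : ZMod q => IsUnit s) := fun x _ y _ h =>
    hb.mul_left_cancel (ZMod.injective_stdAddChar h)
  rw [← Finset.sum_image (f := fun z : ℂ => z) hinj]
  refine Finset.sum_congr (Finset.eq_of_subset_of_card_le ?_ ?_) fun _ _ => rfl
  · intro z hz
    obtain ⟨s, hs, rfl⟩ := Finset.mem_image.mp hz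
    have hu : IsUnit (b * s) := hb.mul (Finset.mem_filter.mp hs).2
    rw [mem_primitiveRoots (Nat.pos_of_ne_zero hq)]
    have h1 : ((b * s).val).Coprime q := by
      rw [← ZMod.isUnit_iff_coprime, ZMod.natCast_zmod_val]; exact hu
    have := Complex.isPrimitiveRoot_exp_of_coprime _ q hq h1
    convert this using 1
    have h2 := ZMod.stdAddChar_coe (N := q) ((b * s).val : ℤ)
    rw [Int.cast_natCast, ZMod.natCast_zmod_val] at h2
    rw [h2]; push_cast; congr 1; ring
  · rw [Finset.card_image_of_injOn hinj, Complex.card_primitiveRoots]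
    rw [← ZMod.card_units_eq_totient, ← Finset.card_univ]
    refine Finset.card_le_card_of_injOn (fun u : (ZMod q)ˣ => (u : ZMod q)) ?_ ?_
    · intro u _; simp
    · intro u _ v _ h; exact Units.ext h

lemma norm_moebius_div_totient_le {q : ℕ} (hq : 3 ≤ q) :
    ‖(ArithmeticFunction.moebius q : ℂ) / q.totient‖ ≤ 1 / 2 := by
  have h1 : 2 ≤ q.totient := by
    have h := Nat.totient_even (show 2 < q by omega)
    have := Nat.totient_pos.mpr (show 0 < q by omega)
    exact Nat.le_of_dvd this h.two_dvd
  have h2 : ‖(ArithmeticFunction.moebius q : ℂ)‖ ≤ 1 := by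
    rw [Complex.norm_intCast]
    exact_mod_cast ArithmeticFunction.abs_moebius_le_one
  rw [norm_div, Complex.norm_natCast]
  gcongr
  exact_mod_cast h1

lemma norm_exp_neg_mul_le {w : ℂ} {r Y : ℝ} (hr : r ≤ w.re) (hY : 0 < Y) (n : ℕ) :
    ‖Complex.exp (-(n * (w / Y)))‖ ≤ exp (-(n * (r / Y))) := by
  rw [Complex.norm_exp, exp_le_exp, Complex.neg_re, ← Complex.ofReal_natCast,
    Complex.re_ofReal_mul, Complex.div_ofReal_re]
  gcongr

/-- The prime number theorem in a residue class, as an exponentially damped prime count. -/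
lemma prime_residueClass_smoothed_pnt {q : ℕ} [NeZero q] {s : ZMod q} (hs : IsUnit s)
    {W ε : ℝ} (hW : 0 < W) (hε : 0 < ε) :
    ∃ Y₀ : ℝ, ∀ Y : ℝ, Y₀ ≤ Y → ∀ w : ℂ, 1 ≤ w.re → ‖w‖ ≤ W →
      ‖∑' n : ℕ, (if n.Prime ∧ (n : ZMod q) = s then Complex.exp (-(n * (w / Y))) else 0) -
        (q.totient : ℂ)⁻¹ * (Y / (log Y * w))‖ ≤ ε * (Y / log Y) := by
  obtain ⟨Y₁, h1⟩ := residueClass_smoothed_pnt_of_one_le_re hs hW (show 0 < ε / 3 by positivity)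
  obtain ⟨Y₂, h2⟩ := exists_tsum_abs_log_sub_log_le (show 0 < ε / 3 by positivity)
  obtain ⟨C, h3⟩ := exists_tsum_vonMangoldt_not_prime_le
  refine ⟨max (max Y₁ Y₂) (max 2 ((3 * C / ε) ^ 2)), fun Y hY w hw hwW => ?_⟩
  simp only [max_le_iff] at hY
  obtain ⟨⟨hY1, hY2⟩, hY3, hY4⟩ := hY
  have hY0 : 0 < Y := by linarith
  have hL : 0 < log Y := log_pos (by linarith)
  have hLC : (log Y : ℂ) ≠ 0 := by exact_mod_cast hL.ne'
  have hw0 : w ≠ 0 := fun h => by simp [h] at hw; linarith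
  specialize h1 Y hY1 w hw hwW
  obtain ⟨h2s, h2⟩ := h2 Y hY2
  obtain ⟨h3s, h3⟩ := h3 Y (by linarith)
  have h3' : C * √Y ≤ ε / 3 * Y := by
    have : 3 * C / ε ≤ √Y := Real.le_sqrt_of_sq_le hY4
    rw [div_le_iff₀ hε] at this
    have h5 := Real.mul_self_sqrt hY0.le
    nlinarith [Real.sqrt_nonneg Y]
  set f : ℕ → ℂ := fun n => Complex.exp (-(n * (w / Y)))
  have hf : ∀ n, ‖f n‖ ≤ exp (-(n / Y)) := fun n =>
    (norm_exp_neg_mul_le hw hY0 n).trans_eq (by rw [mul_one_div])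
  set Λs := ArithmeticFunction.vonMangoldt.residueClass s
  set A : ℕ → ℂ := fun n => if n.Prime ∧ (n : ZMod q) = s then f n else 0
  set g₁ : ℕ → ℂ := fun n => if n.Prime then 0 else (Λs n : ℂ) * f n
  set g₂ : ℕ → ℂ := fun n => if n.Prime ∧ (n : ZMod q) = s then ((log n - log Y : ℝ) : ℂ) * f n else 0
  have hΛ : Summable fun n => (Λs n : ℂ) * f n := by
    refine Summable.of_norm_bounded (summable_vonMangoldt_mul_exp hY0) fun n => ?_
    rw [norm_mul, Complex.norm_real,
      Real.norm_of_nonneg (ArithmeticFunction.vonMangoldt.residueClass_nonneg s n)]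
    gcongr
    exacts [ArithmeticFunction.vonMangoldt.residueClass_le s n, hf n]
  have hg₁ : ∀ n, ‖g₁ n‖ ≤ (if n.Prime then 0 else ArithmeticFunction.vonMangoldt n) * exp (-(n / Y)) := by
    intro n
    simp only [g₁]
    split_ifs
    · simp
    · rw [norm_mul, Complex.norm_real,
        Real.norm_of_nonneg (ArithmeticFunction.vonMangoldt.residueClass_nonneg s n)]
      gcongr
      exacts [ArithmeticFunction.vonMangoldt.residueClass_le s n, hf n]
  have hg₂ : ∀ n, ‖g₂ n‖ ≤ if n.Prime then |log n - log Y| * exp (-(n / Y)) else 0 := by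
    intro n
    simp only [g₂]
    by_cases hp : n.Prime
    · rw [if_pos hp]
      split_ifs
      · rw [norm_mul, Complex.norm_real, Real.norm_eq_abs]
        gcongr
        exact hf n
      · rw [norm_zero]; positivity
    · simp [hp]
  have hs₁ : Summable g₁ := Summable.of_norm_bounded h3s hg₁
  have hs₂ : Summable g₂ := Summable.of_norm_bounded h2s hg₂
  have hA : ∀ n, (log Y : ℂ) * A n = (Λs n : ℂ) * f n - g₁ n - g₂ n := by
    intro n
    simp only [A, g₁, g₂, Λs, ArithmeticFunction.vonMangoldt.residueClass, Set.indicator_apply,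
      Set.mem_ofPred_eq]
    by_cases hp : n.Prime <;> by_cases hn : (n : ZMod q) = s
    · simp only [hp, hn, ArithmeticFunction.vonMangoldt_apply_prime hp]; push_cast; simp; ring
    all_goals simp [hp, hn]
  have hAs : (log Y : ℂ) * ∑' n, A n = ∑' n, (Λs n : ℂ) * f n - ∑' n, g₁ n - ∑' n, g₂ n := by
    rw [← tsum_mul_left, ← hΛ.tsum_sub hs₁, ← (hΛ.sub hs₁).tsum_sub hs₂]
    exact tsum_congr hA
  have n₁ : ‖∑' n, g₁ n‖ ≤ ε / 3 * Y :=
    (tsum_of_norm_bounded h3s.hasSum hg₁).trans (h3.trans h3')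
  have n₂ : ‖∑' n, g₂ n‖ ≤ ε / 3 * Y := (tsum_of_norm_bounded h2s.hasSum hg₂).trans h2
  have hfin : (log Y : ℂ) * (∑' n, A n - (q.totient : ℂ)⁻¹ * (Y / (log Y * w))) =
      (∑' n, (Λs n : ℂ) * f n - (q.totient : ℂ)⁻¹ * (Y / w)) - ∑' n, g₁ n - ∑' n, g₂ n := by
    rw [mul_sub, hAs]; field_simp; ring
  have hn : log Y * ‖∑' n, A n - (q.totient : ℂ)⁻¹ * (Y / (log Y * w))‖ ≤ ε * Y := by
    have := congrArg norm hfin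
    rw [norm_mul, Complex.norm_real, Real.norm_of_nonneg hL.le] at this
    rw [this]
    refine (norm_sub_le _ _).trans ((add_le_add (norm_sub_le _ _) le_rfl).trans ?_)
    linarith
  rw [← mul_div_assoc ε, le_div_iff₀ hL, mul_comm]
  exact hn

lemma tendsto_div_log_atTop : Tendsto (fun Y : ℝ => Y / log Y) atTop atTop := by
  have h1 := Real.isLittleO_log_id_atTop.tendsto_div_nhds_zero
  have h2 : ∀ᶠ Y : ℝ in atTop, 0 < log Y / id Y := by
    filter_upwards [eventually_gt_atTop 1] with Y hY
    have := log_pos hY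
    simp only [id]; positivity
  refine ((tendsto_nhdsWithin_iff.mpr ⟨h1, h2⟩).inv_tendsto_nhdsGT_zero).congr fun Y => ?_
  simp

/-- The sum `∑ p, exp (-p s)` over primes, for complex `s`. -/
def primeExpSumC (s : ℂ) : ℂ := ∑' n : ℕ, if n.Prime then Complex.exp (-(n * s)) else 0

lemma norm_ite_prime_exp_le (s : ℂ) {y : ℝ} (hy : y ≤ s.re) (n : ℕ) :
    ‖(if n.Prime then Complex.exp (-(n * s)) else 0 : ℂ)‖ ≤
      if n.Prime then exp (-(n * y)) else 0 := by
  split_ifs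
  · have := norm_exp_neg_mul_le hy one_pos n
    simpa using this
  · simp

lemma summable_primeExpSumC {s : ℂ} (hs : 0 < s.re) :
    Summable fun n : ℕ => (if n.Prime then Complex.exp (-(n * s)) else 0 : ℂ) :=
  Summable.of_norm_bounded (summable_primeExpSum hs) (norm_ite_prime_exp_le s le_rfl)

lemma primeExpSumC_ofReal (y : ℝ) : primeExpSumC y = primeExpSum y := by
  rw [primeExpSumC, primeExpSum, Complex.ofReal_tsum]
  refine tsum_congr fun n => ?_
  split_ifs <;> simp

lemma exp_neg_mul_sub_eq_stdAddChar {q : ℕ} [NeZero q] (n : ℕ) (z : ℂ) (b : ℤ) :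
    Complex.exp (-(n * (z - 2 * π * Complex.I * (b / q)))) =
      ZMod.stdAddChar ((b : ZMod q) * (n : ZMod q)) * Complex.exp (-(n * z)) := by
  have := ZMod.stdAddChar_coe (N := q) (b * n)
  push_cast at this
  rw [this, ← Complex.exp_add]
  congr 1; ring

lemma primeExpSumC_eq_sum_residueClass {q : ℕ} [NeZero q] {z : ℂ} (hz : 0 < z.re) (b : ℤ) :
    primeExpSumC (z - 2 * π * Complex.I * (b / q)) =
      ∑ s : ZMod q, ZMod.stdAddChar ((b : ZMod q) * s) *
        ∑' n : ℕ, (if n.Prime ∧ (n : ZMod q) = s then Complex.exp (-(n * z)) else 0) := by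
  have hs : ∀ s : ZMod q, Summable fun n : ℕ =>
      (if n.Prime ∧ (n : ZMod q) = s then Complex.exp (-(n * z)) else 0 : ℂ) := fun s => by
    refine Summable.of_norm_bounded (summable_primeExpSum hz) fun n => ?_
    refine le_trans ?_ (norm_ite_prime_exp_le z le_rfl n)
    by_cases h : n.Prime <;> by_cases h' : (n : ZMod q) = s <;> simp [h, h']
  simp_rw [← tsum_mul_left]
  rw [← Summable.tsum_finsetSum fun s _ => (hs s).mul_left _]
  refine tsum_congr fun n => ?_
  split_ifs with h
  · rw [exp_neg_mul_sub_eq_stdAddChar, Finset.sum_eq_single (n : ZMod q)]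
    · simp [h]
    · intro s _ hs; simp [hs.symm]
    · simp
  · simp [h]

lemma norm_tsum_prime_not_isUnit_le {q : ℕ} [NeZero q] {s : ZMod q} (hs : ¬ IsUnit s) {z : ℂ}
    (hz : 0 < z.re) :
    ‖∑' n : ℕ, (if n.Prime ∧ (n : ZMod q) = s then Complex.exp (-(n * z)) else 0 : ℂ)‖ ≤ q + 1 := by
  rw [tsum_eq_sum (s := Finset.range (q + 1))]
  · refine (norm_sum_le _ _).trans ?_
    have : ∀ n ∈ Finset.range (q + 1),
        ‖(if n.Prime ∧ (n : ZMod q) = s then Complex.exp (-(n * z)) else 0 : ℂ)‖ ≤ 1 := by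
      intro n _
      split_ifs
      · rw [Complex.norm_exp, exp_le_one_iff, Complex.neg_re, ← Complex.ofReal_natCast,
          Complex.re_ofReal_mul]
        have : 0 ≤ (n : ℝ) * z.re := by positivity
        linarith
      · simp
    refine (Finset.sum_le_sum this).trans ?_
    simp
  · intro n hn
    refine if_neg fun h => hs ?_
    rw [← h.2, ZMod.isUnit_iff_coprime, h.1.coprime_iff_not_dvd]
    intro hd
    have := Nat.le_of_dvd (NeZero.pos q) hd
    simp at hn; omega

/-- The asymptotics of `∑ p, exp (-p s)` for `s` near a rational point `-2πi b / q`. -/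
lemma primeExpSumC_asymp (q : ℕ) [NeZero q] {W ε : ℝ} (hW : 0 < W) (hε : 0 < ε) :
    ∀ᶠ Y : ℝ in atTop, ∀ w : ℂ, 1 ≤ w.re → ‖w‖ ≤ W → ∀ b : ℤ, IsUnit (b : ZMod q) →
      ‖primeExpSumC (w / Y - 2 * π * Complex.I * (b / q)) -
        (ArithmeticFunction.moebius q : ℂ) / q.totient * (Y / (log Y * w))‖ ≤ ε * (Y / log Y) := by
  classical
  have hq0 : (0 : ℝ) < q := by exact_mod_cast NeZero.pos q
  have hε' : 0 < ε / (2 * q) := by positivity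
  have h1 : ∀ᶠ Y : ℝ in atTop, ∀ s : ZMod q, IsUnit s → ∀ w : ℂ, 1 ≤ w.re → ‖w‖ ≤ W →
      ‖∑' n : ℕ, (if n.Prime ∧ (n : ZMod q) = s then Complex.exp (-(n * (w / Y))) else 0) -
        (q.totient : ℂ)⁻¹ * (Y / (log Y * w))‖ ≤ ε / (2 * q) * (Y / log Y) := by
    refine eventually_all.mpr fun s => ?_
    by_cases hs : IsUnit s
    · filter_upwards [eventually_atTop.mpr (prime_residueClass_smoothed_pnt hs hW hε')]
        with Y hY _ using hY
    · exact Eventually.of_forall fun Y h => absurd h hs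
  filter_upwards [h1, tendsto_div_log_atTop.eventually_ge_atTop ((q + 1) / (ε / (2 * q))),
    eventually_gt_atTop 1] with Y hY hY2 hY1 w hw hwW b hb
  have hY0 : 0 < Y := by linarith
  have hL := log_pos hY1
  have hz : 0 < (w / (Y : ℂ)).re := by
    rw [Complex.div_ofReal_re]; positivity
  set M := (q.totient : ℂ)⁻¹ * (Y / (log Y * w))
  have e : (ArithmeticFunction.moebius q : ℂ) / q.totient * (Y / (log Y * w)) =
      ∑ s : ZMod q, ZMod.stdAddChar ((b : ZMod q) * s) * (if IsUnit s then M else 0) := by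
    rw [← sum_isUnit_stdAddChar_mul hb, Finset.sum_filter, Finset.sum_div, Finset.sum_mul]
    refine Finset.sum_congr rfl fun s _ => ?_
    split_ifs
    · simp only [M]; ring
    · simp
  rw [primeExpSumC_eq_sum_residueClass hz, e, ← Finset.sum_sub_distrib]
  have key : ∀ s : ZMod q, ‖ZMod.stdAddChar ((b : ZMod q) * s) *
        ∑' n : ℕ, (if n.Prime ∧ (n : ZMod q) = s then Complex.exp (-(n * (w / Y))) else 0) -
      ZMod.stdAddChar ((b : ZMod q) * s) * (if IsUnit s then M else 0)‖ ≤
      ε / (2 * q) * (Y / log Y) := by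
    intro s
    rw [← mul_sub, norm_mul, AddChar.norm_apply, one_mul]
    split_ifs with hs
    · exact hY s hs w hw hwW
    · rw [sub_zero]
      refine (norm_tsum_prime_not_isUnit_le hs hz).trans ?_
      rwa [div_le_iff₀ hε', mul_comm] at hY2
  refine (norm_sum_le _ _).trans ((Finset.sum_le_sum fun s _ => key s).trans ?_)
  rw [Finset.sum_const, Finset.card_univ, ZMod.card, nsmul_eq_mul]
  have : (q : ℝ) * (ε / (2 * q) * (Y / log Y)) = ε / 2 * (Y / log Y) := by field_simp
  rw [this]
  gcongr
  linarith

lemma sum_Ico_pow_eq_sum_blocks (b : ℕ) (hb : 1 ≤ b) (g : ℕ → ℝ) {m n : ℕ} (hmn : m ≤ n) :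
    ∑ p ∈ Finset.Ico (b ^ m) (b ^ n), g p =
      ∑ k ∈ Finset.Ico m n, ∑ p ∈ Finset.Ico (b ^ k) (b ^ (k + 1)), g p := by
  induction n, hmn using Nat.le_induction with
  | base => simp
  | succ n hmn ih =>
    rw [Finset.sum_Ico_succ_top hmn, ← ih, Finset.sum_Ico_consecutive]
    · exact Nat.pow_le_pow_right hb hmn
    · exact Nat.pow_le_pow_right hb (Nat.le_succ n)

lemma sum_Ico_one_div_succ_le (n : ℕ) :
    ∑ k ∈ Finset.Ico 0 n, (1 : ℝ) / (k + 1) ≤ 1 + log n := by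
  have := harmonic_le_one_add_log n
  rw [harmonic] at this
  push_cast at this
  rw [Nat.Ico_zero_eq_range]
  simpa using this

lemma log_div_le_sum_Ico_one_div_succ {m n : ℕ} (hmn : m ≤ n) :
    log ((n + 1) / (m + 1)) ≤ ∑ k ∈ Finset.Ico m n, (1 : ℝ) / (k + 1) := by
  induction n, hmn using Nat.le_induction with
  | base => simp [div_self (show (m : ℝ) + 1 ≠ 0 by positivity)]
  | succ n hmn ih =>
    rw [Finset.sum_Ico_succ_top hmn]
    have h : log ((((n + 1 : ℕ) : ℝ) + 1) / (m + 1)) =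
        log ((n + 1) / (m + 1)) + log (((n + 1 : ℕ) + 1) / (n + 1) : ℝ) := by
      rw [← Real.log_mul (by positivity) (by positivity)]
      congr 1; field_simp
    rw [h]
    refine add_le_add ih ?_
    refine (Real.log_le_sub_one_of_pos (by positivity)).trans (le_of_eq ?_)
    push_cast; field_simp; ring

lemma sum_Ico_prime_le_primeCounting (a b : ℕ) :
    ∑ p ∈ Finset.Ico a b, (if p.Prime then (1 : ℝ) else 0) ≤ Nat.primeCounting b := by
  rw [← sum_Icc_prime_eq_primeCounting]
  refine Finset.sum_le_sum_of_subset_of_nonneg (fun n hn => ?_) fun _ _ _ => by positivity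
  simp only [Finset.mem_Ico, Finset.mem_Icc] at hn ⊢
  omega

lemma sum_dyadic_prime_inv_le (k : ℕ) :
    ∑ p ∈ Finset.Ico ((2 : ℕ) ^ k) (2 ^ (k + 1)), (if p.Prime then (1 : ℝ) / p else 0) ≤ 15 / (k + 1) := by
  have h1 : ∀ p ∈ Finset.Ico ((2 : ℕ) ^ k) (2 ^ (k + 1)), (if p.Prime then (1 : ℝ) / p else 0) ≤
      (1 / 2 ^ k) * (if p.Prime then (1 : ℝ) else 0) := by
    intro p hp
    have hp1 : (2 : ℝ) ^ k ≤ p := by exact_mod_cast (Finset.mem_Ico.mp hp).1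
    split_ifs
    · rw [mul_one]; gcongr
    · simp
  refine (Finset.sum_le_sum h1).trans ?_
  rw [← Finset.mul_sum]
  have h2 := primeCounting_floor_le (x := ((2 ^ (k + 1) : ℕ) : ℝ))
    (by exact_mod_cast Nat.one_lt_two_pow (Nat.succ_ne_zero k))
  rw [Nat.floor_natCast] at h2
  have h3 := (sum_Ico_prime_le_primeCounting (2 ^ k) (2 ^ (k + 1))).trans h2
  have hl : 0 < log 2 := log_pos (by norm_num)
  calc _ ≤ (1 / 2 ^ k) * (5 * ((2 ^ (k + 1) : ℕ) : ℝ) / log ((2 ^ (k + 1) : ℕ) : ℝ)) := by gcongr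
    _ = 10 / (log 2 * (k + 1)) := by
        push_cast; rw [Real.log_pow, pow_succ]; push_cast; field_simp; ring
    _ ≤ 15 / (k + 1) := by
        have := Real.log_two_gt_d9
        rw [div_le_div_iff₀ (by positivity) (by positivity)]
        nlinarith [(Nat.cast_nonneg k : (0 : ℝ) ≤ k)]

lemma exists_two_pow_gt {x : ℝ} (hx : 3 ≤ x) :
    ∃ M : ℕ, 1 ≤ M ∧ x < 2 ^ M ∧ (M : ℝ) ≤ 4 * log x := by
  have hl1 : 1 ≤ log x := by
    rw [le_log_iff_exp_le (by linarith)]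
    exact Real.exp_one_lt_three.le.trans hx
  have h2 := Real.log_two_gt_d9
  have h2' := Real.log_two_lt_d9
  refine ⟨⌊log x / log 2⌋₊ + 1, by omega, ?_, ?_⟩
  · have := Nat.lt_floor_add_one (log x / log 2)
    rw [div_lt_iff₀ (by linarith)] at this
    rw [← Real.log_lt_log_iff (by linarith) (by positivity), Real.log_pow]
    push_cast; exact this
  · have h3 := Nat.floor_le (show 0 ≤ log x / log 2 by positivity)
    have h4 : log x / log 2 ≤ 3 * log x := by
      rw [div_le_iff₀ (by linarith)]; nlinarith
    push_cast; linarith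

/-- Upper bound for the sum of reciprocals of primes. -/
lemma sum_prime_inv_le {x : ℝ} (hx : 3 ≤ x) :
    ∑ p ∈ Finset.Icc 0 ⌊x⌋₊, (if p.Prime then (1 : ℝ) / p else 0) ≤ 45 * (1 + log (log x)) := by
  obtain ⟨M, hM1, hM2, hM3⟩ := exists_two_pow_gt hx
  have hl1 : 1 ≤ log x := by
    rw [le_log_iff_exp_le (by linarith)]
    exact Real.exp_one_lt_three.le.trans hx
  have h1 : ∑ p ∈ Finset.Icc 0 ⌊x⌋₊, (if p.Prime then (1 : ℝ) / p else 0) ≤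
      ∑ p ∈ Finset.Ico ((2 : ℕ) ^ 0) (2 ^ M), (if p.Prime then (1 : ℝ) / p else 0) := by
    rw [← Finset.sum_filter, ← Finset.sum_filter]
    refine Finset.sum_le_sum_of_subset_of_nonneg (fun p hp => ?_) fun _ _ _ => by positivity
    rw [Finset.mem_filter, Finset.mem_Icc] at hp
    have h5 : (p : ℝ) ≤ x := (Nat.le_floor_iff (by linarith)).mp hp.1.2
    have h6 : p < 2 ^ M := by exact_mod_cast h5.trans_lt hM2
    simp only [Finset.mem_filter, Finset.mem_Ico, pow_zero]
    exact ⟨⟨hp.2.one_lt.le, h6⟩, hp.2⟩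
  refine h1.trans ?_
  rw [sum_Ico_pow_eq_sum_blocks 2 (by norm_num) _ (Nat.zero_le M)]
  refine (Finset.sum_le_sum fun k _ => sum_dyadic_prime_inv_le k).trans ?_
  have h2 := sum_Ico_one_div_succ_le M
  have h3 : log M ≤ 2 + log (log x) := by
    have h4 : log M ≤ log (4 * log x) := log_le_log (by exact_mod_cast hM1) hM3
    rw [Real.log_mul (by norm_num) (by linarith), show (4 : ℝ) = 2 ^ 2 by norm_num,
      Real.log_pow] at h4
    have := Real.log_two_lt_d9
    push_cast at h4; linarith
  have h5 : 0 ≤ log (log x) := log_nonneg hl1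
  calc ∑ k ∈ Finset.Ico 0 M, (15 : ℝ) / (k + 1) = 15 * ∑ k ∈ Finset.Ico 0 M, (1 : ℝ) / (k + 1) := by
        rw [Finset.mul_sum]; refine Finset.sum_congr rfl fun k _ => by ring
    _ ≤ 15 * (1 + (2 + log (log x))) := by gcongr; linarith
    _ ≤ _ := by linarith

lemma theta_eight_pow (k : ℕ) :
    Chebyshev.theta ((8 : ℝ) ^ k) =
      ∑ p ∈ Finset.Ico 0 ((8 : ℕ) ^ k), (if p.Prime then log p else 0) := by
  have h : ¬ Nat.Prime (8 ^ k) := by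
    rcases k with _ | k
    · simp [Nat.not_prime_one]
    · intro h
      have h2 := (Nat.prime_dvd_prime_iff_eq Nat.prime_two h).mp
        ((show 2 ∣ 8 by norm_num).trans (dvd_pow_self 8 (Nat.succ_ne_zero k)))
      have : 8 ≤ 8 ^ (k + 1) := Nat.le_self_pow (Nat.succ_ne_zero k) 8
      omega
  have h8 : ⌊(8 : ℝ) ^ k⌋₊ = 8 ^ k := by
    rw [show (8 : ℝ) ^ k = ((8 ^ k : ℕ) : ℝ) by push_cast; rfl, Nat.floor_natCast]
  rw [Chebyshev.theta_eq_sum_Icc, Finset.sum_filter, h8, ← Finset.Ico_insert_right (Nat.zero_le _),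
    Finset.sum_insert (by simp), if_neg h, zero_add]

lemma exists_le_theta_sub_theta :
    ∃ K : ℕ, ∀ k ≥ K,
      (8 : ℝ) ^ k ≤ Chebyshev.theta (8 ^ (k + 1)) - Chebyshev.theta (8 ^ k) := by
  have h1 : (fun x : ℝ => √x * log x) =o[atTop] fun x => x := by
    refine ((Asymptotics.isBigO_refl (fun x : ℝ => √x) atTop).mul_isLittleO
      (isLittleO_log_rpow_atTop (show (0 : ℝ) < 1 / 2 by norm_num))).congr' .rfl ?_
    filter_upwards [eventually_ge_atTop 0] with x hx
    rw [← Real.sqrt_eq_rpow, Real.mul_self_sqrt hx]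
  have h2 : Tendsto (fun k : ℕ => (8 : ℝ) ^ (k + 1)) atTop atTop :=
    (tendsto_pow_atTop_atTop_of_one_lt (by norm_num)).comp (tendsto_add_atTop_nat 1)
  have h3 := h2.eventually ((h1.bound (show (0 : ℝ) < 1 / 1000 by norm_num)).and
    ((Real.isLittleO_log_id_atTop.bound (show (0 : ℝ) < 1 / 1000 by norm_num)).and
      (eventually_ge_atTop 1000)))
  obtain ⟨K, hK⟩ := eventually_atTop.mp h3
  refine ⟨K, fun k hk => ?_⟩
  obtain ⟨ha, hb, hc⟩ := hK k hk
  have hx : (8 : ℝ) ^ (k + 1) = 8 * 8 ^ k := by rw [pow_succ]; ring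
  have h5 := Chebyshev.theta_ge' (x := (8 : ℝ) ^ (k + 1)) (by linarith)
  have h6 := Chebyshev.theta_le_log4_mul_x (x := (8 : ℝ) ^ k) (by positivity)
  rw [show (4 : ℝ) = 2 ^ 2 by norm_num, Real.log_pow] at h6
  have h7 : log ((8 : ℝ) ^ (k + 1) + 2) ≤ log ((8 : ℝ) ^ (k + 1)) + 1 := by
    have h1e : log ((8 : ℝ) ^ (k + 1)) + 1 = log (8 ^ (k + 1)) + log (exp 1) := by
      rw [Real.log_exp]
    rw [h1e, ← Real.log_mul (by positivity) (Real.exp_ne_zero _)]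
    apply Real.log_le_log (by positivity)
    nlinarith [Real.exp_one_gt_d9]
  have ha' := (le_abs_self _).trans ha
  have hb' := (le_abs_self _).trans hb
  rw [Real.norm_of_nonneg (by positivity)] at ha' hb'
  simp only [id] at hb'
  have hl := Real.log_two_gt_d9
  rw [hx] at ha' hb' hc h5 h7 ⊢
  push_cast at h6
  have hm : 6 * 8 ^ k * 0.69 ≤ 6 * (8 : ℝ) ^ k * log 2 := by gcongr; linarith
  have := Real.log_two_lt_d9
  linarith

/-- Lower bound for the sum of reciprocals of primes in a block. -/
lemma exists_le_sum_block_prime_inv :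
    ∃ K : ℕ, ∀ k ≥ K, 1 / (24 * ((k : ℝ) + 1)) ≤
      ∑ p ∈ Finset.Ico ((8 : ℕ) ^ k) (8 ^ (k + 1)), (if p.Prime then (1 : ℝ) / p else 0) := by
  obtain ⟨K, hK⟩ := exists_le_theta_sub_theta
  refine ⟨K, fun k hk => ?_⟩
  have h1 := hK k hk
  rw [theta_eight_pow, theta_eight_pow, ← Finset.sum_Ico_consecutive _ (Nat.zero_le (8 ^ k))
    (Nat.pow_le_pow_right (by norm_num) (Nat.le_succ k)), add_sub_cancel_left] at h1
  have hl : log ((8 : ℝ) ^ (k + 1)) ≤ 3 * (k + 1) := by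
    rw [Real.log_pow, show (8 : ℝ) = 2 ^ 3 by norm_num, Real.log_pow]
    have := Real.log_two_lt_d9
    push_cast
    nlinarith [(Nat.cast_nonneg k : (0 : ℝ) ≤ k)]
  have h2 : ∀ p ∈ Finset.Ico ((8 : ℕ) ^ k) (8 ^ (k + 1)), (if p.Prime then log p else 0) ≤
      (3 * (k + 1) * 8 ^ (k + 1)) * (if p.Prime then (1 : ℝ) / p else 0) := by
    intro p hp
    split_ifs with hpp
    · have hp1 : (p : ℝ) ≤ 8 ^ (k + 1) := by exact_mod_cast (Finset.mem_Ico.mp hp).2.le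
      have hp0 : (0 : ℝ) < p := by exact_mod_cast hpp.pos
      have h3 := (Real.log_le_log hp0 hp1).trans hl
      refine h3.trans ?_
      rw [mul_one_div, le_div_iff₀ hp0]
      gcongr
    · simp
  have h3 := h1.trans (Finset.sum_le_sum h2)
  rw [← Finset.mul_sum] at h3
  rw [div_le_iff₀ (by positivity)]
  have h4 : (0 : ℝ) < 8 ^ k := by positivity
  rw [pow_succ] at h3
  nlinarith

/-- The primes in `(exp((log log X)²), √X]`. -/
def midPrimes (X : ℝ) : Finset ℕ :=
  (Finset.Icc 0 ⌊√X⌋₊).filter fun p => p.Prime ∧ exp (log (log X) ^ 2) < p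

lemma mem_midPrimes {X : ℝ} {p : ℕ} :
    p ∈ midPrimes X ↔ (p : ℝ) ≤ √X ∧ p.Prime ∧ exp (log (log X) ^ 2) < p := by
  rw [midPrimes, Finset.mem_filter, Finset.mem_Icc, Nat.le_floor_iff (Real.sqrt_nonneg X)]
  simp

lemma tendsto_log_log : Tendsto (fun X : ℝ => log (log X)) atTop atTop :=
  Real.tendsto_log_atTop.comp Real.tendsto_log_atTop

lemma sum_midPrimes_inv_le :
    ∃ C : ℝ, 0 < C ∧ ∀ᶠ X : ℝ in atTop, ∑ p ∈ midPrimes X, (1 : ℝ) / p ≤ C * log (log X) := by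
  refine ⟨90, by norm_num, ?_⟩
  filter_upwards [tendsto_log_log.eventually_ge_atTop 1, eventually_ge_atTop 9] with X h1 h9
  have hs : 3 ≤ √X := by
    rw [show (3 : ℝ) = √9 by rw [show (9 : ℝ) = 3 ^ 2 by norm_num]; simp]
    exact Real.sqrt_le_sqrt h9
  have h2 := sum_prime_inv_le hs
  have h3 : ∑ p ∈ midPrimes X, (1 : ℝ) / p ≤
      ∑ p ∈ Finset.Icc 0 ⌊√X⌋₊, (if p.Prime then (1 : ℝ) / p else 0) := by
    rw [← Finset.sum_filter]
    refine Finset.sum_le_sum_of_subset_of_nonneg (fun p hp => ?_) fun _ _ _ => by positivity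
    rw [midPrimes, Finset.mem_filter] at hp
    exact Finset.mem_filter.mpr ⟨hp.1, hp.2.1⟩
  have h4 : log (log √X) ≤ log (log X) := by
    apply Real.log_le_log (Real.log_pos (by linarith))
    apply Real.log_le_log (by linarith)
    rw [Real.sqrt_le_left (by linarith)]
    nlinarith
  linarith

lemma exists_le_sum_midPrimes_inv :
    ∃ c : ℝ, 0 < c ∧ ∀ᶠ X : ℝ in atTop, c * log (log X) ≤ ∑ p ∈ midPrimes X, (1 : ℝ) / p := by
  obtain ⟨K, hK⟩ := exists_le_sum_block_prime_inv
  refine ⟨1 / 48, by norm_num, ?_⟩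
  have hlog : Tendsto (fun L : ℝ => L / 2 - (log 9 + 2 * log L)) atTop atTop := by
    have h := Real.isLittleO_log_id_atTop.bound (show (0 : ℝ) < 1 / 8 by norm_num)
    refine tendsto_atTop_mono' _ ?_ (tendsto_atTop_add_const_right _ (-log 9)
      (tendsto_id.atTop_mul_const (show (0 : ℝ) < 1 / 4 by norm_num)))
    filter_upwards [h, eventually_ge_atTop 0] with L h h0
    have := (le_abs_self _).trans h
    simp only [id] at this ⊢
    rw [Real.norm_of_nonneg h0] at this
    linarith
  filter_upwards [tendsto_log_log.eventually (hlog.eventually_ge_atTop 0),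
    tendsto_log_log.eventually_ge_atTop 3,
    tendsto_log_log.eventually_ge_atTop (K + 1), eventually_gt_atTop 1] with X h1 h2 h3 hX1
  set L := log (log X) with hL
  have hlX : log X = exp L := by rw [hL, Real.exp_log (Real.log_pos hX1)]
  have hl2 := Real.log_two_gt_d9
  have hl2' := Real.log_two_lt_d9
  have hl8 : log 8 = 3 * log 2 := by
    rw [show (8 : ℝ) = 2 ^ 3 by norm_num, Real.log_pow]; push_cast; ring
  set m : ℕ := ⌊L ^ 2 / log 8⌋₊ + 1 with hm
  set n : ℕ := ⌊log X / (2 * log 8)⌋₊ with hn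
  have hm1 : L ^ 2 / log 8 < m := by rw [hm]; push_cast; exact Nat.lt_floor_add_one _
  have hm2 : (m : ℝ) + 1 ≤ L ^ 2 := by
    have := Nat.floor_le (show 0 ≤ L ^ 2 / log 8 by positivity)
    rw [hm]; push_cast
    have h5 : L ^ 2 / log 8 ≤ L ^ 2 / 2 := by gcongr; linarith
    nlinarith
  have hKm : K ≤ m := by
    have h5 : L ^ 2 / 3 ≤ L ^ 2 / log 8 := by
      apply div_le_div_of_nonneg_left (by positivity) (by linarith) (by linarith)
    have : (K : ℝ) ≤ m := by nlinarith
    exact_mod_cast this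
  have hn1 : (n : ℝ) ≤ log X / (2 * log 8) :=
    Nat.floor_le (by rw [hlX]; positivity)
  have hn2 : log X / 9 ≤ (n : ℝ) + 1 := by
    refine le_trans ?_ (Nat.lt_floor_add_one _).le
    rw [hlX]
    apply div_le_div_of_nonneg_left (exp_pos _).le (by positivity) (by linarith)
  have hkey : L / 2 ≤ log ((n + 1) / (m + 1)) := by
    have h5 : log X / 9 / L ^ 2 ≤ (n + 1) / (m + 1) := by
      rw [hlX] at hn2 ⊢
      gcongr
    have h6 : log (log X / 9 / L ^ 2) = L - (log 9 + 2 * log L) := by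
      rw [hlX, Real.log_div (by positivity) (by positivity),
        Real.log_div (by positivity) (by positivity), Real.log_exp, Real.log_pow]
      push_cast; ring
    have h7 := Real.log_le_log (by rw [hlX]; positivity) h5
    linarith
  have hmn : m ≤ n := by
    by_contra hcon
    have : ((n : ℝ) + 1) / (m + 1) ≤ 1 := by
      rw [div_le_one (by positivity)]
      have : (n : ℝ) ≤ m := by exact_mod_cast (not_le.mp hcon).le
      linarith
    have := Real.log_nonpos (by positivity) this
    linarith
  have h8 : ∑ p ∈ Finset.Ico ((8 : ℕ) ^ m) (8 ^ n), (if p.Prime then (1 : ℝ) / p else 0) ≤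
      ∑ p ∈ midPrimes X, (1 : ℝ) / p := by
    rw [← Finset.sum_filter]
    refine Finset.sum_le_sum_of_subset_of_nonneg (fun p hp => ?_) fun _ _ _ => by positivity
    rw [Finset.mem_filter, Finset.mem_Ico] at hp
    rw [mem_midPrimes]
    refine ⟨?_, hp.2, ?_⟩
    · have h9 : (p : ℝ) ≤ 8 ^ n := by exact_mod_cast hp.1.2.le
      refine h9.trans (Real.le_sqrt_of_sq_le ?_)
      rw [← pow_mul, ← Real.log_le_log_iff (by positivity) (by linarith), Real.log_pow]
      rw [le_div_iff₀ (by positivity)] at hn1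
      push_cast; linarith
    · have h9 : (8 : ℝ) ^ m ≤ p := by exact_mod_cast hp.1.1
      refine lt_of_lt_of_le ?_ h9
      rw [← Real.lt_log_iff_exp_lt (by positivity), Real.log_pow]
      rwa [div_lt_iff₀ (by positivity)] at hm1
  refine le_trans ?_ h8
  rw [sum_Ico_pow_eq_sum_blocks 8 (by norm_num) _ hmn]
  calc 1 / 48 * L ≤ 1 / 24 * log ((n + 1) / (m + 1)) := by linarith
    _ ≤ 1 / 24 * ∑ k ∈ Finset.Ico m n, (1 : ℝ) / (k + 1) := by
        gcongr; exact log_div_le_sum_Ico_one_div_succ hmn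
    _ = ∑ k ∈ Finset.Ico m n, 1 / (24 * ((k : ℝ) + 1)) := by
        rw [Finset.mul_sum]; refine Finset.sum_congr rfl fun k _ => by field_simp
    _ ≤ _ := Finset.sum_le_sum fun k hk => hK k (hKm.trans (Finset.mem_Ico.mp hk).1)

/-- `∑_{p₁, p₂ prime} exp(-p₁p₂s)`. -/
def semiprimeExpSumC (s : ℂ) : ℂ := ∑' n : ℕ, if n.Prime then primeExpSumC (n * s) else 0

/-- `∑_{p₁, p₂ prime} exp(-p₁p₂y)` for real `y`. -/
def semiprimeExpSum (y : ℝ) : ℝ := ∑' n : ℕ, if n.Prime then primeExpSum (n * y) else 0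

/-- The term of `semiprimeExpSumC` at a pair of integers. -/
def semiprimeTermC (s : ℂ) (x : ℕ × ℕ) : ℂ :=
  if x.1.Prime ∧ x.2.Prime then Complex.exp (-(x.1 * (x.2 * s))) else 0

/-- The term of `semiprimeExpSum` at a pair of integers. -/
def semiprimeTerm (y : ℝ) (x : ℕ × ℕ) : ℝ :=
  if x.1.Prime ∧ x.2.Prime then exp (-(x.1 * (x.2 * y))) else 0

lemma semiprimeTerm_nonneg (y : ℝ) (x : ℕ × ℕ) : 0 ≤ semiprimeTerm y x := by
  unfold semiprimeTerm; positivity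

lemma semiprimeTerm_swap (y : ℝ) (x : ℕ × ℕ) : semiprimeTerm y x.swap = semiprimeTerm y x := by
  simp only [semiprimeTerm, Prod.fst_swap, Prod.snd_swap, and_comm, mul_left_comm]

lemma semiprimeTermC_swap (s : ℂ) (x : ℕ × ℕ) : semiprimeTermC s x.swap = semiprimeTermC s x := by
  simp only [semiprimeTermC, Prod.fst_swap, Prod.snd_swap, and_comm, mul_left_comm]

lemma semiprimeTerm_le_mul {y : ℝ} (hy : 0 ≤ y) (x : ℕ × ℕ) : semiprimeTerm y x ≤
    (if x.1.Prime then exp (-(x.1 * y)) else 0) * (if x.2.Prime then exp (-(x.2 * y)) else 0) := by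
  unfold semiprimeTerm
  split_ifs with h h1 h2 h2
  · rw [← Real.exp_add, Real.exp_le_exp]
    have h3 : (2 : ℝ) ≤ x.1 := by exact_mod_cast h1.two_le
    have h4 : (2 : ℝ) ≤ x.2 := by exact_mod_cast h2.two_le
    have : (x.1 : ℝ) + x.2 ≤ x.1 * x.2 := by nlinarith
    nlinarith
  all_goals first | positivity | tauto

lemma summable_semiprimeTerm {y : ℝ} (hy : 0 < y) : Summable (semiprimeTerm y) :=
  ((summable_primeExpSum hy).mul_of_nonneg (summable_primeExpSum hy)
    (fun _ => by positivity) (fun _ => by positivity)).of_nonneg_of_le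
    (semiprimeTerm_nonneg y) (semiprimeTerm_le_mul hy.le)

lemma norm_semiprimeTermC_le {s : ℂ} {y : ℝ} (h : y ≤ s.re) (x : ℕ × ℕ) :
    ‖semiprimeTermC s x‖ ≤ semiprimeTerm y x := by
  unfold semiprimeTermC semiprimeTerm
  split_ifs
  · rw [Complex.norm_exp, Real.exp_le_exp]
    have : (-((x.1 : ℂ) * (x.2 * s))).re = -(x.1 * (x.2 * s.re)) := by
      simp
    rw [this]
    gcongr
  · simp

lemma summable_semiprimeTermC {s : ℂ} (hs : 0 < s.re) : Summable (semiprimeTermC s) :=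
  (summable_semiprimeTerm hs).of_norm_bounded (norm_semiprimeTermC_le le_rfl)

lemma tsum_semiprimeTerm_fst (y : ℝ) (n : ℕ) :
    ∑' m, semiprimeTerm y (n, m) = if n.Prime then primeExpSum (n * y) else 0 := by
  unfold semiprimeTerm primeExpSum
  split_ifs with h
  · refine tsum_congr fun m => ?_
    simp only [h, true_and, mul_left_comm]
  · simp [h]

lemma tsum_semiprimeTermC_fst (s : ℂ) (n : ℕ) :
    ∑' m, semiprimeTermC s (n, m) = if n.Prime then primeExpSumC (n * s) else 0 := by
  unfold semiprimeTermC primeExpSumC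
  split_ifs with h
  · refine tsum_congr fun m => ?_
    simp only [h, true_and, mul_left_comm]
  · simp [h]

lemma semiprimeExpSumC_eq_tsum {s : ℂ} (hs : 0 < s.re) :
    semiprimeExpSumC s = ∑' x, semiprimeTermC s x := by
  rw [(summable_semiprimeTermC hs).tsum_prod]
  simp_rw [tsum_semiprimeTermC_fst]; rfl

lemma semiprimeExpSum_eq_tsum {y : ℝ} (hy : 0 < y) :
    semiprimeExpSum y = ∑' x, semiprimeTerm y x := by
  rw [(summable_semiprimeTerm hy).tsum_prod]
  simp_rw [tsum_semiprimeTerm_fst]; rfl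

lemma norm_semiprimeExpSumC_le {s : ℂ} {y : ℝ} (hy : 0 < y) (h : y ≤ s.re) :
    ‖semiprimeExpSumC s‖ ≤ semiprimeExpSum y := by
  rw [semiprimeExpSumC_eq_tsum (hy.trans_le h), semiprimeExpSum_eq_tsum hy]
  exact tsum_of_norm_bounded (summable_semiprimeTerm hy).hasSum (norm_semiprimeTermC_le h)

lemma semiprimeExpSumC_ofReal {y : ℝ} (hy : 0 < y) :
    semiprimeExpSumC y = (semiprimeExpSum y : ℂ) := by
  rw [semiprimeExpSumC_eq_tsum (by simpa using hy), semiprimeExpSum_eq_tsum hy, Complex.ofReal_tsum]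
  refine tsum_congr fun x => ?_
  simp only [semiprimeTermC, semiprimeTerm]
  split_ifs <;> push_cast <;> rfl

lemma semiprimeExpSum_nonneg (y : ℝ) : 0 ≤ semiprimeExpSum y :=
  tsum_nonneg fun n => by
    split_ifs
    · exact primeExpSum_nonneg _
    · exact le_rfl

lemma tsum_ite_mem_fst_semiprimeTermC {s : ℂ} (hs : 0 < s.re) (I : Finset ℕ)
    (hI : ∀ n ∈ I, n.Prime) :
    ∑' x : ℕ × ℕ, (if x.1 ∈ I then semiprimeTermC s x else 0) =
      ∑ p ∈ I, primeExpSumC (p * s) := by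
  have hsum : Summable fun x : ℕ × ℕ => if x.1 ∈ I then semiprimeTermC s x else 0 :=
    (summable_semiprimeTermC hs).norm.of_norm_bounded fun x => by split_ifs <;> simp
  rw [hsum.tsum_prod, tsum_eq_sum (s := I)]
  · refine Finset.sum_congr rfl fun p hp => ?_
    simp only [hp, if_true]
    rw [tsum_semiprimeTermC_fst, if_pos (hI p hp)]
  · intro n hn; simp [hn]

lemma tsum_ite_mem_fst_semiprimeTerm {y : ℝ} (hy : 0 < y) (I : Finset ℕ)
    (hI : ∀ n ∈ I, n.Prime) :
    ∑' x : ℕ × ℕ, (if x.1 ∈ I then semiprimeTerm y x else 0) =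
      ∑ p ∈ I, primeExpSum (p * y) := by
  have hsum : Summable fun x : ℕ × ℕ => if x.1 ∈ I then semiprimeTerm y x else 0 :=
    (summable_semiprimeTerm hy).of_nonneg_of_le
      (fun x => by split_ifs <;> first | exact semiprimeTerm_nonneg y x | exact le_rfl)
      fun x => by split_ifs <;> first | exact semiprimeTerm_nonneg y x | exact le_rfl
  rw [hsum.tsum_prod, tsum_eq_sum (s := I)]
  · refine Finset.sum_congr rfl fun p hp => ?_
    simp only [hp, if_true]
    rw [tsum_semiprimeTerm_fst, if_pos (hI p hp)]
  · intro n hn; simp [hn]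

/-- The primes up to `exp((log log X)²)`. -/
def smallPrimes (X : ℝ) : Finset ℕ :=
  (Finset.Icc 0 ⌊exp (log (log X) ^ 2)⌋₊).filter Nat.Prime

lemma mem_smallPrimes {X : ℝ} {p : ℕ} :
    p ∈ smallPrimes X ↔ (p : ℝ) ≤ exp (log (log X) ^ 2) ∧ p.Prime := by
  rw [smallPrimes, Finset.mem_filter, Finset.mem_Icc, Nat.le_floor_iff (exp_pos _).le]
  simp

/-- Majorant for the pairs that are not counted exactly twice by one factor in `midPrimes`. -/
lemma norm_semiprimeTermC_sub_le {X : ℝ} (hX : 0 < X) {s : ℂ} (hs : 1 / X ≤ s.re) (x : ℕ × ℕ) :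
    ‖semiprimeTermC s x - (if x.1 ∈ midPrimes X then semiprimeTermC s x else 0)
        - (if x.2 ∈ midPrimes X then semiprimeTermC s x else 0)‖ ≤
      (if x.1 ∈ smallPrimes X then semiprimeTerm (1 / X) x else 0) +
      (if x.2 ∈ smallPrimes X then semiprimeTerm (1 / X) x else 0) +
      (if x.1.Prime then exp (-(x.1 * (1 / (2 * √X)))) else 0) *
        (if x.2.Prime then exp (-(x.2 * (1 / (2 * √X)))) else 0) +
      (if x ∈ midPrimes X ×ˢ midPrimes X then 1 else 0) := by
  by_cases hp : x.1.Prime ∧ x.2.Prime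
  swap
  · have : semiprimeTermC s x = 0 := if_neg hp
    have h0 := semiprimeTerm_nonneg (1 / X) x
    simp only [this, ite_self, sub_zero, norm_zero]
    positivity
  have hg := norm_semiprimeTermC_le hs x
  have hg0 := semiprimeTerm_nonneg (1 / X) x
  have hg1 : semiprimeTerm (1 / X) x ≤ 1 := by
    rw [semiprimeTerm, if_pos hp, Real.exp_le_one_iff, neg_nonpos]; positivity
  rw [if_pos hp.1, if_pos hp.2, ← Real.exp_add]
  have he := (exp_pos (-(x.1 * (1 / (2 * √X))) + -(x.2 * (1 / (2 * √X)))))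
  by_cases h1 : x.1 ∈ smallPrimes X
  · have h1' : x.1 ∉ midPrimes X := fun h =>
      absurd (mem_smallPrimes.mp h1).1 (not_le.mpr (mem_midPrimes.mp h).2.2)
    rw [if_pos h1, if_neg h1', sub_zero]
    have : ‖semiprimeTermC s x - (if x.2 ∈ midPrimes X then semiprimeTermC s x else 0)‖ ≤
        semiprimeTerm (1 / X) x := by
      split_ifs
      · simpa using hg0
      · simpa using hg
    refine this.trans ?_
    have hb : 0 ≤ (if x.2 ∈ smallPrimes X then semiprimeTerm (1 / X) x else 0) := by positivity
    have hc : (0 : ℝ) ≤ (if x ∈ midPrimes X ×ˢ midPrimes X then 1 else 0) := by positivity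
    linarith
  by_cases h2 : x.2 ∈ smallPrimes X
  · have h2' : x.2 ∉ midPrimes X := fun h =>
      absurd (mem_smallPrimes.mp h2).1 (not_le.mpr (mem_midPrimes.mp h).2.2)
    rw [if_pos h2, if_neg h2', if_neg h1, sub_zero]
    have : ‖semiprimeTermC s x - (if x.1 ∈ midPrimes X then semiprimeTermC s x else 0)‖ ≤
        semiprimeTerm (1 / X) x := by
      split_ifs
      · simpa using hg0
      · simpa using hg
    refine this.trans ?_
    have hc : (0 : ℝ) ≤ (if x ∈ midPrimes X ×ˢ midPrimes X then 1 else 0) := by positivity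
    linarith
  rw [if_neg h1, if_neg h2, zero_add, zero_add]
  have large : ∀ n : ℕ, n.Prime → n ∉ smallPrimes X → n ∉ midPrimes X → √X < n := by
    intro n hn ha hb
    rw [mem_smallPrimes] at ha
    rw [mem_midPrimes] at hb
    by_contra hcon
    exact hb ⟨not_lt.mp hcon, hn, not_le.mp fun h => ha ⟨h, hn⟩⟩
  by_cases h3 : x.1 ∈ midPrimes X <;> by_cases h4 : x.2 ∈ midPrimes X
  · simp only [h3, h4, Finset.mem_product, and_self, if_true, sub_self, zero_sub, norm_neg]
    linarith
  · simp only [h3, h4, if_true, if_false, Finset.mem_product, and_false, sub_self, norm_zero]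
    positivity
  · simp only [h3, h4, if_true, if_false, Finset.mem_product, false_and, sub_zero, sub_self,
      norm_zero]
    positivity
  · simp only [h3, h4, if_false, Finset.mem_product, false_and, sub_zero, add_zero]
    refine hg.trans ?_
    rw [semiprimeTerm, if_pos hp, Real.exp_le_exp]
    have h5 := large _ hp.1 h1 h3
    have h6 := large _ hp.2 h2 h4
    have hs0 : 0 < √X := Real.sqrt_pos.mpr hX
    have hsX : √X * √X = X := Real.mul_self_sqrt hX.le
    have : ((x.1 : ℝ) + x.2) * √X ≤ 2 * (x.1 * x.2) := by nlinarith
    rw [← neg_add, neg_le_neg_iff, ← add_mul, mul_one_div, mul_one_div, mul_div_assoc',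
      div_le_div_iff₀ (by positivity) hX]
    nlinarith

/-- Dirichlet's hyperbola method for the sum over products of two primes. -/
lemma norm_semiprimeExpSumC_sub_le {X : ℝ} (hX : 0 < X) {s : ℂ} (hs : 1 / X ≤ s.re) :
    ‖semiprimeExpSumC s - 2 * ∑ p ∈ midPrimes X, primeExpSumC (p * s)‖ ≤
      2 * ∑ p ∈ smallPrimes X, primeExpSum (p * (1 / X)) + primeExpSum (1 / (2 * √X)) ^ 2 +
        ((midPrimes X).card : ℝ) ^ 2 := by
  have hX' : 0 < 1 / X := by positivity
  have hs' : 0 < s.re := hX'.trans_le hs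
  have hsq : 0 < 1 / (2 * √X) := by have := Real.sqrt_pos.mpr hX; positivity
  have hf := summable_semiprimeTermC hs'
  have hg := summable_semiprimeTerm hX'
  have hI : ∀ p ∈ midPrimes X, p.Prime := fun p hp => (mem_midPrimes.mp hp).2.1
  have hA : ∀ p ∈ smallPrimes X, p.Prime := fun p hp => (mem_smallPrimes.mp hp).2
  have hf1 : Summable fun x : ℕ × ℕ => if x.1 ∈ midPrimes X then semiprimeTermC s x else 0 :=
    hf.norm.of_norm_bounded fun x => by split_ifs <;> simp
  have hf2 : Summable fun x : ℕ × ℕ => if x.2 ∈ midPrimes X then semiprimeTermC s x else 0 :=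
    hf.norm.of_norm_bounded fun x => by split_ifs <;> simp
  have hg1 : Summable fun x : ℕ × ℕ =>
      if x.1 ∈ smallPrimes X then semiprimeTerm (1 / X) x else 0 :=
    hg.of_norm_bounded fun x => by
      split_ifs <;> simp [abs_of_nonneg, semiprimeTerm_nonneg]
  have hg2 : Summable fun x : ℕ × ℕ =>
      if x.2 ∈ smallPrimes X then semiprimeTerm (1 / X) x else 0 :=
    hg.of_norm_bounded fun x => by
      split_ifs <;> simp [abs_of_nonneg, semiprimeTerm_nonneg]
  have hS := summable_primeExpSum hsq
  have hg3 := hS.mul_of_nonneg hS (fun _ => by positivity) (fun _ => by positivity)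
  have hg4 : Summable fun x : ℕ × ℕ =>
      if x ∈ midPrimes X ×ˢ midPrimes X then (1 : ℝ) else 0 :=
    summable_of_ne_finset_zero (s := midPrimes X ×ˢ midPrimes X) fun x hx => if_neg hx
  have e1 := tsum_ite_mem_fst_semiprimeTermC hs' _ hI
  have e2 : ∑' x : ℕ × ℕ, (if x.2 ∈ midPrimes X then semiprimeTermC s x else 0) =
      ∑ p ∈ midPrimes X, primeExpSumC (p * s) := by
    rw [← e1, ← (Equiv.prodComm ℕ ℕ).tsum_eq]
    refine tsum_congr fun x => ?_
    simp [semiprimeTermC_swap]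
  have e3 := tsum_ite_mem_fst_semiprimeTerm hX' _ hA
  have e4 : ∑' x : ℕ × ℕ, (if x.2 ∈ smallPrimes X then semiprimeTerm (1 / X) x else 0) =
      ∑ p ∈ smallPrimes X, primeExpSum (p * (1 / X)) := by
    rw [← e3, ← (Equiv.prodComm ℕ ℕ).tsum_eq]
    refine tsum_congr fun x => ?_
    simp [semiprimeTerm_swap]
  have e5 := hS.tsum_mul_tsum hS hg3
  have e6 : ∑' x : ℕ × ℕ, (if x ∈ midPrimes X ×ˢ midPrimes X then (1 : ℝ) else 0) =
      ((midPrimes X).card : ℝ) ^ 2 := by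
    rw [tsum_eq_sum (s := midPrimes X ×ˢ midPrimes X) fun x hx => if_neg hx,
      Finset.sum_ite_mem, Finset.inter_self, Finset.sum_const, Finset.card_product]
    simp [sq]
  have key := tsum_of_norm_bounded (((hg1.hasSum.add hg2.hasSum).add hg3.hasSum).add hg4.hasSum)
    (norm_semiprimeTermC_sub_le hX hs)
  rw [(hf.sub hf1).tsum_sub hf2, hf.tsum_sub hf1, ← semiprimeExpSumC_eq_tsum hs', e1, e2, e3, e4,
    ← e5, e6] at key
  refine le_trans (le_of_eq ?_) (key.trans (le_of_eq ?_))
  · congr 1; ring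
  · rw [primeExpSum]; ring

/-- The order of magnitude of the number of products of two primes up to `X`. -/
def semiprimeScale (X : ℝ) : ℝ := X * log (log X) / log X

lemma eventually_sq_log_log_le :
    ∀ᶠ X : ℝ in atTop, log (log X) ^ 2 ≤ log X / 2 := by
  have h : ∀ᶠ L : ℝ in atTop, L ^ 2 ≤ exp L / 2 := by
    filter_upwards [(Real.tendsto_exp_div_pow_atTop 2).eventually_ge_atTop 2,
      eventually_gt_atTop 0] with L hL h0
    rw [le_div_iff₀ (by positivity)] at hL
    linarith
  filter_upwards [tendsto_log_log.eventually h, eventually_gt_atTop 1] with X hX h1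
  rwa [Real.exp_log (Real.log_pos h1)] at hX

lemma eventually_exp_sq_log_log_le :
    ∀ᶠ X : ℝ in atTop, exp (log (log X) ^ 2) ≤ √X := by
  filter_upwards [eventually_sq_log_log_le, eventually_gt_atTop 0] with X hX h0
  rw [← Real.le_log_iff_exp_le (Real.sqrt_pos.mpr h0), Real.log_sqrt h0.le]
  exact hX

lemma log_div_ge_half {X p : ℝ} (hX : 1 < X) (hp : 0 < p) (h : p ≤ √X) :
    log X / 2 ≤ log (X / p) := by
  have h1 := Real.log_le_log hp h
  rw [Real.log_sqrt (by linarith)] at h1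
  rw [Real.log_div (by positivity) hp.ne']
  linarith

lemma primeExpSum_mul_one_div_le {X p : ℝ} (hX : 1 < X) (hp : 0 < p) (h : p ≤ √X) :
    primeExpSum (p * (1 / X)) ≤ 30 * (X / log X) * (1 / p) := by
  have hl := Real.log_pos hX
  have h1 := log_div_ge_half hX hp h
  have h2 : 1 < X / p := by
    rw [← Real.log_pos_iff (by positivity)]; linarith
  have h3 := primeExpSum_le h2
  rw [show p * (1 / X) = 1 / (X / p) by field_simp]
  refine h3.trans ?_
  calc 15 * (X / p / log (X / p)) ≤ 15 * (X / p / (log X / 2)) := by gcongr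
    _ = _ := by field_simp; ring

lemma semiprimeExpSumC_asymp {ε : ℝ} (hε : 0 < ε) :
    ∀ᶠ X : ℝ in atTop, ∀ s : ℂ, 1 / X ≤ s.re →
      ‖semiprimeExpSumC s - 2 * ∑ p ∈ midPrimes X, primeExpSumC (p * s)‖ ≤
        ε * semiprimeScale X := by
  have hlog : ∀ᶠ L : ℝ in atTop, 6400 + 5400 * log L ≤ ε * L := by
    filter_upwards [Real.isLittleO_log_id_atTop.bound (show 0 < ε / 10800 by positivity),
      eventually_ge_atTop 0, eventually_ge_atTop (12800 / ε)] with L h h0 h1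
    have := (le_abs_self _).trans h
    rw [id, Real.norm_of_nonneg h0] at this
    rw [div_le_iff₀ hε] at h1
    linarith
  filter_upwards [eventually_exp_sq_log_log_le, tendsto_log_log.eventually hlog,
    tendsto_log_log.eventually_ge_atTop 2, eventually_gt_atTop 1] with X hP hL hL2 hX s hs
  refine (norm_semiprimeExpSumC_sub_le (by linarith) hs).trans ?_
  have hl := Real.log_pos hX
  have hl1 : 1 ≤ log X := by
    have := Real.log_le_sub_one_of_pos hl
    linarith
  have hs1 : 1 < √X := by rw [Real.lt_sqrt (by norm_num)]; linarith
  have hls : log √X = log X / 2 := Real.log_sqrt (by linarith)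
  have hsq : √X ^ 2 = X := Real.sq_sqrt (by linarith)
  have b1 : ∑ p ∈ smallPrimes X, primeExpSum (p * (1 / X)) ≤
      30 * (X / log X) * (45 * (1 + 2 * log (log (log X)))) := by
    have h3 : 3 ≤ exp (log (log X) ^ 2) := by
      have := Real.add_one_le_exp (log (log X) ^ 2)
      nlinarith
    have h4 := sum_prime_inv_le h3
    rw [Real.log_exp, Real.log_pow, ← Finset.sum_filter] at h4
    push_cast at h4
    refine le_trans (Finset.sum_le_sum (g := fun p : ℕ => 30 * (X / log X) * (1 / p))
      fun p hp => ?_) ?_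
    · rw [mem_smallPrimes] at hp
      exact primeExpSum_mul_one_div_le hX (by exact_mod_cast hp.2.pos) (hp.1.trans hP)
    · rw [← Finset.mul_sum]
      gcongr
      exact h4
  have b2 : primeExpSum (1 / (2 * √X)) ^ 2 ≤ 3600 * (X / log X) := by
    have := primeExpSum_two_mul_le hs1
    calc primeExpSum (1 / (2 * √X)) ^ 2 ≤ (30 * (√X / log √X)) ^ 2 := by
          gcongr
          exact primeExpSum_nonneg _
      _ = 3600 * (X / log X) / log X := by
          rw [hls, mul_pow, div_pow, hsq]; field_simp; ring
      _ ≤ 3600 * (X / log X) := div_le_self (by positivity) hl1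
  have b3 : ((midPrimes X).card : ℝ) ^ 2 ≤ 100 * (X / log X) := by
    have h5 : ((midPrimes X).card : ℝ) ≤ 5 * √X / log √X := by
      refine le_trans ?_ (primeCounting_floor_le hs1)
      rw [← sum_Icc_prime_eq_primeCounting, ← Finset.sum_filter, Finset.sum_const, nsmul_eq_mul,
        mul_one]
      exact_mod_cast Finset.card_le_card fun p hp => by
        rw [midPrimes, Finset.mem_filter] at hp
        exact Finset.mem_filter.mpr ⟨hp.1, hp.2.1⟩
    calc ((midPrimes X).card : ℝ) ^ 2 ≤ (5 * √X / log √X) ^ 2 := by gcongr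
      _ = 100 * (X / log X) / log X := by
          rw [hls, div_pow, mul_pow, hsq]; field_simp; ring
      _ ≤ 100 * (X / log X) := div_le_self (by positivity) hl1
  have hXl : 0 < X / log X := by positivity
  calc _ ≤ 2 * (30 * (X / log X) * (45 * (1 + 2 * log (log (log X))))) + 3600 * (X / log X) +
        100 * (X / log X) := by gcongr
    _ = (X / log X) * (6400 + 5400 * log (log (log X))) := by ring
    _ ≤ (X / log X) * (ε * log (log X)) := by gcongr
    _ = _ := by rw [semiprimeScale]; ring

lemma semiprimeScale_pos_eventually : ∀ᶠ X : ℝ in atTop, 0 < semiprimeScale X := by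
  filter_upwards [tendsto_log_log.eventually_gt_atTop 0, eventually_gt_atTop 1] with X h h1
  have := Real.log_pos h1
  unfold semiprimeScale
  positivity

lemma norm_sum_midPrimes_le :
    ∃ C : ℝ, 0 < C ∧ ∀ᶠ X : ℝ in atTop,
      ∑ p ∈ midPrimes X, primeExpSum (p * (1 / X)) ≤ C * semiprimeScale X := by
  obtain ⟨C, hC, h⟩ := sum_midPrimes_inv_le
  refine ⟨30 * C, by positivity, ?_⟩
  filter_upwards [h, eventually_gt_atTop 1] with X h hX
  have hl := Real.log_pos hX
  refine le_trans (Finset.sum_le_sum (g := fun p : ℕ => 30 * (X / log X) * (1 / p))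
      fun p hp => ?_) ?_
  · rw [mem_midPrimes] at hp
    exact primeExpSum_mul_one_div_le hX (by exact_mod_cast hp.2.1.pos) hp.1
  · rw [← Finset.mul_sum]
    calc 30 * (X / log X) * ∑ p ∈ midPrimes X, (1 : ℝ) / p ≤
        30 * (X / log X) * (C * log (log X)) := by gcongr
      _ = _ := by rw [semiprimeScale]; ring

lemma semiprimeExpSum_asymp {ε : ℝ} (hε : 0 < ε) :
    ∀ᶠ X : ℝ in atTop,
      |semiprimeExpSum (1 / X) - 2 * ∑ p ∈ midPrimes X, primeExpSum (p * (1 / X))| ≤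
        ε * semiprimeScale X := by
  filter_upwards [semiprimeExpSumC_asymp hε, eventually_gt_atTop 0] with X h hX
  have h1 := h ((1 / X : ℝ) : ℂ) (by rw [Complex.ofReal_re])
  rw [semiprimeExpSumC_ofReal (by positivity)] at h1
  have h2 : ∀ p ∈ midPrimes X, primeExpSumC (p * ((1 / X : ℝ) : ℂ)) =
      (primeExpSum (p * (1 / X)) : ℂ) := by
    intro p _
    rw [← primeExpSumC_ofReal]
    push_cast; rfl
  rw [Finset.sum_congr rfl h2] at h1
  rw [← Real.norm_eq_abs, ← Complex.norm_real]
  push_cast at h1 ⊢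
  exact h1

lemma semiprimeExpSum_le_scale :
    ∃ C : ℝ, 0 < C ∧ ∀ᶠ X : ℝ in atTop, semiprimeExpSum (1 / X) ≤ C * semiprimeScale X := by
  obtain ⟨C, hC, h⟩ := norm_sum_midPrimes_le
  refine ⟨2 * C + 1, by positivity, ?_⟩
  filter_upwards [h, semiprimeExpSum_asymp one_pos] with X h h1
  have := (abs_le.mp h1).2
  linarith

lemma eventually_half_le_primeExpSum :
    ∀ᶠ Y : ℝ in atTop, 1 / 2 * (Y / log Y) ≤ primeExpSum (1 / Y) := by
  filter_upwards [primeExpSumC_asymp 1 one_pos (show (0 : ℝ) < 1 / 2 by norm_num),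
    eventually_gt_atTop 1] with Y h hY
  have h1 := h 1 (by simp) (by simp) 0 (isUnit_of_subsingleton _)
  simp only [ArithmeticFunction.moebius_apply_one, Nat.totient_one, Int.cast_one, Nat.cast_one,
    div_one, one_mul, mul_one, Int.cast_zero, mul_zero, sub_zero] at h1
  have h2 : (1 : ℂ) / Y = ((1 / Y : ℝ) : ℂ) := by push_cast; rfl
  rw [h2, primeExpSumC_ofReal, ← Complex.ofReal_div, ← Complex.ofReal_sub, Complex.norm_real,
    Real.norm_eq_abs] at h1
  have := (abs_le.mp h1).1
  linarith

lemma eventually_forall_midPrimes {P : ℝ → Prop} (h : ∀ᶠ Y : ℝ in atTop, P Y) :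
    ∀ᶠ X : ℝ in atTop, ∀ p ∈ midPrimes X, P (X / p) := by
  obtain ⟨Y₀, hY₀⟩ := eventually_atTop.mp h
  filter_upwards [Real.tendsto_sqrt_atTop.eventually_ge_atTop Y₀, eventually_gt_atTop 0]
    with X hX h0 p hp
  rw [mem_midPrimes] at hp
  have hp0 : (0 : ℝ) < p := by exact_mod_cast hp.2.1.pos
  refine hY₀ _ (hX.trans ?_)
  rw [le_div_iff₀ hp0]
  calc √X * p ≤ √X * √X := by gcongr; exact hp.1
    _ = X := Real.mul_self_sqrt h0.le

lemma scale_le_semiprimeExpSum :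
    ∃ c : ℝ, 0 < c ∧ ∀ᶠ X : ℝ in atTop, c * semiprimeScale X ≤ semiprimeExpSum (1 / X) := by
  obtain ⟨c, hc, h⟩ := exists_le_sum_midPrimes_inv
  refine ⟨c / 2, by positivity, ?_⟩
  filter_upwards [h, semiprimeExpSum_asymp (half_pos hc),
    eventually_forall_midPrimes eventually_half_le_primeExpSum, eventually_gt_atTop 1,
    eventually_forall_midPrimes (eventually_gt_atTop 1)] with X h h1 h2 hX h3
  have hl := Real.log_pos hX
  have h4 : (1 / 2) * (X / log X) * ∑ p ∈ midPrimes X, (1 : ℝ) / p ≤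
      ∑ p ∈ midPrimes X, primeExpSum (p * (1 / X)) := by
    rw [Finset.mul_sum]
    refine Finset.sum_le_sum fun p hp => ?_
    have hp0 : (1 : ℝ) ≤ p := by exact_mod_cast (mem_midPrimes.mp hp).2.1.one_lt.le
    have h5 := h2 p hp
    have h6 := h3 p hp
    rw [show (p : ℝ) * (1 / X) = 1 / (X / p) by field_simp]
    refine le_trans ?_ h5
    have h7 : 0 < log (X / p) := Real.log_pos h6
    have h8 : log (X / p) ≤ log X := Real.log_le_log (by linarith) (div_le_self (by linarith) hp0)
    calc 1 / 2 * (X / log X) * (1 / p) = 1 / 2 * (X / p / log X) := by field_simp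
      _ ≤ _ := by gcongr
  have h5 := (abs_le.mp h1).1
  have h6 : c * semiprimeScale X ≤ X / log X * ∑ p ∈ midPrimes X, (1 : ℝ) / p := by
    calc c * semiprimeScale X = X / log X * (c * log (log X)) := by rw [semiprimeScale]; ring
      _ ≤ _ := by gcongr
  linarith

lemma primeExpSum_le_inv {y : ℝ} (hy : 0 < y) : primeExpSum y ≤ 1 / y := by
  have hr : exp (-y) < 1 := by rw [Real.exp_lt_one_iff]; linarith
  have hg := hasSum_geometric_of_lt_one (exp_pos (-y)).le hr
  have h1 : ∀ n : ℕ, (if (n + 1).Prime then exp (-(((n + 1 : ℕ) : ℝ) * y)) else 0) ≤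
      exp (-y) * exp (-y) ^ n := by
    intro n
    have : exp (-y) * exp (-y) ^ n = exp (-(((n + 1 : ℕ) : ℝ) * y)) := by
      rw [← Real.exp_nat_mul, ← Real.exp_add]; congr 1; push_cast; ring
    rw [this]
    split_ifs
    · exact le_rfl
    · positivity
  have h2 := (summable_nat_add_iff 1).mpr (summable_primeExpSum hy)
  have h3 := h2.tsum_le_tsum h1 (hg.mul_left _).summable
  rw [(hg.mul_left _).tsum_eq] at h3
  rw [primeExpSum, (summable_primeExpSum hy).tsum_eq_zero_add, if_neg Nat.not_prime_zero, zero_add]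
  refine h3.trans ?_
  rw [← div_eq_mul_inv, div_le_div_iff₀ (by linarith) hy, Real.exp_neg]
  have h4 := Real.add_one_le_exp y
  have h5 := exp_pos y
  rw [one_mul, inv_mul_le_iff₀ h5, mul_sub, mul_one, mul_inv_cancel₀ h5.ne']
  linarith

lemma semiprimeExpSum_le_sq {y : ℝ} (hy : 0 < y) : semiprimeExpSum y ≤ primeExpSum y ^ 2 := by
  have hS := summable_primeExpSum hy
  have hg := hS.mul_of_nonneg hS (fun _ => by positivity) (fun _ => by positivity)
  rw [semiprimeExpSum_eq_tsum hy, sq, primeExpSum, hS.tsum_mul_tsum hS hg]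
  exact (summable_semiprimeTerm hy).tsum_le_tsum (semiprimeTerm_le_mul hy.le) hg

lemma exists_semiprimeExpSum_le_div :
    ∃ C : ℝ, 0 < C ∧ ∀ y : ℝ, 0 < y → semiprimeExpSum y ≤ C / y := by
  obtain ⟨C, hC, h⟩ := semiprimeExpSum_le_scale
  obtain ⟨X₀, hX₀⟩ := eventually_atTop.mp (h.and (eventually_gt_atTop 1))
  have hX1 : 1 < X₀ := (hX₀ X₀ le_rfl).2
  refine ⟨max C X₀, lt_max_of_lt_left hC, fun y hy => ?_⟩
  rcases le_total X₀ (1 / y) with hle | hle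
  · obtain ⟨h1, h2⟩ := hX₀ _ hle
    rw [one_div_one_div] at h1
    refine h1.trans ?_
    have hl := Real.log_pos h2
    have h3 : semiprimeScale (1 / y) ≤ 1 / y := by
      rw [semiprimeScale, mul_div_assoc]
      refine mul_le_of_le_one_right (by positivity) ((div_le_one hl).mpr ?_)
      have := Real.log_le_sub_one_of_pos hl
      linarith
    calc C * semiprimeScale (1 / y) ≤ C * (1 / y) := by gcongr
      _ ≤ max C X₀ * (1 / y) := by gcongr; exact le_max_left _ _
      _ = _ := by ring
  · refine (semiprimeExpSum_le_sq hy).trans ?_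
    have h1 := primeExpSum_le_inv hy
    calc primeExpSum y ^ 2 ≤ (1 / y) ^ 2 := by
          gcongr
          exact primeExpSum_nonneg _
      _ = (1 / y) * (1 / y) := sq _
      _ ≤ X₀ * (1 / y) := by gcongr
      _ ≤ max C X₀ * (1 / y) := by gcongr; exact le_max_right _ _
      _ = _ := by ring

lemma semiprimeExpSum_nat_mul_le :
    ∃ C : ℝ, 0 < C ∧ ∀ᶠ X : ℝ in atTop, ∀ j : ℕ, 1 ≤ j →
      semiprimeExpSum (j * (1 / X)) ≤ C * semiprimeScale X / √j := by
  obtain ⟨C, hC, h⟩ := semiprimeExpSum_le_scale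
  obtain ⟨C', hC', h'⟩ := exists_semiprimeExpSum_le_div
  obtain ⟨X₀, hX₀⟩ := eventually_atTop.mp h
  have hdom : ∀ᶠ X : ℝ in atTop, X₀ ≤ X / log X ^ 2 ∧ 2 * log (log X) ≤ log X / 2 := by
    refine Eventually.and ?_ ?_
    · have h1 : Tendsto (fun X : ℝ => X / log X ^ 2) atTop atTop := by
        refine ((Real.tendsto_exp_div_pow_atTop 2).comp Real.tendsto_log_atTop).congr' ?_
        filter_upwards [eventually_gt_atTop 0] with X hX
        simp [Real.exp_log hX]
      exact h1.eventually_ge_atTop X₀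
    · filter_upwards [eventually_sq_log_log_le, tendsto_log_log.eventually_ge_atTop 2] with X h1 h2
      nlinarith
  refine ⟨2 * C + C', by positivity, ?_⟩
  filter_upwards [hdom, eventually_gt_atTop 1, tendsto_log_log.eventually_ge_atTop 1]
    with X ⟨hd, hd'⟩ hX hL j hj
  have hl := Real.log_pos hX
  have hj0 : (1 : ℝ) ≤ j := by exact_mod_cast hj
  have hsj : 1 ≤ √(j : ℝ) := Real.one_le_sqrt.mpr hj0
  have hsjj : √(j : ℝ) * √j = j := Real.mul_self_sqrt (by linarith)
  have hsc : 0 ≤ semiprimeScale X := by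
    unfold semiprimeScale; positivity
  have e1 : semiprimeExpSum (j * (1 / X)) = semiprimeExpSum (1 / (X / j)) := by
    congr 1; field_simp
  rcases le_total (j : ℝ) (log X ^ 2) with hle | hle
  · have h1 : X₀ ≤ X / j := hd.trans (by gcongr)
    have h2 := hX₀ _ h1
    rw [e1]
    refine h2.trans ?_
    have h3 : log X / 2 ≤ log (X / j) := by
      rw [Real.log_div (by positivity) (by positivity)]
      have := Real.log_le_log (by linarith) hle
      rw [Real.log_pow] at this
      push_cast at this; linarith
    have h4 : semiprimeScale (X / j) ≤ 2 * semiprimeScale X / j := by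
      unfold semiprimeScale
      have h5 : log (log (X / j)) ≤ log (log X) := by
        apply Real.log_le_log (by linarith)
        exact Real.log_le_log (by positivity) (div_le_self (by linarith) hj0)
      calc X / j * log (log (X / j)) / log (X / j) ≤ X / j * log (log X) / (log X / 2) := by
            gcongr
        _ = _ := by field_simp
    calc C * semiprimeScale (X / j) ≤ C * (2 * semiprimeScale X / j) := by gcongr
      _ = 2 * C * semiprimeScale X / j := by ring
      _ ≤ (2 * C + C') * semiprimeScale X / √j := by
          gcongr
          · linarith
          · nlinarith
  · refine (h' _ (by positivity)).trans ?_
    have h1 : log X ≤ √j := Real.le_sqrt_of_sq_le hle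
    have h2 : X / j ≤ semiprimeScale X / √j := by
      have h3 : X / √j ≤ semiprimeScale X := by
        calc X / √j ≤ X / log X := by gcongr
          _ ≤ X * log (log X) / log X := by gcongr; exact le_mul_of_one_le_right (by linarith) hL
      calc X / j = X / √j / √j := by rw [div_div, hsjj]
        _ ≤ _ := by gcongr
    calc C' / (j * (1 / X)) = C' * (X / j) := by field_simp
      _ ≤ C' * (semiprimeScale X / √j) := by gcongr
      _ = C' * semiprimeScale X / √j := by ring
      _ ≤ _ := by gcongr; linarith

lemma factorial_dvd_pow_mul_prod (q m N : ℕ) :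
    N.factorial ∣ q ^ N * ∏ i ∈ Finset.range N, (m + i * q) := by
  rw [Nat.dvd_iff_prime_pow_dvd_dvd]
  intro p k hp hpk
  by_cases hpq : p ∣ q
  · refine Dvd.dvd.mul_right ?_ _
    have hk : k ≤ N := by
      have h1 : k ≤ padicValNat p N.factorial := by
        have := Fact.mk hp
        exact (padicValNat_dvd_iff_le (Nat.factorial_ne_zero N)).mp hpk
      have := Fact.mk hp
      have h2 := sub_one_mul_padicValNat_factorial (p := p) N
      have h3 : padicValNat p N.factorial ≤ (p - 1) * padicValNat p N.factorial :=
        Nat.le_mul_of_pos_left _ (Nat.sub_pos_of_lt hp.one_lt)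
      omega
    exact (pow_dvd_pow p hk).trans (pow_dvd_pow_of_dvd hpq N)
  · refine Dvd.dvd.mul_left ?_ _
    have hcop : Nat.Coprime q (p ^ k) :=
      (Nat.Coprime.pow_left k ((Nat.Prime.coprime_iff_not_dvd hp).mpr hpq)).symm
    obtain ⟨u, hu⟩ := (ZMod.isUnit_iff_coprime q (p ^ k)).mpr hcop
    have : NeZero (p ^ k) := ⟨(pow_pos hp.pos k).ne'⟩
    set v : ℕ := ((u⁻¹ : (ZMod (p ^ k))ˣ) : ZMod (p ^ k)).val with hv
    have hv' : (v : ZMod (p ^ k)) = ((u⁻¹ : (ZMod (p ^ k))ˣ) : ZMod (p ^ k)) :=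
      ZMod.natCast_zmod_val _
    have h1 : p ^ k ∣ (v * m).ascFactorial N := hpk.trans (Nat.factorial_dvd_ascFactorial _ _)
    rw [Nat.ascFactorial_eq_prod_range, ← ZMod.natCast_eq_zero_iff] at h1
    rw [← ZMod.natCast_eq_zero_iff]
    have h2 : ((∏ i ∈ Finset.range N, (m + i * q) : ℕ) : ZMod (p ^ k)) =
        (q : ZMod (p ^ k)) ^ N * ((∏ i ∈ Finset.range N, (v * m + i) : ℕ) : ZMod (p ^ k)) := by
      push_cast
      rw [← Finset.card_range N, ← Finset.prod_const, Finset.card_range, ← Finset.prod_mul_distrib]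
      refine Finset.prod_congr rfl fun i _ => ?_
      rw [hv', ← hu, mul_add, ← mul_assoc, Units.mul_inv, one_mul, mul_comm]
    rw [h2, h1, mul_zero]

/-- A Brun–Titchmarsh type bound for the number of primes among the terms of an arithmetic
progression. -/
lemma card_primes_progression_mul_log_le {q m N : ℕ} (hq : 0 < q) (hN : 0 < N) (hm : N < m)
    (S : Finset ℕ) (hS : ∀ p ∈ S, p.Prime ∧ ∃ i < N, p = m + i * q) :
    (S.card : ℝ) * log m ≤ N * (1 + log q + log ((m + N * q) / N)) := by
  have hprod : ∏ p ∈ S, p ∣ ∏ i ∈ Finset.range N, (m + i * q) := by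
    have himg : ∏ i ∈ Finset.range N, (m + i * q) =
        ∏ x ∈ (Finset.range N).image fun i => m + i * q, x := by
      rw [Finset.prod_image]
      intro i _ j _ hij
      simpa [hq.ne'] using hij
    rw [himg]
    refine Finset.prod_dvd_prod_of_subset _ _ _ fun p hp => ?_
    obtain ⟨_, i, hi, rfl⟩ := hS p hp
    exact Finset.mem_image.mpr ⟨i, Finset.mem_range.mpr hi, rfl⟩
  have hcop : Nat.Coprime N.factorial (∏ p ∈ S, p) := by
    refine Nat.Coprime.prod_right fun p hp => ?_
    obtain ⟨hpp, i, hi, hpi⟩ := hS p hp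
    refine ((Nat.Prime.coprime_iff_not_dvd hpp).mpr ?_).symm
    rw [hpp.dvd_factorial]
    omega
  have hdvd := hcop.mul_dvd_of_dvd_of_dvd (factorial_dvd_pow_mul_prod q m N)
    (hprod.mul_left (q ^ N))
  have hpos : 0 < q ^ N * ∏ i ∈ Finset.range N, (m + i * q) := by
    refine Nat.mul_pos (pow_pos hq N) (Finset.prod_pos fun i _ => ?_)
    omega
  have hle := Nat.le_of_dvd hpos hdvd
  have h1 : m ^ S.card ≤ ∏ p ∈ S, p := by
    rw [← Finset.prod_const]
    refine Finset.prod_le_prod' fun p hp => ?_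
    obtain ⟨_, i, _, rfl⟩ := hS p hp
    omega
  have h2 : ∏ i ∈ Finset.range N, (m + i * q) ≤ (m + N * q) ^ N := by
    conv_rhs => rw [← Finset.card_range N, ← Finset.prod_const]
    refine Finset.prod_le_prod' fun i hi => ?_
    rw [Finset.card_range]
    have := Finset.mem_range.mp hi
    gcongr
  have h3 : N.factorial * m ^ S.card ≤ q ^ N * (m + N * q) ^ N :=
    (Nat.mul_le_mul_left _ h1).trans (hle.trans (Nat.mul_le_mul_left _ h2))
  have hm0 : (0 : ℝ) < m := by exact_mod_cast (Nat.zero_le N).trans_lt hm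
  have hN0 : (0 : ℝ) < N := by exact_mod_cast hN
  have hq0 : (0 : ℝ) < q := by exact_mod_cast hq
  have h4 : (N.factorial : ℝ) * (m : ℝ) ^ S.card ≤ (q : ℝ) ^ N * (m + N * q) ^ N := by
    exact_mod_cast h3
  have h5 : log N.factorial + S.card * log m ≤ N * log q + N * log (m + N * q) := by
    have := Real.log_le_log (by positivity) h4
    rwa [Real.log_mul (by positivity) (by positivity), Real.log_mul (by positivity) (by positivity),
      Real.log_pow, Real.log_pow, Real.log_pow] at this
  have h6 : N * log N - N ≤ log N.factorial := by
    have h7 : (N : ℝ) ^ N / N.factorial ≤ exp N := Real.pow_div_factorial_le_exp N (by positivity) N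
    have h8 := Real.log_le_log (by positivity) h7
    rw [Real.log_exp, Real.log_div (by positivity) (by positivity), Real.log_pow] at h8
    linarith
  rw [Real.log_div (by positivity) (by positivity)]
  nlinarith

/-- Primes in `[kH, (k+1)H)`. -/
def primeBox (H : ℝ) (k : ℕ) : Finset ℕ :=
  (Finset.range ⌈(k + 1) * H⌉₊).filter fun p => p.Prime ∧ k * H ≤ p

lemma mem_primeBox {H : ℝ} {k p : ℕ} :
    p ∈ primeBox H k ↔ p.Prime ∧ k * H ≤ p ∧ (p : ℝ) < (k + 1) * H := by
  rw [primeBox, Finset.mem_filter, Finset.mem_range, Nat.lt_ceil]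
  tauto

/-- Uniform bound for the number of primes of a box in a residue class. -/
lemma card_primeBox_residueClass_le {q : ℕ} [NeZero q] {H : ℝ} (hH : q ≤ H) {k : ℕ} (hk : 3 ≤ k)
    (r : ZMod q) :
    (((primeBox H k).filter fun p : ℕ => (p : ZMod q) = r).card : ℝ) ≤
      2 * H / q * (1 + 2 * log q + log (4 * k)) / log (k * H) := by
  have hq : 0 < q := Nat.pos_of_ne_zero (NeZero.ne q)
  have hq1 : (1 : ℝ) ≤ q := by exact_mod_cast hq
  have hk3 : (3 : ℝ) ≤ k := by exact_mod_cast hk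
  have hkH : 1 < k * H := by nlinarith
  have hlkH := Real.log_pos hkH
  set S := (primeBox H k).filter fun p : ℕ => (p : ZMod q) = r with hS
  rcases S.eq_empty_or_nonempty with he | hne
  · rw [he]
    have : 0 ≤ log q := Real.log_nonneg hq1
    have : 0 ≤ log (4 * k) := Real.log_nonneg (by linarith)
    have : 0 ≤ H := by linarith
    simp only [Finset.card_empty, Nat.cast_zero]
    positivity
  set m := S.min' hne with hm
  have hmS : m ∈ S := S.min'_mem hne
  have hmem : ∀ p ∈ S, p.Prime ∧ k * H ≤ p ∧ (p : ℝ) < (k + 1) * H ∧ (p : ZMod q) = r := by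
    intro p hp
    rw [hS, Finset.mem_filter, mem_primeBox] at hp
    tauto
  obtain ⟨hmp, hmk, hmk', hmr⟩ := hmem m hmS
  set N := ⌊H / q⌋₊ + 1 with hN
  have hN1 : H / q < N := by rw [hN]; push_cast; exact Nat.lt_floor_add_one _
  have hN2 : (N : ℝ) ≤ 2 * H / q := by
    have h1 := Nat.floor_le (show 0 ≤ H / q from div_nonneg (by linarith) (by linarith))
    have h2 : 1 ≤ H / q := (one_le_div (by positivity)).mpr hH
    rw [hN]; push_cast; rw [mul_div_assoc]; linarith
  have hN2' : (N : ℝ) * q ≤ 2 * H := by rwa [le_div_iff₀ (by positivity)] at hN2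
  have hN0 : (0 : ℝ) < N := by rw [hN]; positivity
  have hNm : N < m := by
    have : (N : ℝ) < m := by nlinarith
    exact_mod_cast this
  have key := card_primes_progression_mul_log_le hq (by omega) hNm S (fun p hp => by
    obtain ⟨hpp, hpk, hpk', hpr⟩ := hmem p hp
    refine ⟨hpp, ?_⟩
    have hmp' : m ≤ p := S.min'_le p hp
    have hd : q ∣ p - m := (Nat.modEq_iff_dvd' hmp').mp
      ((ZMod.natCast_eq_natCast_iff _ _ _).mp (hmr.trans hpr.symm))
    obtain ⟨i, hi⟩ := hd
    refine ⟨i, ?_, by rw [mul_comm]; omega⟩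
    have h1 : ((q * i : ℕ) : ℝ) < H := by
      rw [← hi, Nat.cast_sub hmp']; linarith
    push_cast at h1
    have h2 : (i : ℝ) < N := by
      refine lt_of_lt_of_le ?_ hN1.le
      rw [lt_div_iff₀ (by positivity)]; linarith
    exact_mod_cast h2)
  rw [le_div_iff₀ hlkH]
  have h1 : log (k * H) ≤ log m := Real.log_le_log (by linarith) hmk
  have h2 : log ((m + N * q) / N) ≤ log q + log (4 * k) := by
    rw [← Real.log_mul (by positivity) (by positivity)]
    apply Real.log_le_log (by positivity)
    rw [div_le_iff₀ hN0]
    rw [div_lt_iff₀ (by positivity)] at hN1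
    have h3 : (m : ℝ) + N * q ≤ 4 * k * H := by nlinarith
    refine h3.trans ?_
    calc 4 * k * H ≤ 4 * k * (N * q) := by gcongr
      _ = _ := by ring
  have h0 : 0 ≤ log q := Real.log_nonneg hq1
  have h0' : 0 ≤ log (4 * k) := Real.log_nonneg (by linarith)
  calc (S.card : ℝ) * log (k * H) ≤ S.card * log m := by gcongr
    _ ≤ N * (1 + log q + log ((m + N * q) / N)) := key
    _ ≤ N * (1 + 2 * log q + log (4 * k)) := mul_le_mul_of_nonneg_left (by linarith) hN0.le
    _ ≤ _ := by gcongr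

lemma abs_mul_norm_geom_sum_le {x φ : ℝ} (hx : 0 ≤ x) (hφ : |φ| ≤ 1) (M M' : ℕ) :
    |φ| * ‖∑ i ∈ Finset.Ico M M', Complex.exp (-x + φ * Complex.I) ^ i‖ ≤ 4 := by
  rcases lt_or_ge M' M with hlt | hle
  · rw [Finset.Ico_eq_empty (by omega)]; simp
  set z := Complex.exp (-x + φ * Complex.I) with hz
  have hz1 : ‖z‖ ≤ 1 := by
    rw [hz, Complex.norm_exp]
    simpa using hx
  have h1 := geom_sum_Ico_mul z hle
  have h2 : ‖∑ i ∈ Finset.Ico M M', z ^ i‖ * ‖z - 1‖ ≤ 2 := by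
    rw [← norm_mul, h1]
    refine (norm_sub_le _ _).trans ?_
    rw [norm_pow, norm_pow]
    have := pow_le_one₀ (n := M') (norm_nonneg z) hz1
    have := pow_le_one₀ (n := M) (norm_nonneg z) hz1
    linarith
  have h3 : |φ| / 2 ≤ ‖z - 1‖ := by
    have e : ‖z - 1‖ = ‖Complex.exp (-x) - Complex.exp ((-φ : ℝ) * Complex.I)‖ := by
      have : z - 1 = Complex.exp (φ * Complex.I) *
          (Complex.exp (-x) - Complex.exp ((-φ : ℝ) * Complex.I)) := by
        rw [mul_sub, ← Complex.exp_add, ← Complex.exp_add, hz]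
        congr 1
        · congr 1; ring
        · push_cast
          rw [neg_mul, add_neg_cancel, Complex.exp_zero]
      rw [this, norm_mul, Complex.norm_exp_ofReal_mul_I, one_mul]
    rw [e]
    refine le_trans ?_ (Complex.abs_im_le_norm _)
    have him : (Complex.exp (-x) - Complex.exp ((-φ : ℝ) * Complex.I)).im = sin φ := by
      rw [Complex.sub_im, Complex.exp_ofReal_mul_I_im, Real.sin_neg, ← Complex.ofReal_neg,
        Complex.exp_ofReal_im]
      ring
    rw [him, abs_sin_eq_sin_abs_of_abs_le_pi (hφ.trans (by linarith [Real.pi_gt_three]))]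
    have h4 := Real.mul_le_sin (abs_nonneg φ) (hφ.trans (by linarith [Real.pi_gt_three]))
    refine le_trans ?_ h4
    rw [div_eq_mul_inv, mul_comm]
    gcongr
    rw [inv_eq_one_div, div_le_div_iff₀ (by norm_num) Real.pi_pos]
    linarith [Real.pi_le_four]
  nlinarith [norm_nonneg (∑ i ∈ Finset.Ico M M', z ^ i)]

lemma sum_one_div_abs_sub_add_one_le {M k : ℕ} (hk : k < M) :
    ∑ l ∈ Finset.range M, (1 : ℝ) / (|(k : ℝ) - l| + 1) ≤ 2 * (1 + log M) := by
  have hmono : ∀ n ≤ M, ∑ j ∈ Finset.range n, (1 : ℝ) / (j + 1) ≤ 1 + log M := by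
    intro n hn
    refine le_trans (Finset.sum_le_sum_of_subset_of_nonneg (Finset.range_mono hn)
      fun _ _ _ => by positivity) ?_
    rw [← Nat.Ico_zero_eq_range]
    exact sum_Ico_one_div_succ_le M
  rw [← Finset.sum_range_add_sum_Ico _ hk.le, Finset.sum_Ico_eq_sum_range,
    ← Finset.sum_range_reflect, two_mul]
  refine add_le_add (le_trans (Finset.sum_le_sum fun j hj => ?_) (hmono k hk.le))
    (le_trans (Finset.sum_le_sum fun j hj => ?_) (hmono (M - k) (by omega)))
  · have hj' := Finset.mem_range.mp hj
    have : ((k - 1 - j : ℕ) : ℝ) = k - 1 - j := by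
      rw [Nat.cast_sub (by omega), Nat.cast_sub (by omega)]; push_cast; ring
    rw [this, show (k : ℝ) - (k - 1 - j) = j + 1 by ring, abs_of_nonneg (by positivity)]
    gcongr
    linarith
  · push_cast
    rw [show (k : ℝ) - (k + j) = -j by ring, abs_neg, abs_of_nonneg (by positivity)]

/-- The coefficients `exp(-ik(1 - iτ)/N²)` of the discretised bilinear form. -/
def boxCoeff (N : ℕ) (τ : ℝ) (i k : ℕ) : ℂ :=
  Complex.exp (-((i * k / N ^ 2 : ℝ) * (1 - τ * Complex.I)))

lemma norm_boxCoeff_le_one (N : ℕ) (τ : ℝ) (i k : ℕ) : ‖boxCoeff N τ i k‖ ≤ 1 := by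
  rw [boxCoeff, Complex.norm_exp, Real.exp_le_one_iff, Complex.neg_re, Complex.re_ofReal_mul]
  simp
  positivity

lemma boxCoeff_mul_conj (N : ℕ) (τ : ℝ) (i k l : ℕ) :
    boxCoeff N τ i k * (starRingEnd ℂ) (boxCoeff N τ i l) =
      Complex.exp (-((k + l) / N ^ 2 : ℝ) + (τ * (k - l) / N ^ 2 : ℝ) * Complex.I) ^ i := by
  rw [boxCoeff, boxCoeff, ← Complex.exp_conj, ← Complex.exp_add, ← Complex.exp_nat_mul]
  congr 1
  simp only [map_neg, map_mul, map_sub, map_one, Complex.conj_ofReal, Complex.conj_I]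
  push_cast
  ring

lemma norm_sum_boxCoeff_mul_conj_le {N M : ℕ} {τ : ℝ} (hN : 1 + |τ| ≤ N)
    (hM : |τ| * M ≤ N ^ 2) {k l : ℕ} (hk : k < M) (hl : l < M) :
    (1 + |τ|) * ‖∑ i ∈ Finset.Ico N (2 * N),
        boxCoeff N τ i k * (starRingEnd ℂ) (boxCoeff N τ i l)‖ ≤
      N + 8 * N ^ 2 * (1 / (|(k : ℝ) - l| + 1)) := by
  set G := ∑ i ∈ Finset.Ico N (2 * N), boxCoeff N τ i k * (starRingEnd ℂ) (boxCoeff N τ i l)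
    with hG
  have hN0 : (0 : ℝ) < N := by have := abs_nonneg τ; linarith
  have h1 : ‖G‖ ≤ N := by
    refine (norm_sum_le _ _).trans ((Finset.sum_le_sum (g := fun _ => (1 : ℝ)) fun i _ => ?_).trans
      ?_)
    · rw [norm_mul, RCLike.norm_conj]
      exact mul_le_one₀ (norm_boxCoeff_le_one _ _ _ _) (norm_nonneg _) (norm_boxCoeff_le_one _ _ _ _)
    · simp only [Finset.sum_const, Nat.card_Ico, nsmul_eq_mul, mul_one]
      rw [show 2 * N - N = N by omega]
  rcases eq_or_ne k l with rfl | hkl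
  · rw [sub_self, abs_zero, zero_add, div_one, mul_one]
    nlinarith [norm_nonneg G]
  have hd : 1 ≤ |(k : ℝ) - l| := by
    have : (1 : ℤ) ≤ |(k : ℤ) - l| := Int.one_le_abs (sub_ne_zero.mpr (by exact_mod_cast hkl))
    exact_mod_cast this
  have hd2 : |(k : ℝ) - l| ≤ M := by
    have hk' : (k : ℝ) < M := by exact_mod_cast hk
    have hl' : (l : ℝ) < M := by exact_mod_cast hl
    rw [abs_le]
    constructor <;> linarith [(Nat.cast_nonneg k : (0 : ℝ) ≤ k), (Nat.cast_nonneg l : (0 : ℝ) ≤ l)]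
  have hφ : |τ * (k - l) / N ^ 2| = |τ| * |(k : ℝ) - l| / N ^ 2 := by
    rw [abs_div, abs_mul, abs_of_nonneg (show (0 : ℝ) ≤ N ^ 2 by positivity)]
  have h2 : |τ| * |(k : ℝ) - l| / N ^ 2 * ‖G‖ ≤ 4 := by
    rw [← hφ, hG]
    simp_rw [boxCoeff_mul_conj]
    have := abs_mul_norm_geom_sum_le (x := (k + l) / N ^ 2) (φ := τ * (k - l) / N ^ 2)
      (by positivity) (by
        rw [hφ, div_le_one (by positivity)]
        refine le_trans ?_ hM
        gcongr) N (2 * N)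
    exact this
  rw [div_mul_eq_mul_div, div_le_iff₀ (by positivity)] at h2
  have h3 : |τ| * ‖G‖ ≤ 8 * N ^ 2 * (1 / (|(k : ℝ) - l| + 1)) := by
    rw [mul_one_div, le_div_iff₀ (by positivity)]
    have : 0 ≤ |τ| * ‖G‖ := by positivity
    nlinarith
  linarith

lemma sum_norm_sum_boxCoeff_mul_conj_le {N M : ℕ} {τ : ℝ} (hN : 1 + |τ| ≤ N)
    (hM : |τ| * M ≤ N ^ 2) :
    (1 + |τ|) * ∑ k ∈ Finset.range M, ∑ l ∈ Finset.range M, ‖∑ i ∈ Finset.Ico N (2 * N),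
        boxCoeff N τ i k * (starRingEnd ℂ) (boxCoeff N τ i l)‖ ≤
      M ^ 2 * N + 16 * N ^ 2 * M * (1 + log M) := by
  rw [Finset.mul_sum]
  have h : ∀ k ∈ Finset.range M, (1 + |τ|) * ∑ l ∈ Finset.range M, ‖∑ i ∈ Finset.Ico N (2 * N),
        boxCoeff N τ i k * (starRingEnd ℂ) (boxCoeff N τ i l)‖ ≤
      M * N + 16 * N ^ 2 * (1 + log M) := by
    intro k hk
    rw [Finset.mem_range] at hk
    rw [Finset.mul_sum]
    refine (Finset.sum_le_sum fun l hl =>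
      norm_sum_boxCoeff_mul_conj_le hN hM hk (Finset.mem_range.mp hl)).trans ?_
    rw [Finset.sum_add_distrib, ← Finset.mul_sum, Finset.sum_const, Finset.card_range, nsmul_eq_mul]
    have := sum_one_div_abs_sub_add_one_le hk
    calc (M : ℝ) * N + 8 * N ^ 2 * _ ≤ M * N + 8 * N ^ 2 * (2 * (1 + log M)) := by gcongr
      _ = _ := by ring
  refine (Finset.sum_le_sum h).trans (le_of_eq ?_)
  rw [Finset.sum_const, Finset.card_range, nsmul_eq_mul]
  ring

/-- Parseval's identity on `ZMod q`, with frequencies dilated by a unit. -/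
lemma sum_normSq_sum_stdAddChar {q : ℕ} [NeZero q] {b : ZMod q} (hb : IsUnit b)
    (c : ZMod q → ℂ) :
    ∑ r : ZMod q, ‖∑ t : ZMod q, c t * ZMod.stdAddChar (b * r * t)‖ ^ 2 =
      q * ∑ t : ZMod q, ‖c t‖ ^ 2 := by
  have h : ∀ z : ℂ, ((‖z‖ ^ 2 : ℝ) : ℂ) = z * (starRingEnd ℂ) z := fun z => by
    rw [Complex.mul_conj, Complex.normSq_eq_norm_sq]
  apply Complex.ofReal_injective
  simp only [Complex.ofReal_sum, Complex.ofReal_mul, h, Complex.ofReal_natCast]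
  calc ∑ r : ZMod q, (∑ t, c t * ZMod.stdAddChar (b * r * t)) *
        (starRingEnd ℂ) (∑ t, c t * ZMod.stdAddChar (b * r * t))
      = ∑ r : ZMod q, ∑ t, ∑ t', c t * (starRingEnd ℂ) (c t') *
          ZMod.stdAddChar (r * (b * (t - t'))) := by
        refine Finset.sum_congr rfl fun r _ => ?_
        rw [map_sum, Finset.sum_mul_sum]
        refine Finset.sum_congr rfl fun t _ => Finset.sum_congr rfl fun t' _ => ?_
        have hψ : ZMod.stdAddChar (r * (b * (t - t'))) = ZMod.stdAddChar (b * r * t) *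
            (starRingEnd ℂ) (ZMod.stdAddChar (b * r * t')) := by
          rw [← AddChar.map_neg_eq_conj, ← AddChar.map_add_eq_mul]
          congr 1
          ring
        rw [hψ, map_mul (starRingEnd ℂ)]
        ring
    _ = ∑ t, ∑ t', c t * (starRingEnd ℂ) (c t') *
          ∑ r : ZMod q, ZMod.stdAddChar (r * (b * (t - t'))) := by
        rw [Finset.sum_comm]
        refine Finset.sum_congr rfl fun t _ => ?_
        rw [Finset.sum_comm]
        simp_rw [Finset.mul_sum]
    _ = ∑ t, c t * (starRingEnd ℂ) (c t) * q := by
        refine Finset.sum_congr rfl fun t _ => ?_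
        simp_rw [AddChar.sum_mulShift _ (ZMod.isPrimitive_stdAddChar q), ZMod.card]
        rw [Finset.sum_eq_single t]
        · simp
        · intro t' _ hne
          have : b * (t - t') ≠ 0 := by
            rw [Ne, hb.mul_right_eq_zero, sub_eq_zero]; exact hne.symm
          simp [this]
        · simp
    _ = _ := by rw [← Finset.sum_mul, mul_comm]

/-- Expansion of a mean square of linear forms. -/
lemma sum_norm_sq_linearForm_le {ι κ : Type*} (I : Finset ι) (J : Finset κ) (e : ι → κ → ℂ)
    (n : κ → ℝ) {B : ℝ} (hn : ∀ k ∈ J, 0 ≤ n k) (hB : ∀ k ∈ J, n k ≤ B) :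
    ∑ i ∈ I, ‖∑ k ∈ J, e i k * n k‖ ^ 2 ≤
      B ^ 2 * ∑ k ∈ J, ∑ l ∈ J, ‖∑ i ∈ I, e i k * (starRingEnd ℂ) (e i l)‖ := by
  have h : ∀ z : ℂ, ((‖z‖ ^ 2 : ℝ) : ℂ) = z * (starRingEnd ℂ) z := fun z => by
    rw [Complex.mul_conj, Complex.normSq_eq_norm_sq]
  have h1 : ((∑ i ∈ I, ‖∑ k ∈ J, e i k * n k‖ ^ 2 : ℝ) : ℂ) =
      ∑ k ∈ J, ∑ l ∈ J, (n k * n l : ℝ) * ∑ i ∈ I, e i k * (starRingEnd ℂ) (e i l) := by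
    simp only [Complex.ofReal_sum, h, map_sum, Finset.sum_mul_sum]
    simp only [Finset.mul_sum]
    rw [Finset.sum_comm]
    refine Finset.sum_congr rfl fun k _ => ?_
    rw [Finset.sum_comm]
    refine Finset.sum_congr rfl fun l _ => Finset.sum_congr rfl fun i _ => ?_
    rw [map_mul, Complex.conj_ofReal]
    push_cast; ring
  have h2 : ∑ i ∈ I, ‖∑ k ∈ J, e i k * n k‖ ^ 2 =
      ‖((∑ i ∈ I, ‖∑ k ∈ J, e i k * n k‖ ^ 2 : ℝ) : ℂ)‖ := by
    rw [Complex.norm_real, Real.norm_of_nonneg (Finset.sum_nonneg fun _ _ => sq_nonneg _)]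
  rw [h2, h1, Finset.mul_sum]
  refine (norm_sum_le _ _).trans (Finset.sum_le_sum fun k hk => ?_)
  rw [Finset.mul_sum]
  refine (norm_sum_le _ _).trans (Finset.sum_le_sum fun l hl => ?_)
  rw [norm_mul, Complex.norm_real, Real.norm_of_nonneg (mul_nonneg (hn k hk) (hn l hl)), sq]
  gcongr
  · exact hn l hl
  · exact (hn k hk).trans (hB k hk)
  · exact hB k hk
  · exact hB l hl

/-- Bilinear estimate for two families of finite sets of integers equidistributed at most in
residue classes. -/
lemma sq_sum_norm_bilinear_le {q : ℕ} [NeZero q] {b : ZMod q} (hb : IsUnit b) (I J : Finset ℕ)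
    (e : ℕ → ℕ → ℂ) (S T : ℕ → Finset ℕ) {A B : ℝ}
    (hA : ∀ i ∈ I, ∀ r : ZMod q, (((S i).filter fun p : ℕ => (p : ZMod q) = r).card : ℝ) ≤ A)
    (hB : ∀ k ∈ J, ∀ r : ZMod q, (((T k).filter fun p : ℕ => (p : ZMod q) = r).card : ℝ) ≤ B) :
    (∑ i ∈ I, ∑ p ∈ S i, ‖∑ k ∈ J, ∑ p' ∈ T k,
        e i k * ZMod.stdAddChar (b * (p : ZMod q) * (p' : ZMod q))‖) ^ 2 ≤
      A ^ 2 * B ^ 2 * I.card * q ^ 3 *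
        ∑ k ∈ J, ∑ l ∈ J, ‖∑ i ∈ I, e i k * (starRingEnd ℂ) (e i l)‖ := by
  set n : ℕ → ZMod q → ℝ := fun k t => (((T k).filter fun p : ℕ => (p : ZMod q) = t).card : ℝ)
    with hn
  set D : ℕ → ZMod q → ℂ := fun i r =>
    ∑ t : ZMod q, (∑ k ∈ J, e i k * (n k t : ℂ)) * ZMod.stdAddChar (b * r * t) with hD
  rcases I.eq_empty_or_nonempty with rfl | ⟨i₀, hi₀⟩
  · simp
  have hA0 : 0 ≤ A := (Nat.cast_nonneg _).trans (hA i₀ hi₀ 0)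
  have hinner : ∀ i, ∀ p : ℕ, ∑ k ∈ J, ∑ p' ∈ T k,
      e i k * ZMod.stdAddChar (b * (p : ZMod q) * (p' : ZMod q)) = D i p := by
    intro i p
    rw [hD]
    simp only [Finset.sum_mul]
    rw [Finset.sum_comm]
    refine Finset.sum_congr rfl fun k _ => ?_
    rw [← Finset.sum_fiberwise (T k) (fun p' : ℕ => (p' : ZMod q))]
    refine Finset.sum_congr rfl fun t _ => ?_
    rw [Finset.sum_congr rfl (g := fun _ => e i k * ZMod.stdAddChar (b * (p : ZMod q) * t))
      fun p' hp' => by rw [(Finset.mem_filter.mp hp').2]]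
    rw [Finset.sum_const, nsmul_eq_mul, hn]
    push_cast; ring
  have houter : ∑ i ∈ I, ∑ p ∈ S i, ‖∑ k ∈ J, ∑ p' ∈ T k,
        e i k * ZMod.stdAddChar (b * (p : ZMod q) * (p' : ZMod q))‖ ≤
      A * ∑ i ∈ I, ∑ r : ZMod q, ‖D i r‖ := by
    rw [Finset.mul_sum]
    refine Finset.sum_le_sum fun i hi => ?_
    simp_rw [hinner]
    rw [← Finset.sum_fiberwise (S i) (fun p : ℕ => (p : ZMod q)), Finset.mul_sum]
    refine Finset.sum_le_sum fun r _ => ?_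
    rw [Finset.sum_congr rfl (g := fun _ => ‖D i r‖)
      fun p hp => by rw [(Finset.mem_filter.mp hp).2]]
    rw [Finset.sum_const, nsmul_eq_mul]
    gcongr
    exact hA i hi r
  have hCS : (∑ i ∈ I, ∑ r : ZMod q, ‖D i r‖) ^ 2 ≤
      (I.card * q) * ∑ i ∈ I, ∑ r : ZMod q, ‖D i r‖ ^ 2 := by
    rw [← Finset.sum_product', ← Finset.sum_product' (f := fun i r => ‖D i r‖ ^ 2)]
    refine sq_sum_le_card_mul_sum_sq.trans (le_of_eq ?_)
    rw [Finset.card_product, Finset.card_univ, ZMod.card]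
    push_cast; rfl
  have hP : ∑ i ∈ I, ∑ r : ZMod q, ‖D i r‖ ^ 2 ≤
      q * (q * (B ^ 2 * ∑ k ∈ J, ∑ l ∈ J, ‖∑ i ∈ I, e i k * (starRingEnd ℂ) (e i l)‖)) := by
    simp_rw [hD, sum_normSq_sum_stdAddChar hb]
    rw [← Finset.mul_sum, Finset.sum_comm]
    gcongr
    refine (Finset.sum_le_card_nsmul _ _
      (B ^ 2 * ∑ k ∈ J, ∑ l ∈ J, ‖∑ i ∈ I, e i k * (starRingEnd ℂ) (e i l)‖) fun t _ => ?_).trans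
      (le_of_eq ?_)
    · exact sum_norm_sq_linearForm_le I J e (fun k => n k t) (fun _ _ => Nat.cast_nonneg _)
        fun k hk => hB k hk t
    · rw [Finset.card_univ, ZMod.card, nsmul_eq_mul]
  calc _ ≤ (A * ∑ i ∈ I, ∑ r : ZMod q, ‖D i r‖) ^ 2 := by gcongr
    _ = A ^ 2 * (∑ i ∈ I, ∑ r : ZMod q, ‖D i r‖) ^ 2 := mul_pow _ _ _
    _ ≤ A ^ 2 * ((I.card * q) * (q * (q * (B ^ 2 * ∑ k ∈ J, ∑ l ∈ J,
          ‖∑ i ∈ I, e i k * (starRingEnd ℂ) (e i l)‖)))) := by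
        gcongr
        exact hCS.trans (by gcongr)
    _ = _ := by ring

lemma norm_exp_neg_mul_sub_le {w : ℂ} (hw : 0 ≤ w.re) {u v : ℝ} (hu : 0 ≤ u) (hv : 0 ≤ v) :
    ‖Complex.exp (-(u * w)) - Complex.exp (-(v * w))‖ ≤ ‖w‖ * |u - v| := by
  have hd : ∀ t ∈ Set.Ici (0 : ℝ), HasDerivWithinAt (fun t : ℝ => Complex.exp (-(t * w)))
      (Complex.exp (-(t * w)) * (-(1 * w))) (Set.Ici 0) t := fun t _ =>
    (((Complex.ofRealCLM.hasDerivAt (x := t)).mul_const w).neg.cexp).hasDerivWithinAt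
  have := (convex_Ici (0 : ℝ)).norm_image_sub_le_of_norm_hasDerivWithin_le (C := ‖w‖) hd
    (fun t ht => ?_) (Set.mem_Ici.mpr hv) (Set.mem_Ici.mpr hu)
  · simpa using this
  · rw [norm_mul, norm_neg, one_mul, Complex.norm_exp, Complex.neg_re, Complex.re_ofReal_mul]
    have : exp (-(t * w.re)) ≤ 1 := by
      rw [Real.exp_le_one_iff, neg_nonpos]; exact mul_nonneg ht hw
    exact mul_le_of_le_one_left (norm_nonneg _) this

lemma norm_primeExpSumC_sub_sum_le {z : ℂ} {Y R : ℝ} (hY : 0 < Y) (hz : 1 / Y ≤ z.re) :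
    ‖primeExpSumC z -
        ∑ n ∈ (Finset.range ⌈R * Y⌉₊).filter Nat.Prime, Complex.exp (-(n * z))‖ ≤
      exp (-R / 2) * primeExpSum (1 / (2 * Y)) := by
  have hz0 : 0 < z.re := lt_of_lt_of_le (by positivity) hz
  rw [primeExpSumC, Finset.sum_filter, primeExpSum, ← tsum_mul_left,
    ← (summable_primeExpSumC hz0).sum_add_tsum_compl (s := Finset.range ⌈R * Y⌉₊),
    add_sub_cancel_left]
  have hsum := (summable_primeExpSum (show 0 < 1 / (2 * Y) by positivity)).mul_left (exp (-R / 2))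
  refine (tsum_of_norm_bounded (hsum.subtype _).hasSum fun n => ?_).trans
    (hsum.tsum_subtype_le _ _ fun n => by positivity)
  obtain ⟨n, hn⟩ := n
  have hn' : R * Y ≤ n := by
    simpa using hn
  simp only [Function.comp_apply]
  refine (norm_ite_prime_exp_le z hz n).trans ?_
  split_ifs
  · rw [← Real.exp_add, exp_le_exp]
    have : R ≤ n / Y := by rwa [le_div_iff₀ hY]
    have e : (n : ℝ) * (1 / (2 * Y)) = n / Y / 2 := by field_simp
    rw [e, mul_one_div]
    linarith
  · simp

/-- Approximation of the inner sum by one whose smooth weight is constant on boxes. -/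
lemma norm_primeExpSumC_le_box {q : ℕ} [NeZero q] (b : ℤ) {P Y τ : ℝ} (hP : 0 < P) (hY : 0 < Y)
    {N R i p : ℕ} (hi : i ∈ Finset.Ico N (2 * N)) (hp : p ∈ primeBox (P / N) i) :
    ‖primeExpSumC (p * ((1 - τ * Complex.I) / (P * Y : ℝ) - 2 * π * Complex.I * (b / q)))‖ ≤
      ‖∑ k ∈ Finset.Ico 3 (R * N), ∑ n ∈ primeBox (Y / N) k,
          boxCoeff N τ i k * ZMod.stdAddChar ((b : ZMod q) * (p : ZMod q) * (n : ZMod q))‖ +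
        Nat.primeCounting ⌊R * Y⌋₊ * ((1 + |τ|) * (R + 2) / N) +
        Nat.primeCounting ⌊3 * Y / N⌋₊ + exp (-R / 2) * primeExpSum (1 / (2 * Y)) := by
  obtain ⟨hNi, hi2⟩ := Finset.mem_Ico.mp hi
  have hN : 0 < N := by omega
  have hN' : (0 : ℝ) < N := by exact_mod_cast hN
  obtain ⟨hpp, hp1, hp2⟩ := mem_primeBox.mp hp
  have hp0 : (0 : ℝ) < p := by exact_mod_cast hpp.pos
  have hPp : P ≤ p := by
    refine le_trans ?_ hp1
    rw [mul_div_assoc', le_div_iff₀ hN', mul_comm]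
    have : (N : ℝ) ≤ i := by exact_mod_cast hNi
    gcongr
  set z : ℂ := p * ((1 - τ * Complex.I) / (P * Y : ℝ) - 2 * π * Complex.I * (b / q)) with hz
  have hzre : z.re = p / (P * Y) := by
    have e : z = ((p / (P * Y) : ℝ) : ℂ) * (1 - τ * Complex.I) -
        ((p * (2 * π) * (b / q) : ℝ) : ℂ) * Complex.I := by
      rw [hz]; push_cast; ring
    rw [e, Complex.sub_re, Complex.re_ofReal_mul, Complex.re_ofReal_mul]; simp
  have hz1 : 1 / Y ≤ z.re := by
    rw [hzre, div_le_div_iff₀ hY (by positivity)]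
    nlinarith
  have htail := norm_primeExpSumC_sub_sum_le (R := R) hY hz1
  set Q := (Finset.range ⌈R * Y⌉₊).filter Nat.Prime with hQ
  have hterm : ∀ n : ℕ, Complex.exp (-(n * z)) =
      ZMod.stdAddChar ((b : ZMod q) * (p : ZMod q) * (n : ZMod q)) *
        Complex.exp (-((p * n / (P * Y) : ℝ) * (1 - τ * Complex.I))) := by
    intro n
    have := exp_neg_mul_sub_eq_stdAddChar (q := q) (p * n) ((1 - τ * Complex.I) / (P * Y : ℝ)) b
    rw [hz, show -((n : ℂ) * (p * ((1 - τ * Complex.I) / (P * Y : ℝ) -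
      2 * π * Complex.I * (b / q)))) = -(((p * n : ℕ) : ℂ) * ((1 - τ * Complex.I) / (P * Y : ℝ) -
      2 * π * Complex.I * (b / q))) by push_cast; ring, this]
    congr 1
    · push_cast; congr 1; ring
    · push_cast; congr 1; ring
  have hψ : ∀ x : ZMod q, ‖ZMod.stdAddChar x‖ = 1 := fun x => AddChar.norm_apply _ _
  have hw : ‖1 - (τ : ℂ) * Complex.I‖ ≤ 1 + |τ| := by
    refine (norm_sub_le _ _).trans ?_
    simp
  set Q₁ := Q.filter fun n : ℕ => (n : ℝ) < 3 * Y / N with hQ₁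
  set Q₂ := Q.filter fun n : ℕ => ¬ (n : ℝ) < 3 * Y / N with hQ₂
  have hsplit : ∑ n ∈ Q, Complex.exp (-(n * z)) =
      ∑ n ∈ Q₁, Complex.exp (-(n * z)) + ∑ n ∈ Q₂, Complex.exp (-(n * z)) :=
    (Finset.sum_filter_add_sum_filter_not _ _ _).symm
  have hcard : ∀ (U : Finset ℕ) (x : ℝ), (∀ n ∈ U, n.Prime ∧ (n : ℝ) ≤ x) →
      (U.card : ℝ) ≤ Nat.primeCounting ⌊x⌋₊ := by
    intro U x hU
    rw [← Nat.primesLE_card_eq_primeCounting]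
    norm_cast
    refine Finset.card_le_card fun n hn => ?_
    rw [Nat.primesLE_eq_filter_Icc_zero, Finset.mem_filter, Finset.mem_Icc]
    exact ⟨⟨Nat.zero_le _, Nat.le_floor (hU n hn).2⟩, (hU n hn).1⟩
  have hmemQ : ∀ n, n ∈ Q ↔ (n : ℝ) < R * Y ∧ n.Prime := fun n => by
    rw [hQ, Finset.mem_filter, Finset.mem_range, Nat.lt_ceil]
  have h1 : ‖∑ n ∈ Q₁, Complex.exp (-(n * z))‖ ≤ Nat.primeCounting ⌊3 * Y / N⌋₊ := by
    refine (norm_sum_le _ _).trans ((Finset.sum_le_card_nsmul _ _ 1 fun n _ => ?_).trans ?_)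
    · have := norm_exp_neg_mul_le (w := z) (r := 0) (Y := 1) (by rw [hzre]; positivity) one_pos n
      simpa using this
    · rw [nsmul_eq_mul, mul_one]
      refine hcard _ _ fun n hn => ?_
      obtain ⟨hn1, hn2⟩ := Finset.mem_filter.mp hn
      exact ⟨((hmemQ n).mp hn1).2, hn2.le⟩
  set g : ℕ → ℕ := fun n => ⌊(n : ℝ) / (Y / N)⌋₊ with hg
  have hYN : 0 < Y / N := by positivity
  have hgk : ∀ n k : ℕ, g n = k ↔ (k * (Y / N) ≤ n ∧ (n : ℝ) < (k + 1) * (Y / N)) := by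
    intro n k
    rw [hg]
    simp only
    rw [Nat.floor_eq_iff (by positivity), le_div_iff₀ hYN, div_lt_iff₀ hYN]
  have hmaps : ∀ n ∈ Q₂, g n ∈ Finset.Ico 3 (R * N) := by
    intro n hn
    obtain ⟨hn1, hn2⟩ := Finset.mem_filter.mp hn
    have hn3 := ((hmemQ n).mp hn1).1
    rw [Finset.mem_Ico]
    constructor
    · refine Nat.le_floor ?_
      rw [le_div_iff₀ hYN]
      push_cast
      rw [← mul_div_assoc]; linarith
    · rw [Nat.floor_lt (by positivity), div_lt_iff₀ hYN]
      push_cast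
      rw [show (R : ℝ) * N * (Y / N) = R * Y by field_simp]
      exact hn3
  have hfib : ∀ k ∈ Finset.Ico 3 (R * N), Q₂.filter (fun n => g n = k) = primeBox (Y / N) k := by
    intro k hk
    obtain ⟨hk3, hkR⟩ := Finset.mem_Ico.mp hk
    ext n
    rw [Finset.mem_filter, hQ₂, Finset.mem_filter, hmemQ, hgk, mem_primeBox]
    constructor
    · rintro ⟨⟨⟨-, h1⟩, -⟩, h2⟩; exact ⟨h1, h2⟩
    · rintro ⟨h1, h2, h3⟩
      refine ⟨⟨⟨h3.trans_le ?_, h1⟩, not_lt.mpr (le_trans ?_ h2)⟩, h2, h3⟩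
      · have : (k + 1 : ℝ) ≤ R * N := by exact_mod_cast hkR
        calc (k + 1 : ℝ) * (Y / N) ≤ R * N * (Y / N) := by gcongr
          _ = R * Y := by field_simp
      · rw [mul_div_assoc]
        have : (3 : ℝ) ≤ k := by exact_mod_cast hk3
        gcongr
  have hmid : ∑ k ∈ Finset.Ico 3 (R * N), ∑ n ∈ primeBox (Y / N) k,
      boxCoeff N τ i k * ZMod.stdAddChar ((b : ZMod q) * (p : ZMod q) * (n : ZMod q)) =
      ∑ n ∈ Q₂, boxCoeff N τ i (g n) *
        ZMod.stdAddChar ((b : ZMod q) * (p : ZMod q) * (n : ZMod q)) := by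
    rw [← Finset.sum_fiberwise_of_maps_to hmaps]
    refine Finset.sum_congr rfl fun k hk => ?_
    rw [hfib k hk]
    refine Finset.sum_congr rfl fun n hn => ?_
    rw [(hgk n k).mpr (mem_primeBox.mp hn).2]
  have h2 : ‖∑ n ∈ Q₂, Complex.exp (-(n * z)) - ∑ n ∈ Q₂, boxCoeff N τ i (g n) *
        ZMod.stdAddChar ((b : ZMod q) * (p : ZMod q) * (n : ZMod q))‖ ≤
      Nat.primeCounting ⌊R * Y⌋₊ * ((1 + |τ|) * (R + 2) / N) := by
    rw [← Finset.sum_sub_distrib]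
    refine (norm_sum_le _ _).trans ((Finset.sum_le_card_nsmul _ _
      ((1 + |τ|) * (R + 2) / N) fun n hn => ?_).trans ?_)
    · have hk := hmaps n hn
      obtain ⟨hk3, hkR⟩ := Finset.mem_Ico.mp hk
      obtain ⟨hn1, hn2⟩ := (hgk n (g n)).mp rfl
      rw [hterm, mul_comm, ← sub_mul, norm_mul, hψ, mul_one, boxCoeff]
      refine (norm_exp_neg_mul_sub_le (by simp) (by positivity) (by positivity)).trans ?_
      rw [mul_div_assoc (1 + |τ|)]
      have hkR' : (g n + 1 : ℝ) ≤ R * N := by exact_mod_cast hkR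
      have hi2' : (i + 1 : ℝ) ≤ 2 * N := by exact_mod_cast hi2
      have hlow : (i * g n / N ^ 2 : ℝ) ≤ p * n / (P * Y) := by
        rw [div_le_div_iff₀ (by positivity) (by positivity)]
        calc (i * g n : ℝ) * (P * Y) = (i * (P / N)) * (g n * (Y / N)) * N ^ 2 := by
              field_simp
          _ ≤ p * n * N ^ 2 := by gcongr
      have hup : (p * n / (P * Y) : ℝ) ≤ (i + 1) * (g n + 1) / N ^ 2 := by
        rw [div_le_div_iff₀ (by positivity) (by positivity)]
        calc (p * n * N ^ 2 : ℝ) ≤ ((i + 1) * (P / N)) * ((g n + 1) * (Y / N)) * N ^ 2 := by gcongr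
          _ = _ := by field_simp
      have hgap : ((i + 1) * (g n + 1) / N ^ 2 : ℝ) - i * g n / N ^ 2 ≤ (R + 2) / N := by
        rw [← sub_div, div_le_div_iff₀ (by positivity) hN', sq, ← mul_assoc]
        gcongr
        nlinarith
      rw [abs_of_nonneg (by linarith)]
      gcongr
      linarith
    · rw [nsmul_eq_mul]
      refine mul_le_mul_of_nonneg_right (hcard _ _ fun n hn => ?_) (by positivity)
      have := (hmemQ n).mp (Finset.mem_filter.mp hn).1
      exact ⟨this.2, this.1.le⟩
  rw [hmid]
  have key : primeExpSumC z = ∑ n ∈ Q₂, boxCoeff N τ i (g n) *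
        ZMod.stdAddChar ((b : ZMod q) * (p : ZMod q) * (n : ZMod q)) +
      (∑ n ∈ Q₂, Complex.exp (-(n * z)) - ∑ n ∈ Q₂, boxCoeff N τ i (g n) *
        ZMod.stdAddChar ((b : ZMod q) * (p : ZMod q) * (n : ZMod q))) +
      ∑ n ∈ Q₁, Complex.exp (-(n * z)) +
      (primeExpSumC z - ∑ n ∈ Q, Complex.exp (-(n * z))) := by
    rw [hsplit]; ring
  rw [key]
  refine norm_add₃_le.trans ?_ |>.trans (add_le_add (add_le_add (add_le_add le_rfl h2) h1) htail)
  refine (add_le_add (add_le_add (norm_add_le _ _) le_rfl) le_rfl)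

/-- The primes of the interval `[P, 2 * P)`. -/
def dyadicPrimes (P : ℝ) : Finset ℕ := (Finset.range ⌈2 * P⌉₊).filter fun p => p.Prime ∧ P ≤ p

lemma mem_dyadicPrimes {P : ℝ} {p : ℕ} :
    p ∈ dyadicPrimes P ↔ p.Prime ∧ P ≤ p ∧ (p : ℝ) < 2 * P := by
  rw [dyadicPrimes, Finset.mem_filter, Finset.mem_range, Nat.lt_ceil]
  tauto

lemma card_dyadicPrimes_le {P : ℝ} (hP : 1 < P) : ((dyadicPrimes P).card : ℝ) ≤ 10 * P / log P := by
  have hl : 0 < log P := log_pos hP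
  have hl2 : log P ≤ log (2 * P) := log_le_log (by linarith) (by linarith)
  have h : ((dyadicPrimes P).card : ℝ) ≤ Nat.primeCounting ⌊2 * P⌋₊ := by
    rw [← Nat.primesLE_card_eq_primeCounting]
    norm_cast
    refine Finset.card_le_card fun n hn => ?_
    rw [mem_dyadicPrimes] at hn
    rw [Nat.primesLE_eq_filter_Icc_zero, Finset.mem_filter, Finset.mem_Icc]
    exact ⟨⟨Nat.zero_le _, Nat.le_floor hn.2.2.le⟩, hn.1⟩
  refine (h.trans (primeCounting_floor_le (by linarith))).trans ?_
  rw [show 5 * (2 * P) = 10 * P by ring]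
  gcongr

lemma sum_dyadicPrimes_eq {P : ℝ} (hP : 0 < P) {N : ℕ} (hN : 0 < N) (f : ℕ → ℝ) :
    ∑ p ∈ dyadicPrimes P, f p = ∑ i ∈ Finset.Ico N (2 * N), ∑ p ∈ primeBox (P / N) i, f p := by
  have hN' : (0 : ℝ) < N := by exact_mod_cast hN
  have hPN : 0 < P / N := by positivity
  have hgk : ∀ n k : ℕ, ⌊(n : ℝ) / (P / N)⌋₊ = k ↔
      (k * (P / N) ≤ n ∧ (n : ℝ) < (k + 1) * (P / N)) := by
    intro n k
    rw [Nat.floor_eq_iff (by positivity), le_div_iff₀ hPN, div_lt_iff₀ hPN]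
  have hmaps : ∀ n ∈ dyadicPrimes P, ⌊(n : ℝ) / (P / N)⌋₊ ∈ Finset.Ico N (2 * N) := by
    intro n hn
    obtain ⟨-, h1, h2⟩ := mem_dyadicPrimes.mp hn
    rw [Finset.mem_Ico]
    constructor
    · refine Nat.le_floor ?_
      rw [le_div_iff₀ hPN, mul_div_cancel₀ _ hN'.ne']
      exact h1
    · rw [Nat.floor_lt (by positivity), div_lt_iff₀ hPN]
      push_cast
      rw [mul_assoc, mul_div_cancel₀ _ hN'.ne']
      exact h2
  rw [← Finset.sum_fiberwise_of_maps_to hmaps]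
  refine Finset.sum_congr rfl fun k hk => Finset.sum_congr ?_ fun _ _ => rfl
  obtain ⟨hk1, hk2⟩ := Finset.mem_Ico.mp hk
  have hk1' : (N : ℝ) ≤ k := by exact_mod_cast hk1
  have hk2' : (k + 1 : ℝ) ≤ 2 * N := by exact_mod_cast hk2
  have e : P = N * (P / N) := by field_simp
  ext n
  rw [Finset.mem_filter, mem_dyadicPrimes, hgk, mem_primeBox]
  constructor
  · rintro ⟨⟨h1, -⟩, h2⟩; exact ⟨h1, h2⟩
  · rintro ⟨h1, h2, h3⟩
    refine ⟨⟨h1, ?_, ?_⟩, h2, h3⟩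
    · calc P = N * (P / N) := e
        _ ≤ k * (P / N) := by gcongr
        _ ≤ n := h2
    · calc (n : ℝ) < (k + 1) * (P / N) := h3
        _ ≤ 2 * N * (P / N) := by gcongr
        _ = 2 * P := by rw [mul_assoc, ← e]

/-- The main term of the bilinear estimate on a dyadic block. -/
lemma sum_norm_box_bilinear_le {q : ℕ} [NeZero q] {b : ZMod q} (hb : IsUnit b) {P Y τ : ℝ}
    {N R : ℕ} (hτN : 1 + |τ| ≤ N) (hR : 1 ≤ R) (hτR : |τ| * R ≤ N) (hN3 : 3 ≤ N)
    (hP : 1 < P) (hY : 1 < Y) (hqP : q * N ≤ P) (hqY : q * N ≤ Y) (hNY : (N : ℝ) ^ 2 ≤ Y) :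
    ∑ i ∈ Finset.Ico N (2 * N), ∑ p ∈ primeBox (P / N) i,
      ‖∑ k ∈ Finset.Ico 3 (R * N), ∑ n ∈ primeBox (Y / N) k,
          boxCoeff N τ i k * ZMod.stdAddChar (b * (p : ZMod q) * (n : ZMod q))‖ ≤
      P * Y / (log P * log Y) * (8 * (1 + 2 * log q + log (8 * R * N)) ^ 2 *
        √((R ^ 2 + 16 * R * (1 + log (R * N))) / (q * (1 + |τ|)))) := by
  have hN' : (3 : ℝ) ≤ N := by exact_mod_cast hN3
  have hN0 : (0 : ℝ) < N := by linarith
  have hR' : (1 : ℝ) ≤ R := by exact_mod_cast hR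
  have hq1 : (1 : ℝ) ≤ q := by exact_mod_cast Nat.pos_of_ne_zero (NeZero.ne q)
  have hlP : 0 < log P := log_pos hP
  have hlY : 0 < log Y := log_pos hY
  have hκ : 0 < 1 + |τ| := by positivity
  set lam := 1 + 2 * log q + log (8 * R * N) with hlam
  have hlq : 0 ≤ log q := log_nonneg hq1
  have hRN : 1 ≤ (R : ℝ) * N := by nlinarith
  have hlam0 : 0 ≤ lam := by
    have : 0 ≤ log (8 * R * N) := log_nonneg (by nlinarith)
    positivity
  have hlam_le : ∀ k : ℕ, 1 ≤ k → (k : ℝ) ≤ 2 * R * N →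
      1 + 2 * log q + log (4 * k) ≤ lam := by
    intro k hk1 hk
    have : (1 : ℝ) ≤ k := by exact_mod_cast hk1
    have : log (4 * k) ≤ log (8 * R * N) := log_le_log (by positivity) (by linarith)
    rw [hlam]
    linarith
  have hA : ∀ i ∈ Finset.Ico N (2 * N), ∀ r : ZMod q,
      (((primeBox (P / N) i).filter fun p : ℕ => (p : ZMod q) = r).card : ℝ) ≤
        2 * (P / N) / q * lam / log P := by
    intro i hi r
    obtain ⟨hi1, hi2⟩ := Finset.mem_Ico.mp hi
    have hi1' : (N : ℝ) ≤ i := by exact_mod_cast hi1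
    have hi2' : (i : ℝ) ≤ 2 * N := by exact_mod_cast hi2.le
    refine (card_primeBox_residueClass_le (by rwa [le_div_iff₀ hN0]) (by omega) r).trans ?_
    have h1 : P ≤ i * (P / N) := by
      calc P = N * (P / N) := by field_simp
        _ ≤ i * (P / N) := by gcongr
    gcongr
    exact hlam_le i (by omega) (by nlinarith)
  have hB : ∀ k ∈ Finset.Ico 3 (R * N), ∀ r : ZMod q,
      (((primeBox (Y / N) k).filter fun p : ℕ => (p : ZMod q) = r).card : ℝ) ≤
        2 * (Y / N) / q * lam / (log Y / 2) := by
    intro k hk r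
    obtain ⟨hk1, hk2⟩ := Finset.mem_Ico.mp hk
    have hk1' : (3 : ℝ) ≤ k := by exact_mod_cast hk1
    have hk2' : (k : ℝ) ≤ R * N := by exact_mod_cast hk2.le
    refine (card_primeBox_residueClass_le (by rwa [le_div_iff₀ hN0]) hk1 r).trans ?_
    have hNs : (N : ℝ) ≤ √Y := Real.le_sqrt_of_sq_le hNY
    have h1 : √Y ≤ k * (Y / N) := by
      calc √Y = Y / √Y := (Real.div_sqrt).symm
        _ ≤ Y / N := by gcongr
        _ ≤ k * (Y / N) := le_mul_of_one_le_left (by positivity) (by linarith)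
    have h2 : log Y / 2 ≤ log (k * (Y / N)) := by
      rw [← Real.log_sqrt (by linarith)]
      exact log_le_log (by positivity) h1
    gcongr
    exact hlam_le k (by omega) (by nlinarith)
  have hsq := sq_sum_norm_bilinear_le hb (Finset.Ico N (2 * N)) (Finset.Ico 3 (R * N))
    (boxCoeff N τ) (primeBox (P / N)) (primeBox (Y / N)) hA hB
  have hbox := sum_norm_sum_boxCoeff_mul_conj_le (N := N) (M := R * N) (τ := τ) hτN (by
    push_cast
    nlinarith)
  have hsub : ∑ k ∈ Finset.Ico 3 (R * N), ∑ l ∈ Finset.Ico 3 (R * N),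
      ‖∑ i ∈ Finset.Ico N (2 * N), boxCoeff N τ i k * (starRingEnd ℂ) (boxCoeff N τ i l)‖ ≤
      ((R * N) ^ 2 * N + 16 * N ^ 2 * (R * N) * (1 + log (R * N))) / (1 + |τ|) := by
    rw [le_div_iff₀' hκ]
    push_cast at hbox
    refine le_trans ?_ hbox
    have hs : Finset.Ico 3 (R * N) ⊆ Finset.range (R * N) := fun x hx =>
      Finset.mem_range.mpr (Finset.mem_Ico.mp hx).2
    refine mul_le_mul_of_nonneg_left ?_ hκ.le
    refine (Finset.sum_le_sum fun k _ => Finset.sum_le_sum_of_subset_of_nonneg hs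
      fun _ _ _ => norm_nonneg _).trans (Finset.sum_le_sum_of_subset_of_nonneg hs
      fun _ _ _ => Finset.sum_nonneg fun _ _ => norm_nonneg _)
  have hlRN : 0 ≤ log (R * N) := log_nonneg hRN
  refine abs_le_of_sq_le_sq' (hsq.trans ?_) (by positivity) |>.2
  rw [mul_pow, mul_pow, Real.sq_sqrt (by positivity), Nat.card_Ico,
    show 2 * N - N = N by omega]
  refine (mul_le_mul_of_nonneg_left hsub (by positivity)).trans (le_of_eq ?_)
  field_simp
  ring

/-- Bilinear estimate on a dyadic block. -/
lemma sum_dyadicPrimes_norm_le {q : ℕ} [NeZero q] {b : ℤ} (hb : IsUnit (b : ZMod q)) {P Y τ : ℝ}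
    {N R : ℕ} (hτN : 1 + |τ| ≤ N) (hR : 1 ≤ R) (hτR : |τ| * R ≤ N) (hN3 : 3 ≤ N)
    (hP : 1 < P) (hY : 1 < Y) (hqP : q * N ≤ P) (hqY : q * N ≤ Y) (hNY : (N : ℝ) ^ 2 ≤ Y) :
    ∑ p ∈ dyadicPrimes P,
      ‖primeExpSumC (p * ((1 - τ * Complex.I) / (P * Y : ℝ) - 2 * π * Complex.I * (b / q)))‖ ≤
      P * Y / (log P * log Y) * (8 * (1 + 2 * log q + log (8 * R * N)) ^ 2 *
        √((R ^ 2 + 16 * R * (1 + log (R * N))) / (q * (1 + |τ|))) +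
        (50 * R * (R + 2) * ((1 + |τ|) / N) + 300 / N + 300 * exp (-R / 2))) := by
  have hN' : (3 : ℝ) ≤ N := by exact_mod_cast hN3
  have hN0 : (0 : ℝ) < N := by linarith
  have hR' : (1 : ℝ) ≤ R := by exact_mod_cast hR
  have hlP : 0 < log P := log_pos hP
  have hlY : 0 < log Y := log_pos hY
  have hP0 : 0 < P := by linarith
  have hY0 : 0 < Y := by linarith
  have hκ : 0 < 1 + |τ| := by positivity
  set E : ℝ := Y / log Y * (5 * R * (R + 2) * ((1 + |τ|) / N) + 30 / N + 30 * exp (-R / 2)) with hE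
  have hpt : ∀ i ∈ Finset.Ico N (2 * N), ∀ p ∈ primeBox (P / N) i,
      ‖primeExpSumC (p * ((1 - τ * Complex.I) / (P * Y : ℝ) - 2 * π * Complex.I * (b / q)))‖ ≤
      ‖∑ k ∈ Finset.Ico 3 (R * N), ∑ n ∈ primeBox (Y / N) k,
          boxCoeff N τ i k * ZMod.stdAddChar ((b : ZMod q) * (p : ZMod q) * (n : ZMod q))‖ + E := by
    intro i hi p hp
    have h := norm_primeExpSumC_le_box (q := q) (R := R) (τ := τ) b hP0 hY0 hi hp
    have h1 : (Nat.primeCounting ⌊R * Y⌋₊ : ℝ) ≤ 5 * (R * Y) / log Y := by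
      refine (primeCounting_floor_le (by nlinarith)).trans ?_
      have : log Y ≤ log (R * Y) := log_le_log hY0 (by nlinarith)
      gcongr
    have h2 : (Nat.primeCounting ⌊3 * Y / N⌋₊ : ℝ) ≤ 30 * Y / N / log Y := by
      have hNs : (N : ℝ) ≤ √Y := Real.le_sqrt_of_sq_le hNY
      have hs : √Y ≤ 3 * Y / N := by
        calc √Y = Y / √Y := (Real.div_sqrt).symm
          _ ≤ Y / N := by gcongr
          _ ≤ 3 * Y / N := by gcongr; linarith
      have hl : log Y / 2 ≤ log (3 * Y / N) := by
        rw [← Real.log_sqrt (by linarith)]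
        exact log_le_log (by positivity) hs
      refine (primeCounting_floor_le (by linarith)).trans ?_
      calc 5 * (3 * Y / N) / log (3 * Y / N) ≤ 5 * (3 * Y / N) / (log Y / 2) := by gcongr
        _ = 30 * Y / N / log Y := by field_simp; ring
    have h3 := primeExpSum_two_mul_le hY
    calc _ ≤ _ := h
      _ ≤ ‖∑ k ∈ Finset.Ico 3 (R * N), ∑ n ∈ primeBox (Y / N) k,
          boxCoeff N τ i k * ZMod.stdAddChar ((b : ZMod q) * (p : ZMod q) * (n : ZMod q))‖ +
          5 * (R * Y) / log Y * ((1 + |τ|) * (R + 2) / N) + 30 * Y / N / log Y +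
          exp (-R / 2) * (30 * (Y / log Y)) := by gcongr
      _ = _ := by rw [hE]; ring
  have hcard := card_dyadicPrimes_le hP
  have hcards : ∑ i ∈ Finset.Ico N (2 * N), ∑ p ∈ primeBox (P / N) i, E =
      (dyadicPrimes P).card * E := by
    rw [← sum_dyadicPrimes_eq hP0 (by omega) fun _ => E, Finset.sum_const, nsmul_eq_mul]
  rw [sum_dyadicPrimes_eq hP0 (N := N) (by omega) fun p : ℕ => ‖primeExpSumC (p *
    ((1 - τ * Complex.I) / (P * Y : ℝ) - 2 * π * Complex.I * (b / q)))‖]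
  refine (Finset.sum_le_sum fun i hi => Finset.sum_le_sum (hpt i hi)).trans ?_
  simp_rw [Finset.sum_add_distrib]
  rw [hcards, mul_add]
  refine add_le_add (sum_norm_box_bilinear_le hb hτN hR hτR hN3 hP hY hqP hqY hNY) ?_
  have hE0 : 0 ≤ E := by positivity
  refine (mul_le_mul_of_nonneg_right hcard hE0).trans (le_of_eq ?_)
  rw [hE]
  field_simp
  ring

open Asymptotics in
lemma tendsto_log_sq_mul_sqrt_log_div (a b c d : ℝ) :
    Tendsto (fun x : ℝ => (a + b * log x) ^ 2 * √((c + d * log x) / x)) atTop (𝓝 0) := by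
  have hl : (fun x : ℝ => log x) =o[atTop] fun x : ℝ => x ^ (1 / 5 : ℝ) :=
    isLittleO_log_rpow_atTop (by norm_num)
  have hlin : ∀ a b : ℝ, (fun x : ℝ => a + b * log x) =o[atTop] fun x : ℝ => x ^ (1 / 5 : ℝ) := by
    intro a b
    refine IsLittleO.add ?_ (hl.const_mul_left b)
    exact isLittleO_const_left.mpr (Or.inr (tendsto_norm_atTop_atTop.comp
      (tendsto_rpow_atTop (by norm_num))))
  have hprod : (fun x : ℝ => (a + b * log x) ^ 4 * (c + d * log x)) =o[atTop] fun x : ℝ => x := by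
    refine (((hlin a b).pow (n := 4) (by norm_num)).mul (hlin c d)).congr' EventuallyEq.rfl ?_
    filter_upwards [eventually_gt_atTop 0] with x hx
    rw [← pow_succ, ← Real.rpow_natCast, ← Real.rpow_mul hx.le]
    norm_num
  have h := (hprod.tendsto_div_nhds_zero).sqrt
  rw [Real.sqrt_zero] at h
  refine h.congr fun x => ?_
  rw [mul_div_assoc, Real.sqrt_mul (by positivity), show (a + b * log x) ^ 4 =
    ((a + b * log x) ^ 2) ^ 2 by ring, Real.sqrt_sq (by positivity)]

lemma exists_box_parameters {ε : ℝ} (hε : 0 < ε) :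
    ∃ R K : ℕ, 1 ≤ R ∧ 3 ≤ K ∧ R ≤ K ∧
      50 * R * (R + 2) / (K : ℝ) + 300 / (K : ℝ) + 300 * exp (-R / 2) ≤ 3 * ε := by
  obtain ⟨R, hR1, hRε⟩ : ∃ R : ℕ, 1 ≤ R ∧ 300 * exp (-R / 2) ≤ ε := by
    have h : Tendsto (fun R : ℕ => 300 * exp (-R / 2)) atTop (𝓝 (300 * 0)) := by
      refine (Real.tendsto_exp_atBot.comp ?_).const_mul 300
      simp_rw [neg_div]
      exact tendsto_neg_atTop_atBot.comp (tendsto_natCast_atTop_atTop.atTop_div_const (by norm_num))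
    rw [mul_zero] at h
    obtain ⟨R, h1, h2⟩ := ((eventually_ge_atTop 1).and
      (h.eventually (eventually_le_nhds hε))).exists
    exact ⟨R, h1, h2⟩
  have hlim : ∀ c : ℝ, ∀ᶠ K : ℕ in atTop, c / (K : ℝ) ≤ ε := fun c =>
    (tendsto_const_div_atTop_nhds_zero_nat c).eventually (eventually_le_nhds hε)
  obtain ⟨K, h1, h2, h3, h4⟩ := ((hlim (50 * R * (R + 2))).and ((hlim 300).and
    ((eventually_ge_atTop 3).and (eventually_ge_atTop R)))).exists
  exact ⟨R, K, hR1, h3, h4, by linarith⟩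

lemma log_sq_mul_sqrt_box_le {R K q κ N : ℝ} (hR : 1 ≤ R) (hK : 1 ≤ K) (hq : 1 ≤ q) (hκ : 1 ≤ κ)
    (hN : 1 ≤ N) (hNκ : N ≤ 2 * K * κ) :
    8 * (1 + 2 * log q + log (8 * R * N)) ^ 2 *
        √((R ^ 2 + 16 * R * (1 + log (R * N))) / (q * κ)) ≤
      8 * ((1 + log (16 * R * K) + 3 * log (q * κ)) ^ 2 *
        √((R ^ 2 + 16 * R * (1 + log (2 * R * K)) + 16 * R * log (q * κ)) / (q * κ))) := by
  set x := q * κ with hx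
  have hqx : q ≤ x := le_mul_of_one_le_right (by linarith) hκ
  have hκx : κ ≤ x := le_mul_of_one_le_left (by linarith) hq
  have hx0 : 0 < x := by linarith
  have hNx : N ≤ 2 * K * x := hNκ.trans (by gcongr)
  have hRN : 1 ≤ R * N := one_le_mul_of_one_le_of_one_le hR hN
  have hl1 : log q ≤ log x := log_le_log (by linarith) hqx
  have hl2 : log (8 * R * N) ≤ log (16 * R * K) + log x := by
    rw [← Real.log_mul (by positivity) (by positivity)]
    refine log_le_log (by positivity) ?_
    calc 8 * R * N ≤ 8 * R * (2 * K * x) := by gcongr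
      _ = _ := by ring
  have hl3 : log (R * N) ≤ log (2 * R * K) + log x := by
    rw [← Real.log_mul (by positivity) (by positivity)]
    refine log_le_log (by positivity) ?_
    calc R * N ≤ R * (2 * K * x) := by gcongr
      _ = _ := by ring
  have h0 : 0 ≤ 1 + 2 * log q + log (8 * R * N) := by
    have := log_nonneg hq
    have := log_nonneg (show (1 : ℝ) ≤ 8 * R * N by linarith)
    positivity
  have h1 : 1 + 2 * log q + log (8 * R * N) ≤ 1 + log (16 * R * K) + 3 * log x := by linarith
  have h2 : R ^ 2 + 16 * R * (1 + log (R * N)) ≤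
      R ^ 2 + 16 * R * (1 + log (2 * R * K)) + 16 * R * log x := by
    have := mul_le_mul_of_nonneg_left hl3 (show 0 ≤ 16 * R by linarith)
    linarith
  rw [mul_assoc]
  gcongr

/-- The bilinear estimate on dyadic blocks, made arbitrarily small when `q (1 + |τ|)` is large. -/
lemma exists_sum_dyadicPrimes_norm_le {ε : ℝ} (hε : 0 < ε) :
    ∃ K T : ℝ, 1 ≤ K ∧ ∀ (q : ℕ) [NeZero q] (b : ℤ) (τ P Y : ℝ), IsUnit (b : ZMod q) →
      T ≤ q * (1 + |τ|) → 1 < P → 1 < Y → q * (K * (1 + |τ|)) ≤ P → q * (K * (1 + |τ|)) ≤ Y →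
      (K * (1 + |τ|)) ^ 2 ≤ Y →
      ∑ p ∈ dyadicPrimes P,
        ‖primeExpSumC (p * ((1 - τ * Complex.I) / (P * Y : ℝ) - 2 * π * Complex.I * (b / q)))‖ ≤
        ε * (P * Y / (log P * log Y)) := by
  obtain ⟨R, K, hR1, hK3, hKR, hRK⟩ := exists_box_parameters (show 0 < ε / 4 by positivity)
  have hR0 : (1 : ℝ) ≤ R := by exact_mod_cast hR1
  replace hK3 : (3 : ℝ) ≤ K := by exact_mod_cast hK3
  replace hKR : (R : ℝ) ≤ K := by exact_mod_cast hKR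
  have hlim := (tendsto_log_sq_mul_sqrt_log_div (1 + log (16 * R * K)) 3
    (R ^ 2 + 16 * R * (1 + log (2 * R * K))) (16 * R)).const_mul 8
  rw [mul_zero] at hlim
  obtain ⟨T, hT⟩ := eventually_atTop.mp
    (hlim.eventually (eventually_le_nhds (show (0 : ℝ) < ε / 4 by positivity)))
  refine ⟨2 * K, T, by linarith, ?_⟩
  intro q _ b τ P Y hb hTq hP hY hqP hqY hYK
  set κ := 1 + |τ| with hκ
  have hκ1 : 1 ≤ κ := by rw [hκ]; linarith [abs_nonneg τ]
  have hq1 : (1 : ℝ) ≤ q := by exact_mod_cast Nat.pos_of_ne_zero (NeZero.ne q)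
  set N := K * ⌈κ⌉₊ with hN
  have hceil : κ ≤ ⌈κ⌉₊ := Nat.le_ceil κ
  have hceil2 : (⌈κ⌉₊ : ℝ) ≤ 2 * κ := by linarith [(Nat.ceil_lt_add_one (by linarith : 0 ≤ κ)).le]
  have hNκ : K * κ ≤ (N : ℝ) := by rw [hN]; push_cast; gcongr
  have hNκ2 : (N : ℝ) ≤ 2 * K * κ := by
    rw [hN]; push_cast
    calc (K : ℝ) * ⌈κ⌉₊ ≤ K * (2 * κ) := by gcongr
      _ = _ := by ring
  have hKκ : (K : ℝ) ≤ K * κ := le_mul_of_one_le_right (by linarith) hκ1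
  have hτκ : |τ| ≤ κ := by rw [hκ]; linarith
  have hκN : κ ≤ N := by nlinarith
  have hN3 : 3 ≤ N := by
    have : (3 : ℝ) ≤ N := by linarith
    exact_mod_cast this
  have hτR : |τ| * R ≤ N := by
    calc |τ| * R ≤ κ * K := by gcongr
      _ ≤ N := by rwa [mul_comm]
  have hqN : (q : ℝ) * N ≤ q * (2 * K * κ) := by gcongr
  have hNsq : (N : ℝ) ^ 2 ≤ (2 * K * κ) ^ 2 := by gcongr
  refine (sum_dyadicPrimes_norm_le hb hκN hR1 hτR hN3 hP hY (hqN.trans hqP) (hqN.trans hqY)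
    (hNsq.trans hYK)).trans ?_
  have hlP : 0 < log P := log_pos hP
  have hlY : 0 < log Y := log_pos hY
  rw [mul_comm ε]
  refine mul_le_mul_of_nonneg_left ?_ (by positivity)
  have hmain := (log_sq_mul_sqrt_box_le hR0 (by linarith) hq1 hκ1 (by linarith : 1 ≤ (N : ℝ))
    hNκ2).trans (hT (q * κ) hTq)
  have hKN : (1 : ℝ) / N ≤ 1 / K :=
    one_div_le_one_div_of_le (by linarith) (hKκ.trans hNκ)
  have hκNK : κ / N ≤ 1 / K := by
    rw [div_le_div_iff₀ (by linarith) (by linarith)]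
    linarith
  have herr : 50 * R * (R + 2) * (κ / N) + 300 / N ≤ 50 * R * (R + 2) / (K : ℝ) + 300 / K := by
    rw [div_eq_mul_one_div _ (K : ℝ), div_eq_mul_one_div 300 (K : ℝ),
      div_eq_mul_one_div 300 (N : ℝ)]
    gcongr
  linarith

lemma eventually_mul_rpow_log_le_exp_sq_log_log (C A : ℝ) :
    ∀ᶠ X : ℝ in atTop, C * log X ^ A ≤ exp (log (log X) ^ 2) := by
  filter_upwards [tendsto_log_log.eventually_ge_atTop (1 + |A| + |log C|),
    Real.tendsto_log_atTop.eventually_gt_atTop 0] with X hX hl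
  rcases le_or_gt C 0 with hC | hC
  · exact (mul_nonpos_of_nonpos_of_nonneg hC (by positivity)).trans (exp_pos _).le
  rw [← Real.log_le_iff_le_exp (by positivity), Real.log_mul hC.ne' (by positivity),
    Real.log_rpow hl]
  have h1 := le_abs_self A
  have h2 := le_abs_self (log C)
  have h3 := abs_nonneg A
  have h4 := abs_nonneg (log C)
  set L := log (log X)
  nlinarith

/-- The primes of `midPrimes X` fall into dyadic blocks with few indices. -/
lemma sum_midPrimes_le_of_dyadic {X C : ℝ} (hX0 : 0 < X) (hX : 1 < log X) (hC : 0 ≤ C) (f : ℕ → ℝ)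
    (hf : ∀ p, 0 ≤ f p)
    (h : ∀ m : ℕ, 1 ≤ m → (2 : ℝ) ^ m ≤ √X → exp (log (log X) ^ 2) ≤ 2 * 2 ^ m →
      ∑ p ∈ dyadicPrimes (2 ^ m), f p ≤ C / m) :
    ∑ p ∈ midPrimes X, f p ≤ C * (1 + log (log X)) := by
  have hblock : ∀ p ∈ midPrimes X, 1 ≤ Nat.log 2 p ∧ (2 : ℝ) ^ Nat.log 2 p ≤ p ∧
      (p : ℝ) < 2 * 2 ^ Nat.log 2 p := by
    intro p hp
    obtain ⟨-, hpp, -⟩ := mem_midPrimes.mp hp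
    refine ⟨Nat.log_pos (by norm_num) hpp.two_le, ?_, ?_⟩
    · exact_mod_cast Nat.pow_log_le_self 2 hpp.ne_zero
    · rw [mul_comm, ← pow_succ]
      exact_mod_cast Nat.lt_pow_succ_log_self (by norm_num) p
  have hmaps : ∀ p ∈ midPrimes X, Nat.log 2 p ∈ (midPrimes X).image (Nat.log 2) := fun p hp =>
    Finset.mem_image_of_mem _ hp
  rw [← Finset.sum_fiberwise_of_maps_to hmaps]
  have hle : ∀ m ∈ (midPrimes X).image (Nat.log 2),
      ∑ p ∈ midPrimes X with Nat.log 2 p = m, f p ≤ C / m := by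
    intro m hm
    obtain ⟨p, hp, rfl⟩ := Finset.mem_image.mp hm
    obtain ⟨h1, h2, h3⟩ := hblock p hp
    obtain ⟨hp1, hpp, hp2⟩ := mem_midPrimes.mp hp
    refine le_trans ?_ (h _ h1 (h2.trans hp1) (hp2.le.trans h3.le))
    refine Finset.sum_le_sum_of_subset_of_nonneg (fun n hn => ?_) fun _ _ _ => hf _
    obtain ⟨hn1, hn2⟩ := Finset.mem_filter.mp hn
    obtain ⟨-, h2', h3'⟩ := hblock n hn1
    rw [hn2] at h2' h3'
    exact mem_dyadicPrimes.mpr ⟨(mem_midPrimes.mp hn1).2.1, h2', h3'⟩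
  refine (Finset.sum_le_sum hle).trans ?_
  have hsub : (midPrimes X).image (Nat.log 2) ⊆ (Finset.Ico 0 ⌊log X⌋₊).image Nat.succ := by
    intro m hm
    obtain ⟨p, hp, rfl⟩ := Finset.mem_image.mp hm
    obtain ⟨h1, h2, h3⟩ := hblock p hp
    obtain ⟨hp1, hpp, hp2⟩ := mem_midPrimes.mp hp
    have hlog : (Nat.log 2 p : ℝ) ≤ log X := by
      have := Real.log_le_log (by positivity) (h2.trans hp1)
      rw [Real.log_pow, Real.log_sqrt hX0.le] at this
      have h4 := Real.log_two_gt_d9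
      have h5 : (0 : ℝ) ≤ Nat.log 2 p := Nat.cast_nonneg _
      nlinarith
    have := Nat.le_floor hlog
    exact Finset.mem_image.mpr ⟨Nat.log 2 p - 1, Finset.mem_Ico.mpr ⟨Nat.zero_le _, by omega⟩,
      Nat.sub_add_cancel h1⟩
  calc ∑ m ∈ (midPrimes X).image (Nat.log 2), C / m
      ≤ ∑ m ∈ (Finset.Ico 0 ⌊log X⌋₊).image Nat.succ, C / m :=
        Finset.sum_le_sum_of_subset_of_nonneg hsub fun _ _ _ => by positivity
    _ = C * ∑ k ∈ Finset.Ico 0 ⌊log X⌋₊, (1 : ℝ) / (k + 1) := by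
        rw [Finset.sum_image fun _ _ _ _ h => Nat.succ_injective h, Finset.mul_sum]
        refine Finset.sum_congr rfl fun k _ => ?_
        rw [Nat.cast_succ, mul_one_div]
    _ ≤ C * (1 + log (log X)) := by
        gcongr
        refine (sum_Ico_one_div_succ_le _).trans ?_
        have h1 : 1 ≤ ⌊log X⌋₊ := Nat.le_floor (by exact_mod_cast hX.le)
        have h2 := Nat.floor_le (show 0 ≤ log X by linarith)
        gcongr

/-- Cancellation in the sums over primes twisted by an additive character of large conductor or a
large frequency. -/
lemma sum_midPrimes_norm_le {ε : ℝ} (hε : 0 < ε) (A : ℝ) :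
    ∃ T : ℝ, ∀ᶠ X : ℝ in atTop, ∀ (q : ℕ) [NeZero q] (b : ℤ) (τ : ℝ), IsUnit (b : ZMod q) →
      (q : ℝ) ≤ log X ^ A → |τ| ≤ log X ^ A → T ≤ q * (1 + |τ|) →
      ∑ p ∈ midPrimes X,
        ‖primeExpSumC (p * ((1 - τ * Complex.I) / X - 2 * π * Complex.I * (b / q)))‖ ≤
        ε * semiprimeScale X := by
  obtain ⟨K, T, hK, hT⟩ := exists_sum_dyadicPrimes_norm_le (show 0 < ε / 8 by positivity)
  refine ⟨T, ?_⟩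
  filter_upwards [eventually_mul_rpow_log_le_exp_sq_log_log (8 * K ^ 2) (A + A),
    eventually_exp_sq_log_log_le, Real.tendsto_log_atTop.eventually_gt_atTop 1,
    tendsto_log_log.eventually_ge_atTop 3, eventually_gt_atTop 1] with X hX1 hX2 hl1 hll hX
  intro q _ b τ hb hq hτ hTq
  have hX0 : 0 < X := by linarith
  have hq1 : (1 : ℝ) ≤ q := by exact_mod_cast Nat.pos_of_ne_zero (NeZero.ne q)
  have hlA : 1 ≤ log X ^ A := hq1.trans hq
  set κ := 1 + |τ| with hκ
  have hκ1 : 1 ≤ κ := by rw [hκ]; linarith [abs_nonneg τ]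
  have hκ2 : κ ≤ 2 * log X ^ A := by rw [hκ]; linarith
  rw [Real.rpow_add (by linarith)] at hX1
  set V := log X ^ A
  have hqκ : q * (K * κ) * 2 ≤ exp (log (log X) ^ 2) := by
    calc q * (K * κ) * 2 ≤ V * (K * (2 * V)) * 2 := by gcongr
      _ = 4 * K * (V * V) := by ring
      _ ≤ 8 * K ^ 2 * (V * V) := by gcongr <;> nlinarith
      _ ≤ _ := hX1
  have hκsq : (K * κ) ^ 2 ≤ √X := by
    calc (K * κ) ^ 2 ≤ (K * (2 * V)) ^ 2 := by gcongr
      _ = 4 * K ^ 2 * (V * V) := by ring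
      _ ≤ 8 * K ^ 2 * (V * V) := by gcongr; norm_num
      _ ≤ _ := hX1.trans hX2
  have hexp : 4 < exp (log (log X) ^ 2) := by
    have := Real.add_one_le_exp (log (log X) ^ 2)
    nlinarith
  refine (sum_midPrimes_le_of_dyadic (C := ε / 2 * (X / log X)) hX0 hl1 (by positivity) _
    (fun p => norm_nonneg _) fun m hm hm1 hm2 => ?_).trans ?_
  · have hm0 : (1 : ℝ) ≤ m := by exact_mod_cast hm
    have h2m : (0 : ℝ) < 2 ^ m := by positivity
    have hsX : √X ≤ X / 2 ^ m := by
      calc √X = X / √X := Real.div_sqrt.symm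
        _ ≤ X / 2 ^ m := by gcongr
    have h := hT q b τ (2 ^ m) (X / 2 ^ m) hb hTq (by linarith) (by linarith) (by linarith)
      (by linarith) (by linarith)
    rw [mul_div_cancel₀ _ h2m.ne'] at h
    refine h.trans ?_
    have hlY : log X / 2 ≤ log (X / 2 ^ m) := by
      rw [← Real.log_sqrt hX0.le]
      exact log_le_log (by positivity) hsX
    have hl2 : (m : ℝ) / 2 ≤ log (2 ^ m) := by
      rw [Real.log_pow]
      have := Real.log_two_gt_d9
      nlinarith
    have hl3 : 0 < log ((2 : ℝ) ^ m) := by linarith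
    calc ε / 8 * (X / (log (2 ^ m) * log (X / 2 ^ m)))
        ≤ ε / 8 * (X / (m / 2 * (log X / 2))) := by gcongr
      _ = ε / 2 * (X / log X) / m := by field_simp; ring
  · rw [semiprimeScale]
    calc ε / 2 * (X / log X) * (1 + log (log X))
        ≤ ε / 2 * (X / log X) * (2 * log (log X)) := by gcongr; linarith
      _ = _ := by ring

lemma norm_moebius_div_totient_le_one {q : ℕ} [NeZero q] :
    ‖(ArithmeticFunction.moebius q : ℂ) / q.totient‖ ≤ 1 := by
  have h1 : (1 : ℝ) ≤ q.totient := by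
    exact_mod_cast Nat.totient_pos.mpr (Nat.pos_of_ne_zero (NeZero.ne q))
  rw [norm_div, Complex.norm_intCast, Complex.norm_natCast, div_le_one (by linarith)]
  refine le_trans ?_ h1
  exact_mod_cast ArithmeticFunction.abs_moebius_le_one

/-- The main term `2 ∑ (X / p) / log (X / p)` of the damped sum over products of two primes. -/
def midPrimesMain (X : ℝ) : ℝ := 2 * ∑ p ∈ midPrimes X, X / p / log (X / p)

lemma semiprimeExpSumC_sub_midPrimesMain_le (q : ℕ) [NeZero q] {W ε : ℝ} (hW : 0 < W)
    (hε : 0 < ε) :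
    ∀ᶠ X : ℝ in atTop, ∀ w : ℂ, 1 ≤ w.re → ‖w‖ ≤ W → ∀ b : ℤ, IsUnit (b : ZMod q) →
      ‖semiprimeExpSumC (w / X - 2 * π * Complex.I * (b / q)) -
        (ArithmeticFunction.moebius q : ℂ) / q.totient * (midPrimesMain X / w)‖ ≤
        ε * semiprimeScale X := by
  obtain ⟨C, hC, hmid⟩ := sum_midPrimes_inv_le
  filter_upwards [hmid, semiprimeExpSumC_asymp (half_pos hε),
    eventually_forall_midPrimes (primeExpSumC_asymp q hW (show 0 < ε / (8 * C) by positivity)),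
    eventually_gt_atTop 1, tendsto_log_log.eventually_ge_atTop (1 + q)] with X hmid h1 h2 hX hLq
  intro w hw1 hw2 b hb
  have hX0 : 0 < X := by linarith
  have hl : 0 < log X := log_pos hX
  set c := (ArithmeticFunction.moebius q : ℂ) / q.totient
  set s : ℂ := w / X - 2 * π * Complex.I * (b / q) with hs
  have hsre : 1 / X ≤ s.re := by
    have e : s = w / X - ((2 * π * (b / q) : ℝ) : ℂ) * Complex.I := by
      rw [hs]; push_cast; ring
    rw [e, Complex.sub_re, Complex.re_ofReal_mul, Complex.div_ofReal_re, Complex.I_re, mul_zero,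
      sub_zero]
    gcongr
  have hterm : ∀ p ∈ midPrimes X,
      ‖primeExpSumC (p * s) - c * ((X / p / log (X / p) : ℝ) / w)‖ ≤
        ε / (4 * C) * (X / log X) * (1 / p) := by
    intro p hp
    obtain ⟨hp1, hpp, hp2⟩ := mem_midPrimes.mp hp
    have hp0 : (0 : ℝ) < p := by exact_mod_cast hpp.pos
    have hqp : q < p := by
      have : (q : ℝ) < p := by
        refine lt_of_le_of_lt ?_ hp2
        have := Real.add_one_le_exp (log (log X) ^ 2)
        have : (0 : ℝ) ≤ q := Nat.cast_nonneg q
        nlinarith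
      exact_mod_cast this
    have hunit : IsUnit ((b * (p : ℤ) : ℤ) : ZMod q) := by
      push_cast
      refine hb.mul ((ZMod.isUnit_iff_coprime p q).mpr ?_)
      exact (Nat.Prime.coprime_iff_not_dvd hpp).mpr
        (Nat.not_dvd_of_pos_of_lt (Nat.pos_of_ne_zero (NeZero.ne q)) hqp)
    have h := h2 p hp w hw1 hw2 (b * p) hunit
    have hpc : (p : ℂ) ≠ 0 := by exact_mod_cast hpp.ne_zero
    have hXc : (X : ℂ) ≠ 0 := by exact_mod_cast hX0.ne'
    rw [show (p : ℂ) * s = w / ((X / p : ℝ) : ℂ) -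
        2 * π * Complex.I * (((b * (p : ℤ) : ℤ) : ℂ) / q) by
      rw [hs]; push_cast; field_simp,
      show (((X / p / log (X / p) : ℝ) : ℂ) / w) =
        ((X / p : ℝ) : ℂ) / ((log (X / p) : ℝ) * w) by push_cast; rw [div_div]]
    refine h.trans ?_
    have hlp := log_div_ge_half hX hp0 hp1
    calc ε / (8 * C) * (X / p / log (X / p)) ≤ ε / (8 * C) * (X / p / (log X / 2)) := by gcongr
      _ = _ := by field_simp; ring
  have hsum : ‖2 * ∑ p ∈ midPrimes X, primeExpSumC (p * s) - c * (midPrimesMain X / w)‖ ≤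
      ε / 2 * semiprimeScale X := by
    have e : 2 * ∑ p ∈ midPrimes X, primeExpSumC (p * s) - c * (midPrimesMain X / w) =
        2 * ∑ p ∈ midPrimes X, (primeExpSumC (p * s) - c * ((X / p / log (X / p) : ℝ) / w)) := by
      rw [Finset.sum_sub_distrib, midPrimesMain, mul_sub, ← Finset.mul_sum, ← Finset.sum_div]
      push_cast; ring
    rw [e, norm_mul, Complex.norm_two]
    calc 2 * ‖∑ p ∈ midPrimes X, (primeExpSumC (p * s) - c * ((X / p / log (X / p) : ℝ) / w))‖
        ≤ 2 * ∑ p ∈ midPrimes X, ε / (4 * C) * (X / log X) * (1 / p) := by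
          gcongr
          exact (norm_sum_le _ _).trans (Finset.sum_le_sum hterm)
      _ = ε / (2 * C) * (X / log X) * ∑ p ∈ midPrimes X, (1 : ℝ) / p := by
          rw [← Finset.mul_sum]; ring
      _ ≤ ε / (2 * C) * (X / log X) * (C * log (log X)) := by gcongr
      _ = ε / 2 * semiprimeScale X := by rw [semiprimeScale]; field_simp
  calc _ = ‖(semiprimeExpSumC s - 2 * ∑ p ∈ midPrimes X, primeExpSumC (p * s)) +
        (2 * ∑ p ∈ midPrimes X, primeExpSumC (p * s) - c * (midPrimesMain X / w))‖ := by
        congr 1; ring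
    _ ≤ ε / 2 * semiprimeScale X + ε / 2 * semiprimeScale X :=
        (norm_add_le _ _).trans (add_le_add (h1 s hsre) hsum)
    _ = _ := by ring

/-- Near a rational with fixed denominator, the damped sum over products of two primes is
proportional to its value at the real point. -/
lemma semiprimeExpSumC_sub_le (q : ℕ) [NeZero q] {W ε : ℝ} (hW : 0 < W) (hε : 0 < ε) :
    ∀ᶠ X : ℝ in atTop, ∀ w : ℂ, 1 ≤ w.re → ‖w‖ ≤ W → ∀ b : ℤ, IsUnit (b : ZMod q) →
      ‖semiprimeExpSumC (w / X - 2 * π * Complex.I * (b / q)) -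
        (ArithmeticFunction.moebius q : ℂ) / q.totient * (semiprimeExpSum (1 / X) / w)‖ ≤
        ε * semiprimeScale X := by
  filter_upwards [semiprimeExpSumC_sub_midPrimesMain_le q hW (half_pos hε),
    semiprimeExpSumC_sub_midPrimesMain_le 1 one_pos (half_pos hε), eventually_gt_atTop 0]
    with X h1 h2 hX0 w hw1 hw2 b hb
  have h2' := h2 1 (by simp) (by simp) 0 (isUnit_of_subsingleton _)
  have e : semiprimeExpSumC (1 / X - 2 * π * Complex.I * ((0 : ℤ) / (1 : ℕ))) =
      semiprimeExpSum (1 / X) := by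
    rw [← semiprimeExpSumC_ofReal (by positivity)]
    congr 1
    simp
  rw [e] at h2'
  simp only [ArithmeticFunction.moebius_apply_one, Nat.totient_one, Nat.cast_one, Int.cast_one,
    div_one, one_mul] at h2'
  have hw0 : 1 ≤ ‖w‖ := hw1.trans (Complex.re_le_norm w)
  set c := (ArithmeticFunction.moebius q : ℂ) / q.totient with hc
  have hc1 : ‖c‖ ≤ 1 := norm_moebius_div_totient_le_one
  have h3 : ‖c * (midPrimesMain X / w) - c * (semiprimeExpSum (1 / X) / w)‖ ≤
      ‖(midPrimesMain X : ℂ) - semiprimeExpSum (1 / X)‖ := by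
    rw [show c * (midPrimesMain X / w) - c * (semiprimeExpSum (1 / X) / w) =
      c * ((midPrimesMain X - semiprimeExpSum (1 / X)) / w) by ring, norm_mul,
      norm_div (_ - _)]
    calc ‖c‖ * (‖(midPrimesMain X : ℂ) - semiprimeExpSum (1 / X)‖ / ‖w‖)
        ≤ 1 * (‖(midPrimesMain X : ℂ) - semiprimeExpSum (1 / X)‖ / 1) := by gcongr
      _ = _ := by ring
  calc _ = ‖(semiprimeExpSumC (w / X - 2 * π * Complex.I * (b / q)) - c * (midPrimesMain X / w)) +
        (c * (midPrimesMain X / w) - c * (semiprimeExpSum (1 / X) / w))‖ := by congr 1; ring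
    _ ≤ ε / 2 * semiprimeScale X + ε / 2 * semiprimeScale X :=
        (norm_add_le _ _).trans (add_le_add (h1 w hw1 hw2 b hb) (h3.trans (by rwa [norm_sub_rev])))
    _ = _ := by ring

lemma re_div_sub_two_pi_mul_I {w : ℂ} {X y : ℝ} :
    (w / X - 2 * π * Complex.I * y).re = w.re / X := by
  rw [show w / X - 2 * π * Complex.I * y = w / X - ((2 * π * y : ℝ) : ℂ) * Complex.I by
    push_cast; ring, Complex.sub_re, Complex.re_ofReal_mul, Complex.div_ofReal_re, Complex.I_re,
    mul_zero, sub_zero]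

lemma norm_semiprimeExpSumC_le_of_large {ε : ℝ} (hε : 0 < ε) (A : ℝ) :
    ∃ T : ℝ, ∀ᶠ X : ℝ in atTop, ∀ (q : ℕ) [NeZero q] (b : ℤ) (τ : ℝ), IsUnit (b : ZMod q) →
      (q : ℝ) ≤ log X ^ A → |τ| ≤ log X ^ A → T ≤ q * (1 + |τ|) →
      ‖semiprimeExpSumC ((1 - τ * Complex.I) / X - 2 * π * Complex.I * (b / q))‖ ≤
        ε * semiprimeScale X := by
  obtain ⟨T, hT⟩ := sum_midPrimes_norm_le (show 0 < ε / 4 by positivity) A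
  refine ⟨T, ?_⟩
  filter_upwards [hT, semiprimeExpSumC_asymp (half_pos hε), eventually_gt_atTop 0]
    with X h1 h2 hX0 q _ b τ hb hq hτ hTq
  set s : ℂ := (1 - τ * Complex.I) / X - 2 * π * Complex.I * (b / q) with hs
  have hsre : 1 / X ≤ s.re := by
    have := re_div_sub_two_pi_mul_I (w := 1 - τ * Complex.I) (X := X) (y := b / q)
    push_cast at this
    rw [hs, this]
    simp
  have h3 := h2 s hsre
  have h4 : ‖2 * ∑ p ∈ midPrimes X, primeExpSumC (p * s)‖ ≤ 2 * (ε / 4 * semiprimeScale X) := by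
    rw [norm_mul, Complex.norm_two]
    gcongr
    exact (norm_sum_le _ _).trans (h1 q b τ hb hq hτ hTq)
  have h5 := norm_add_le (semiprimeExpSumC s - 2 * ∑ p ∈ midPrimes X, primeExpSumC (p * s))
    (2 * ∑ p ∈ midPrimes X, primeExpSumC (p * s))
  rw [sub_add_cancel] at h5
  linarith

lemma norm_one_sub_mul_I_le (τ : ℝ) : ‖1 - (τ : ℂ) * Complex.I‖ ≤ 1 + |τ| :=
  (norm_sub_le _ _).trans (by simp)

lemma one_add_abs_le_two_mul_norm (τ : ℝ) : 1 + |τ| ≤ 2 * ‖1 - (τ : ℂ) * Complex.I‖ := by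
  have h1 := Complex.abs_re_le_norm (1 - (τ : ℂ) * Complex.I)
  have h2 := Complex.abs_im_le_norm (1 - (τ : ℂ) * Complex.I)
  simp at h1 h2
  linarith

/-- Behaviour of the damped sum over products of two primes near a rational with fixed
denominator, uniformly in the frequency. -/
lemma semiprimeExpSumC_sub_le_uniform (q : ℕ) [NeZero q] {ε : ℝ} (hε : 0 < ε) {A : ℝ} (hA : 0 < A) :
    ∀ᶠ X : ℝ in atTop, ∀ (b : ℤ) (τ : ℝ), IsUnit (b : ZMod q) → |τ| ≤ log X ^ A →
      ‖semiprimeExpSumC ((1 - τ * Complex.I) / X - 2 * π * Complex.I * (b / q)) -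
        (ArithmeticFunction.moebius q : ℂ) / q.totient *
          (semiprimeExpSum (1 / X) / (1 - τ * Complex.I))‖ ≤ ε * semiprimeScale X := by
  obtain ⟨T, hT⟩ := norm_semiprimeExpSumC_le_of_large (half_pos hε) A
  obtain ⟨C, hC, hCX⟩ := semiprimeExpSum_le_scale
  have hlog : Tendsto (fun X : ℝ => log X ^ A) atTop atTop :=
    (tendsto_rpow_atTop hA).comp Real.tendsto_log_atTop
  filter_upwards [hT, hCX, hlog.eventually_ge_atTop q, semiprimeScale_pos_eventually,
    semiprimeExpSumC_sub_le q (show 0 < 1 + |T| + 4 * C / ε by positivity) hε]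
    with X h1 h2 hq hsc h3 b τ hb hτ
  set w : ℂ := 1 - τ * Complex.I with hw
  have hq1 : (1 : ℝ) ≤ q := by exact_mod_cast Nat.pos_of_ne_zero (NeZero.ne q)
  rcases le_or_gt (1 + |τ|) (1 + |T| + 4 * C / ε) with hκ | hκ
  · exact h3 w (by simp [hw]) ((norm_one_sub_mul_I_le τ).trans hκ) b hb
  · have hκ0 : 0 < 1 + |τ| := by positivity
    have hwκ := one_add_abs_le_two_mul_norm τ
    rw [← hw] at hwκ
    have h4 := h1 q b τ hb hq hτ (by
      have := le_abs_self T
      have : 0 ≤ 4 * C / ε := by positivity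
      nlinarith)
    have h5 : ‖(ArithmeticFunction.moebius q : ℂ) / q.totient * (semiprimeExpSum (1 / X) / w)‖ ≤
        ε / 2 * semiprimeScale X := by
      have hwC : 2 * C / ε ≤ ‖w‖ := by
        have : 2 * (2 * C / ε) = 4 * C / ε := by ring
        linarith [abs_nonneg T]
      have hw0 : 0 < ‖w‖ := by linarith
      rw [norm_mul, norm_div _ w, Complex.norm_real, Real.norm_of_nonneg (semiprimeExpSum_nonneg _)]
      calc _ ≤ 1 * (C * semiprimeScale X / (2 * C / ε)) := by
            gcongr
            · exact div_nonneg (semiprimeExpSum_nonneg _) (norm_nonneg _)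
            · exact norm_moebius_div_totient_le_one (q := q)
        _ = _ := by field_simp
    calc _ ≤ _ := norm_sub_le _ _
      _ ≤ ε / 2 * semiprimeScale X + ε / 2 * semiprimeScale X := add_le_add h4 h5
      _ = _ := by ring

/-- For denominators at least `3`, the damped sum over products of two primes is at most about
half its value at the real point. -/
lemma norm_semiprimeExpSumC_le_half {ε : ℝ} (hε : 0 < ε) (A : ℝ) :
    ∀ᶠ X : ℝ in atTop, ∀ (q : ℕ) [NeZero q] (b : ℤ) (τ : ℝ), 3 ≤ q → IsUnit (b : ZMod q) →
      (q : ℝ) ≤ log X ^ A → |τ| ≤ log X ^ A →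
      ‖semiprimeExpSumC ((1 - τ * Complex.I) / X - 2 * π * Complex.I * (b / q))‖ ≤
        1 / 2 * semiprimeExpSum (1 / X) + ε * semiprimeScale X := by
  obtain ⟨T, hT⟩ := norm_semiprimeExpSumC_le_of_large hε A
  have hfix : ∀ᶠ X : ℝ in atTop, ∀ q ∈ Finset.range ⌈T⌉₊, ∀ _ : NeZero q, ∀ w : ℂ,
      1 ≤ w.re → ‖w‖ ≤ 1 + |T| → ∀ b : ℤ, IsUnit (b : ZMod q) →
      ‖semiprimeExpSumC (w / X - 2 * π * Complex.I * (b / q)) -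
        (ArithmeticFunction.moebius q : ℂ) / q.totient * (semiprimeExpSum (1 / X) / w)‖ ≤
        ε * semiprimeScale X := by
    rw [Filter.eventually_all_finset]
    intro q _
    by_cases hq : q = 0
    · exact .of_forall fun X hne => absurd hq hne.ne
    · have : NeZero q := ⟨hq⟩
      filter_upwards [semiprimeExpSumC_sub_le q (show 0 < 1 + |T| by positivity) hε] with X h _
      exact h
  filter_upwards [hT, hfix, semiprimeScale_pos_eventually] with X h1 h2 hsc q _ b τ hq3 hb hq hτ
  have hF := semiprimeExpSum_nonneg (1 / X)
  rcases le_or_gt T (q * (1 + |τ|)) with h | h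
  · have := h1 q b τ hb hq hτ h
    linarith
  · set w : ℂ := 1 - τ * Complex.I with hw
    have hq1 : (1 : ℝ) ≤ q := by exact_mod_cast Nat.pos_of_ne_zero (NeZero.ne q)
    have hwre : w.re = 1 := by simp [hw]
    have hwT : ‖w‖ ≤ 1 + |T| := by
      have hwτ := norm_one_sub_mul_I_le τ
      rw [← hw] at hwτ
      nlinarith [abs_nonneg τ, le_abs_self T]
    have hqT : q ∈ Finset.range ⌈T⌉₊ := by
      rw [Finset.mem_range, Nat.lt_ceil]
      nlinarith [abs_nonneg τ]
    have h3 := h2 q hqT inferInstance w hwre.ge hwT b hb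
    have hw1 : 1 ≤ ‖w‖ := hwre.ge.trans (Complex.re_le_norm w)
    have h4 : ‖(ArithmeticFunction.moebius q : ℂ) / q.totient * (semiprimeExpSum (1 / X) / w)‖ ≤
        1 / 2 * semiprimeExpSum (1 / X) := by
      rw [norm_mul, norm_div _ w, Complex.norm_real, Real.norm_of_nonneg hF]
      calc _ ≤ 1 / 2 * (semiprimeExpSum (1 / X) / 1) := by
            gcongr
            exact norm_moebius_div_totient_le hq3
        _ = _ := by ring
    have h5 := norm_add_le
      ((ArithmeticFunction.moebius q : ℂ) / q.totient * (semiprimeExpSum (1 / X) / w))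
      (semiprimeExpSumC (w / X - 2 * π * Complex.I * (b / q)) -
        (ArithmeticFunction.moebius q : ℂ) / q.totient * (semiprimeExpSum (1 / X) / w))
    rw [add_sub_cancel] at h5
    linarith

lemma tsum_primes_eq_tsum_ite {E : Type*} [AddCommGroup E] [TopologicalSpace E] [T2Space E]
    (f : ℕ → E) : ∑' p : Nat.Primes, f p = ∑' n : ℕ, if n.Prime then f n else 0 := by
  refine (tsum_subtype {n : ℕ | n.Prime} f).trans (tsum_congr fun n => ?_)
  simp [Set.indicator_apply]

lemma PhiP2C_exp_neg (s : ℂ) :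
    PhiP2C (Complex.exp (-s)) = ∑' j : ℕ+, 1 / (j : ℂ) * semiprimeExpSumC (j * s) := by
  refine tsum_congr fun j => ?_
  simp_rw [tsum_mul_left]
  congr 1
  have h (p : ℕ) : ∑' q : Nat.Primes, Complex.exp (-s) ^ (p * (q : ℕ) * (j : ℕ)) =
      primeExpSumC (p * (j * s)) := by
    rw [tsum_primes_eq_tsum_ite (fun q => Complex.exp (-s) ^ (p * q * (j : ℕ))), primeExpSumC]
    refine tsum_congr fun q => ?_
    rw [← Complex.exp_nat_mul]
    congr 2
    push_cast
    ring
  simp_rw [h]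
  exact tsum_primes_eq_tsum_ite (fun p => primeExpSumC (p * (j * s)))

lemma PhiP2_exp_neg (y : ℝ) :
    PhiP2 (exp (-y)) = ∑' j : ℕ+, 1 / (j : ℝ) * semiprimeExpSum (j * y) := by
  refine tsum_congr fun j => ?_
  simp_rw [tsum_mul_left]
  congr 1
  have h (p : ℕ) : ∑' q : Nat.Primes, exp (-y) ^ (p * (q : ℕ) * (j : ℕ)) =
      primeExpSum (p * (j * y)) := by
    rw [tsum_primes_eq_tsum_ite (fun q => exp (-y) ^ (p * q * (j : ℕ))), primeExpSum]
    refine tsum_congr fun q => ?_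
    rw [← Real.exp_nat_mul]
    congr 2
    push_cast
    ring
  simp_rw [h]
  exact tsum_primes_eq_tsum_ite (fun p => primeExpSum (p * (j * y)))

lemma summable_semiprimeExpSum_div {y : ℝ} (hy : 0 < y) :
    Summable fun j : ℕ+ => 1 / (j : ℝ) * semiprimeExpSum (j * y) := by
  obtain ⟨C, hC, h⟩ := exists_semiprimeExpSum_le_div
  have hs : Summable fun j : ℕ+ => C / y * (1 / (j : ℝ) ^ 2) :=
    ((Real.summable_one_div_nat_pow.mpr one_lt_two).comp_injective
      PNat.coe_injective).mul_left (C / y)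
  refine hs.of_nonneg_of_le (fun j => mul_nonneg (by positivity) (semiprimeExpSum_nonneg _))
    fun j => ?_
  have hj : (0 : ℝ) < j := by exact_mod_cast j.pos
  calc _ ≤ 1 / (j : ℝ) * (C / (j * y)) := by
        gcongr
        exact h _ (by positivity)
    _ = _ := by field_simp

lemma norm_div_semiprimeExpSumC_le {y : ℝ} (hy : 0 < y) {s : ℂ} (hs : y ≤ s.re) (j : ℕ+) :
    ‖1 / (j : ℂ) * semiprimeExpSumC (j * s)‖ ≤ 1 / (j : ℝ) * semiprimeExpSum (j * y) := by
  have hj : (0 : ℝ) < j := by exact_mod_cast j.pos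
  rw [norm_mul, norm_div, norm_one, Complex.norm_natCast]
  gcongr
  refine norm_semiprimeExpSumC_le (by positivity) ?_
  have : ((j : ℂ) * s).re = j * s.re := by
    simp
  rw [this]
  gcongr

lemma summable_semiprimeExpSumC_div {s : ℂ} (hs : 0 < s.re) :
    Summable fun j : ℕ+ => 1 / (j : ℂ) * semiprimeExpSumC (j * s) :=
  .of_norm_bounded (summable_semiprimeExpSum_div hs)
    (norm_div_semiprimeExpSumC_le hs le_rfl)

/-- Replacing finitely many terms of the series for `PhiP2C` by a norm bound. -/
lemma norm_PhiP2C_le {y : ℝ} (hy : 0 < y) {s : ℂ} (hs : y ≤ s.re) (t : Finset ℕ+) :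
    ‖PhiP2C (Complex.exp (-s))‖ ≤ ‖∑ j ∈ t, 1 / (j : ℂ) * semiprimeExpSumC (j * s)‖ +
      (PhiP2 (exp (-y)) - ∑ j ∈ t, 1 / (j : ℝ) * semiprimeExpSum (j * y)) := by
  have hR := summable_semiprimeExpSum_div hy
  have hC := summable_semiprimeExpSumC_div (hy.trans_le hs)
  rw [PhiP2C_exp_neg, PhiP2_exp_neg, ← hC.sum_add_tsum_subtype_compl t,
    ← hR.sum_add_tsum_subtype_compl t, add_sub_cancel_left]
  refine (norm_add_le _ _).trans (add_le_add_right ?_ _)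
  exact tsum_of_norm_bounded (hR.subtype _).hasSum
    fun j => norm_div_semiprimeExpSumC_le hy hs j

lemma semiprimeExpSum_antitone {x y : ℝ} (hx : 0 < x) (hxy : x ≤ y) :
    semiprimeExpSum y ≤ semiprimeExpSum x := by
  have h := norm_semiprimeExpSumC_le (s := y) hx (by simpa using hxy)
  rwa [semiprimeExpSumC_ofReal (hx.trans_le hxy), Complex.norm_real,
    Real.norm_of_nonneg (semiprimeExpSum_nonneg y)] at h

lemma semiprimeExpSum_pos_eventually : ∀ᶠ X : ℝ in atTop, 0 < semiprimeExpSum (1 / X) := by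
  obtain ⟨c, hc, h⟩ := scale_le_semiprimeExpSum
  filter_upwards [h, semiprimeScale_pos_eventually] with X h1 h2
  exact (mul_pos hc h2).trans_le h1

lemma tendsto_semiprimeExpSum_nat_mul_div (j : ℕ) (hj : 1 ≤ j) :
    Tendsto (fun X : ℝ => semiprimeExpSum (j * (1 / X)) / semiprimeExpSum (1 / X)) atTop
      (𝓝 (1 / j)) := by
  obtain ⟨c, hc, hcX⟩ := scale_le_semiprimeExpSum
  have hj1 : (1 : ℝ) ≤ j := by exact_mod_cast hj
  rw [Metric.tendsto_atTop']
  intro ε hε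
  obtain ⟨N, hN⟩ := eventually_atTop.mp
    ((semiprimeExpSumC_sub_le 1 (show (0 : ℝ) < j by linarith)
      (show 0 < ε / 2 * c by positivity)).and (hcX.and (semiprimeExpSum_pos_eventually.and
        (eventually_gt_atTop 0))))
  refine ⟨N, fun X hX => ?_⟩
  obtain ⟨h1, h2, h3, hX0⟩ := hN X hX.le
  have h4 := h1 j (by simpa using hj1) (by simp) 0 (isUnit_of_subsingleton _)
  have e1 : (j : ℂ) / X - 2 * π * Complex.I * ((0 : ℤ) / (1 : ℕ)) = ((j * (1 / X) : ℝ) : ℂ) := by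
    push_cast; ring
  have e2 : (ArithmeticFunction.moebius 1 : ℂ) / Nat.totient 1 * (semiprimeExpSum (1 / X) / j) =
      ((semiprimeExpSum (1 / X) / j : ℝ) : ℂ) := by
    simp
  rw [e1, semiprimeExpSumC_ofReal (by positivity), e2, ← Complex.ofReal_sub, Complex.norm_real,
    Real.norm_eq_abs] at h4
  rw [Real.dist_eq, show semiprimeExpSum (j * (1 / X)) / semiprimeExpSum (1 / X) - 1 / (j : ℝ) =
    (semiprimeExpSum (j * (1 / X)) - semiprimeExpSum (1 / X) / j) / semiprimeExpSum (1 / X) by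
      field_simp, abs_div, abs_of_pos h3, div_lt_iff₀ h3]
  nlinarith

lemma tendsto_PhiP2_div_semiprimeExpSum :
    Tendsto (fun X : ℝ => PhiP2 (exp (-(1 / X))) / semiprimeExpSum (1 / X)) atTop
      (𝓝 (π ^ 2 / 6)) := by
  obtain ⟨C, hC, hCX⟩ := semiprimeExpSum_nat_mul_le
  obtain ⟨c, hc, hcX⟩ := scale_le_semiprimeExpSum
  have hz : ∑' j : ℕ+, 1 / (j : ℝ) * (1 / (j : ℝ)) = π ^ 2 / 6 := by
    rw [← hasSum_zeta_two.tsum_eq, ← tsum_pnat_eq_tsum_of_eq_zero (f := fun n : ℕ => 1 / (n : ℝ) ^ 2) (by simp)]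
    exact tsum_congr fun j => by ring
  simp_rw [PhiP2_exp_neg, ← tsum_div_const, mul_div_assoc]
  rw [← hz]
  refine tendsto_tsum_of_dominated_convergence
    (bound := fun j : ℕ+ => C / c * (1 / (j : ℝ) ^ (3 / 2 : ℝ))) ?_ (fun j => ?_) ?_
  · exact ((Real.summable_one_div_nat_rpow.mpr (by norm_num)).comp_injective
      PNat.coe_injective).mul_left _
  · exact (tendsto_semiprimeExpSum_nat_mul_div j j.pos).const_mul _
  · filter_upwards [hCX, hcX, semiprimeExpSum_pos_eventually] with X h1 h2 h3 j
    have hj : (0 : ℝ) < j := by exact_mod_cast j.pos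
    rw [Real.norm_of_nonneg (mul_nonneg (by positivity)
      (div_nonneg (semiprimeExpSum_nonneg _) h3.le)),
      show (3 / 2 : ℝ) = 1 + 1 / 2 by norm_num, rpow_add hj, rpow_one, ← sqrt_eq_rpow]
    calc _ ≤ 1 / (j : ℝ) * (C * (semiprimeExpSum (1 / X) / c) / √j / semiprimeExpSum (1 / X)) := by
          gcongr
          refine (h1 j j.pos).trans ?_
          gcongr
          rwa [le_div_iff₀' hc]
      _ = _ := by field_simp

lemma PhiP2_le_semiprimeExpSum :
    ∀ᶠ X : ℝ in atTop, PhiP2 (exp (-(1 / X))) ≤ 1.7 * semiprimeExpSum (1 / X) := by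
  have hπ : π ^ 2 / 6 < 1.7 := by nlinarith [pi_lt_d2, pi_pos]
  filter_upwards [tendsto_PhiP2_div_semiprimeExpSum.eventually_lt_const hπ,
    semiprimeExpSum_pos_eventually] with X h1 h2
  exact ((div_lt_iff₀ h2).mp h1).le

/-- For denominator `2`, the first two terms of the series for `PhiP2C` nearly cancel the second
term of the series for `PhiP2`. -/
lemma norm_semiprimeExpSumC_add_half_le {ε : ℝ} (hε : 0 < ε) {A : ℝ} (hA : 0 < A) :
    ∀ᶠ X : ℝ in atTop, ∀ (b : ℤ) (τ : ℝ), IsUnit (b : ZMod 2) → |τ| ≤ log X ^ A →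
      |τ| ≤ log (X / 2) ^ A →
      ‖semiprimeExpSumC ((1 - τ * Complex.I) / X - 2 * π * Complex.I * (b / (2 : ℕ))) +
        1 / 2 * semiprimeExpSumC
          (2 * ((1 - τ * Complex.I) / X - 2 * π * Complex.I * (b / (2 : ℕ))))‖ ≤
        semiprimeExpSum (1 / X) - 1 / 2 * semiprimeExpSum (2 * (1 / X)) +
          ε * semiprimeExpSum (1 / X) := by
  obtain ⟨c, hc, hcX⟩ := scale_le_semiprimeExpSum
  have hδ : 0 < ε / 2 * c := by positivity
  have htwo : Tendsto (fun X : ℝ => X / 2) atTop atTop := tendsto_id.atTop_div_const two_pos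
  filter_upwards [semiprimeExpSumC_sub_le_uniform 2 hδ hA, hcX,
    htwo.eventually (semiprimeExpSumC_sub_le_uniform 1 hδ hA), htwo.eventually hcX,
    eventually_gt_atTop 0] with X h1 h2 h3 h4 hX b τ hb hτ hτ'
  set w : ℂ := 1 - τ * Complex.I with hw
  set s : ℂ := w / X - 2 * π * Complex.I * (b / (2 : ℕ)) with hs
  have hw1 : 1 ≤ ‖w‖ := by
    have hre : w.re = 1 := by simp [hw]
    exact hre.ge.trans (Complex.re_le_norm w)
  have hw0 : w ≠ 0 := norm_pos_iff.mp (by linarith)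
  have e1 : w / (X / 2 : ℝ) - 2 * π * Complex.I * (b / (1 : ℕ)) = 2 * s := by
    rw [hs]; push_cast; field_simp
  have e2 : 1 / (X / 2) = 2 * (1 / X) := by field_simp
  have h5 := h1 b τ hb hτ
  have h6 := h3 b τ (isUnit_of_subsingleton _) hτ'
  rw [← hw, e1, e2] at h6
  rw [← hw, ← hs] at h5
  rw [e2] at h4
  have h21 : semiprimeExpSum (2 * (1 / X)) ≤ semiprimeExpSum (1 / X) :=
    semiprimeExpSum_antitone (by positivity) (by linarith [show 0 < 1 / X by positivity])
  set F1 := semiprimeExpSum (1 / X)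
  set F2 := semiprimeExpSum (2 * (1 / X))
  have hF1 : 0 ≤ F1 := semiprimeExpSum_nonneg _
  have m1 : (ArithmeticFunction.moebius 1 : ℂ) / Nat.totient 1 * (F2 / w) = F2 / w := by simp
  have m2 : (ArithmeticFunction.moebius 2 : ℂ) / Nat.totient 2 * (F1 / w) = -(F1 / w) := by
    rw [ArithmeticFunction.moebius_apply_prime Nat.prime_two]; simp
  rw [m1] at h6
  rw [m2] at h5
  have h7 : ‖((-F1 + 1 / 2 * F2 : ℝ) : ℂ) / w‖ ≤ F1 - 1 / 2 * F2 := by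
    rw [norm_div, Complex.norm_real, Real.norm_of_nonpos (by linarith)]
    refine (div_le_self (by linarith) hw1).trans (by linarith)
  have e3 : semiprimeExpSumC s + 1 / 2 * semiprimeExpSumC (2 * s) =
      ((-F1 + 1 / 2 * F2 : ℝ) : ℂ) / w + (semiprimeExpSumC s - -(F1 / w)) +
        1 / 2 * (semiprimeExpSumC (2 * s) - F2 / w) := by
    push_cast; ring
  rw [e3]
  refine (norm_add₃_le).trans ?_
  have h8 : ‖1 / 2 * (semiprimeExpSumC (2 * s) - F2 / w)‖ ≤
      1 / 2 * (ε / 2 * c * semiprimeScale (X / 2)) := by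
    rw [norm_mul, show ‖(1 / 2 : ℂ)‖ = 1 / 2 by simp]
    gcongr
  have h9 : ε / 2 * (c * semiprimeScale X) ≤ ε / 2 * F1 := by gcongr
  have h10 : ε / 2 * (c * semiprimeScale (X / 2)) ≤ ε / 2 * F1 := by
    gcongr
    exact h4.trans h21
  linarith [mul_nonneg hε.le hF1]

lemma eventually_mul_log_rpow_le (K : ℝ) {A : ℝ} (hA : 0 < A) :
    ∀ᶠ X : ℝ in atTop, K * log X ^ A ≤ log (X / 2) ^ (A + 1) := by
  have hlog : Tendsto (fun X : ℝ => log (X / 2)) atTop atTop :=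
    Real.tendsto_log_atTop.comp (tendsto_id.atTop_div_const two_pos)
  filter_upwards [hlog.eventually_ge_atTop (|K| * 2 ^ A), hlog.eventually_ge_atTop 1,
    eventually_ge_atTop 4] with X h1 h2 h3
  have h4 : log X = log (X / 2) + log 2 := by
    rw [log_div (by linarith) two_ne_zero]; ring
  have h5 : log 2 ≤ log (X / 2) := log_le_log two_pos (by linarith)
  have h6 : 0 ≤ log X := log_nonneg (by linarith)
  calc K * log X ^ A ≤ |K| * (2 * log (X / 2)) ^ A := by
        gcongr
        · exact le_abs_self K
        · linarith
    _ = |K| * 2 ^ A * log (X / 2) ^ A := by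
        rw [mul_rpow two_pos.le (by linarith)]; ring
    _ ≤ log (X / 2) * log (X / 2) ^ A := by gcongr
    _ = _ := by rw [rpow_add_one (by linarith), mul_comm]

/-- Lemma 7.4 (the non-principal major arcs do not contribute): for `A > 18`,
`2 ≤ q ≤ (log X)^A`, `(a,q) = 1`, `ρ = e^{−1/X}` and all sufficiently large `X`, for
every `α` in the major arc `𝔐(q,a) = (a/q − δ_q, a/q + δ_q)` with
`δ_q = q⁻¹X⁻¹(log X)^A`, one has `|Re(Φ(ρe(α)))| ≤ (3/4)Φ(ρ)`. -/
theorem nonprincipal_major_arc_bound (A : ℝ) (hA : 18 < A) :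
    ∃ X₀ : ℝ, ∀ X : ℝ, X₀ ≤ X →
      ∀ (a : ℤ) (q : ℕ) (α : ℝ), 2 ≤ q → (q : ℝ) ≤ (Real.log X) ^ A →
        Int.gcd a q = 1 →
        |α - (a : ℝ)/(q : ℝ)| < (Real.log X) ^ A / ((q : ℝ) * X) →
        |(PhiP2C ((Real.exp (-1/X) : ℝ) * eC α)).re| ≤
          (3/4) * PhiP2 (Real.exp (-1/X)) := by
  have hA0 : 0 < A := by linarith
  obtain ⟨c, hc, hcX⟩ := scale_le_semiprimeExpSum
  rw [← eventually_atTop]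
  filter_upwards [hcX, norm_semiprimeExpSumC_le_half (show 0 < c / 20 by positivity) (A + 1),
    norm_semiprimeExpSumC_add_half_le (show (0 : ℝ) < 1 / 50 by norm_num)
      (show 0 < A + 1 by linarith), eventually_mul_log_rpow_le (2 * π) hA0,
    (tendsto_semiprimeExpSum_nat_mul_div 2 one_le_two).eventually_const_lt
      (show (47 / 100 : ℝ) < 1 / (2 : ℕ) by norm_num), PhiP2_le_semiprimeExpSum,
    semiprimeExpSum_pos_eventually, eventually_ge_atTop 2]
    with X hscale hodd htwo hlog hhalf hΦ hF hX a q α hq2 hqA hgcd hα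
  have hX0 : 0 < X := by linarith
  have hq0 : (0 : ℝ) < q := by exact_mod_cast (by omega : 0 < q)
  have hq1 : (1 : ℝ) ≤ q := by exact_mod_cast (by omega : 1 ≤ q)
  have ha : IsUnit (a : ZMod q) := (ZMod.coe_int_isUnit_iff_isCoprime a q).mpr
    (Int.isCoprime_iff_gcd_eq_one.mpr (by rwa [Int.gcd_comm]))
  set τ : ℝ := 2 * π * X * (α - a / q) with hτdef
  set s : ℂ := (1 - τ * Complex.I) / X - 2 * π * Complex.I * (a / q) with hs
  have hτ0 : |τ| ≤ 2 * π * log X ^ A := by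
    rw [hτdef, abs_mul, abs_of_pos (by positivity)]
    calc 2 * π * X * |α - a / q| ≤ 2 * π * X * (log X ^ A / (1 * X)) := by
          gcongr
          refine hα.le.trans ?_
          have : 0 ≤ log X ^ A := hq0.le.trans hqA
          gcongr
      _ = _ := by field_simp
  have hτ2 := hτ0.trans hlog
  have hlog2 : log (X / 2) ^ (A + 1) ≤ log X ^ (A + 1) := by
    have : 0 ≤ log (X / 2) := log_nonneg (by linarith)
    gcongr
    linarith
  have hτ1 := hτ2.trans hlog2
  have hqA1 : (q : ℝ) ≤ log X ^ (A + 1) := by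
    refine hqA.trans (le_trans ?_ (hlog.trans hlog2))
    have : 0 ≤ log X ^ A := hq0.le.trans hqA
    nlinarith [pi_gt_three]
  have hz : (exp (-1 / X) : ℝ) * eC α = Complex.exp (-s) := by
    rw [eC, Complex.ofReal_exp, ← Complex.exp_add, hs, hτdef]
    congr 1
    have : (X : ℂ) ≠ 0 := by exact_mod_cast hX0.ne'
    push_cast
    field_simp
    ring
  have hsre : 1 / X ≤ s.re := by
    have := re_div_sub_two_pi_mul_I (w := 1 - τ * Complex.I) (X := X) (y := a / q)
    push_cast at this
    rw [hs, this]
    simp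
  have hy : 0 < 1 / X := by positivity
  rw [hz, neg_div]
  refine (Complex.abs_re_le_norm _).trans ?_
  rcases hq2.eq_or_lt with rfl | hq3
  · have h1 := norm_PhiP2C_le hy hsre {1, 2}
    have h12 : (1 : ℕ+) ≠ 2 := by decide
    rw [Finset.sum_pair h12, Finset.sum_pair h12] at h1
    simp only [PNat.val_ofNat, Nat.cast_one, Nat.cast_ofNat, div_one, one_mul] at h1
    have h2 := htwo a τ ha hτ1 hτ2
    rw [← hs] at h2
    rw [lt_div_iff₀ hF, Nat.cast_ofNat] at hhalf
    linarith
  · have : NeZero q := ⟨by omega⟩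
    have h1 := norm_PhiP2C_le hy hsre {1}
    rw [Finset.sum_singleton, Finset.sum_singleton] at h1
    simp only [PNat.one_coe, Nat.cast_one, div_one, one_mul] at h1
    have h2 := hodd q a τ hq3 ha hqA1 hτ1
    rw [← hs] at h2
    linarith

end
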